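/- Let C ⊂ ℙ² be a smooth plane cubic over a field k with char(k) ≠ 3, and T_C ⊂ (ℙ²)∨ its set of nine inflection lines. There is a unique geometrically integral curve C′ ⊂ (ℙ²)∨ such that: if char(k) ≠ 2, C′ is a sextic with cusps at all points of T_C; if char(k) = 2 and j(C) ≠ 0, C′ is a cubic containing T_C; if char(k) = 2 and j(C) = 0, C′ is a cubic containing T_C with vanishing j-invariant. Moreover, the linear system of cubics in (ℙ²)∨ containing T_C has dimension one if and only if (char(k), j(C)) = (2,0). In all cases C′ is the dual curve of C. -/

import Mathlib

/-!
STATEMENT 2 (Pacini–Testa, Theorem `n3`, Reconstruction Theorem): let `C ⊂ ℙ²` be a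
smooth plane cubic over a field `k` with `char k ≠ 3` and let `T_C ⊂ (ℙ²)∨` be its set
of inflection lines.  There is a unique geometrically integral curve `C′ ⊂ (ℙ²)∨`
(given by a form `G` over `k`, unique up to a nonzero scalar) such that:
* if `char k ≠ 2`, `C′` is a sextic with cusps at all points of `T_C`;
* if `char k = 2` and `j(C) ≠ 0`, `C′` is a cubic containing `T_C`;
* if `char k = 2` and `j(C) = 0`, `C′` is a cubic containing `T_C` with `j(C′) = 0`.
Moreover the linear system of cubics in `(ℙ²)∨` through `T_C` has (projective)
dimension one — i.e. the space of such cubic forms has `k`-dimension 2 — iff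
`(char k, j(C)) = (2, 0)`.  In all cases `C′` is the dual curve of `C` (the unique
geometrically integral curve through the image of the Gauss map of `C`).

A cusp is a singular point with complete local ring `k[[x,y]]/(y²−x³)`, formalized (in
the relevant characteristics ≠ 2,3) by: the Hessian quadratic form has rank 1 and the
third-order form does not vanish on the kernel direction.  "`j(C) = 0`" is formalized
as: over the algebraic closure, `C` is projectively equivalent to a Weierstrass cubic
with `j`-invariant `0`.
-/

open MvPolynomial Polynomial

noncomputable section

namespace Infl

variable {K : Type*} [Field K]

def dotv (w p : Fin 3 → K) : K := ∑ i, w i * p i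

def lineRestrict (F : MvPolynomial (Fin 3) K) (a b : Fin 3 → K) : Polynomial K :=
  MvPolynomial.aeval (fun i => Polynomial.C (a i) + Polynomial.C (b i) * Polynomial.X) F

def contactAt (F : MvPolynomial (Fin 3) K) (a b : Fin 3 → K) : ℕ :=
  (lineRestrict F a b).rootMultiplicity 0

def IsSmoothCurve (F : MvPolynomial (Fin 3) K) (d : ℕ) : Prop :=
  F.IsHomogeneous d ∧ F ≠ 0 ∧
    ∀ p : Fin 3 → K, p ≠ 0 → eval p F = 0 → ∃ i, eval p (pderiv i F) ≠ 0

def IsInflLine (F : MvPolynomial (Fin 3) K) (w : Fin 3 → K) : Prop :=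
  w ≠ 0 ∧ ∃ a b : Fin 3 → K, dotv w a = 0 ∧ dotv w b = 0 ∧
    LinearIndependent K ![a, b] ∧ lineRestrict F a b ≠ 0 ∧ 3 ≤ contactAt F a b

def SingAt (F : MvPolynomial (Fin 3) K) (p : Fin 3 → K) : Prop :=
  eval p F = 0 ∧ ∀ i, eval p (pderiv i F) = 0

def hessMat (F : MvPolynomial (Fin 3) K) (p : Fin 3 → K) : Matrix (Fin 3) (Fin 3) K :=
  Matrix.of fun i j => eval p (pderiv i (pderiv j F))

def cubicForm (F : MvPolynomial (Fin 3) K) (p v : Fin 3 → K) : K :=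
  ∑ i, ∑ j, ∑ l, eval p (pderiv i (pderiv j (pderiv l F))) * v i * v j * v l

def IsCuspAt (F : MvPolynomial (Fin 3) K) (p : Fin 3 → K) : Prop :=
  SingAt F p ∧ (hessMat F p).rank = 1 ∧
    ∀ v, (hessMat F p).mulVec v = 0 → LinearIndependent K ![p, v] → cubicForm F p v ≠ 0

def gradVec (F : MvPolynomial (Fin 3) K) (p : Fin 3 → K) : Fin 3 → K :=
  fun i => eval p (pderiv i F)

/-- `G` vanishes on the image of the Gauss map of the smooth curve `F`: it contains all
tangent lines of `{F = 0}` — together with geometric integrality this characterizes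
(an equation of) the dual curve of `F`. -/
def ContainsGaussImage (G F : MvPolynomial (Fin 3) K) : Prop :=
  ∀ p : Fin 3 → K, p ≠ 0 → eval p F = 0 → eval (gradVec F p) G = 0

variable {k : Type*} [Field k]

def bar (F : MvPolynomial (Fin 3) k) : MvPolynomial (Fin 3) (AlgebraicClosure k) :=
  MvPolynomial.map (algebraMap k (AlgebraicClosure k)) F

def wpoly (W : WeierstrassCurve K) : MvPolynomial (Fin 3) K :=
  X 1 ^ 2 * X 2 + MvPolynomial.C W.a₁ * X 0 * X 1 * X 2 + MvPolynomial.C W.a₃ * X 1 * X 2 ^ 2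
    - X 0 ^ 3 - MvPolynomial.C W.a₂ * X 0 ^ 2 * X 2 - MvPolynomial.C W.a₄ * X 0 * X 2 ^ 2
    - MvPolynomial.C W.a₆ * X 2 ^ 3

def transformPoly (g : Matrix (Fin 3) (Fin 3) K) (F : MvPolynomial (Fin 3) K) :
    MvPolynomial (Fin 3) K :=
  MvPolynomial.aeval (fun i => ∑ j, MvPolynomial.C (g i j) * X j) F

/-- The plane cubic `F` has `j`-invariant zero. -/
def HasJZero (F : MvPolynomial (Fin 3) k) : Prop :=
  ∃ (W : WeierstrassCurve (AlgebraicClosure k)) (hW : W.IsElliptic)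
    (g : GL (Fin 3) (AlgebraicClosure k)) (c : (AlgebraicClosure k)ˣ),
      (letI := hW; W.j = 0) ∧
      transformPoly (g : Matrix (Fin 3) (Fin 3) (AlgebraicClosure k)) (bar F) =
        (c : AlgebraicClosure k) • wpoly W

/-- The `k`-vector space of ternary cubics (in the dual plane) vanishing at all points
of `T_C`, the set of inflection lines of `{F = 0}`. -/
def cubicsThroughTC (F : MvPolynomial (Fin 3) k) : Submodule k (MvPolynomial (Fin 3) k) :=
  (homogeneousSubmodule (Fin 3) k 3) ⊓
    ⨅ w ∈ {w : Fin 3 → AlgebraicClosure k | IsInflLine (bar F) w},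
      LinearMap.ker ((MvPolynomial.aeval (R := k) w).toLinearMap)

/-- The three case conditions on the curve `C′` in the Reconstruction Theorem. -/
def ReconstructionCond (F G : MvPolynomial (Fin 3) k) : Prop :=
  ((2 : k) ≠ 0 →
    G.IsHomogeneous 6 ∧
      ∀ w : Fin 3 → AlgebraicClosure k, IsInflLine (bar F) w → IsCuspAt (bar G) w) ∧
  ((2 : k) = 0 →
    G.IsHomogeneous 3 ∧
      (∀ w : Fin 3 → AlgebraicClosure k, IsInflLine (bar F) w → eval w (bar G) = 0) ∧
      (HasJZero F → HasJZero G))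


/-! ### Linear substitutions -/

abbrev ggrad (F : MvPolynomial (Fin 3) K) : Fin 3 → MvPolynomial (Fin 3) K := fun i => pderiv i F

theorem eval_transformPoly (g : Matrix (Fin 3) (Fin 3) K) (F : MvPolynomial (Fin 3) K)
    (p : Fin 3 → K) : eval p (transformPoly g F) = eval (g.mulVec p) F := by
  have h : (MvPolynomial.aeval p : MvPolynomial (Fin 3) K →ₐ[K] K).comp
      (MvPolynomial.aeval (fun i => ∑ j, MvPolynomial.C (g i j) * X j)) =
      MvPolynomial.aeval (g.mulVec p) := by
    apply MvPolynomial.algHom_ext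
    intro i
    simp [Matrix.mulVec, dotProduct]
  have := DFunLike.congr_fun h F
  simpa [transformPoly, MvPolynomial.aeval_eq_eval] using this

theorem transformPoly_mul (g : Matrix (Fin 3) (Fin 3) K) (F G : MvPolynomial (Fin 3) K) :
    transformPoly g (F * G) = transformPoly g F * transformPoly g G := map_mul _ _ _

theorem transformPoly_add (g : Matrix (Fin 3) (Fin 3) K) (F G : MvPolynomial (Fin 3) K) :
    transformPoly g (F + G) = transformPoly g F + transformPoly g G := map_add _ _ _

theorem transformPoly_smul (g : Matrix (Fin 3) (Fin 3) K) (c : K) (F : MvPolynomial (Fin 3) K) :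
    transformPoly g (c • F) = c • transformPoly g F := map_smul _ _ _

theorem transformPoly_comp (g h : Matrix (Fin 3) (Fin 3) K) (F : MvPolynomial (Fin 3) K) :
    transformPoly g (transformPoly h F) = transformPoly (h * g) F := by
  have h : (MvPolynomial.aeval (fun i => ∑ j, MvPolynomial.C (g i j) * X j) :
      MvPolynomial (Fin 3) K →ₐ[K] MvPolynomial (Fin 3) K).comp
      (MvPolynomial.aeval (fun i => ∑ j, MvPolynomial.C (h i j) * X j)) =
      MvPolynomial.aeval (fun i => ∑ j, MvPolynomial.C ((h * g) i j) * X j) := by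
    apply MvPolynomial.algHom_ext
    intro i
    simp only [AlgHom.comp_apply, MvPolynomial.aeval_X, map_add, map_mul, Matrix.mul_apply,
      MvPolynomial.algHom_C, MvPolynomial.algebraMap_eq, Fin.sum_univ_three]
    ring
  exact DFunLike.congr_fun h F

theorem transformPoly_one (F : MvPolynomial (Fin 3) K) :
    transformPoly (1 : Matrix (Fin 3) (Fin 3) K) F = F := by
  have h : (MvPolynomial.aeval (fun i => ∑ j, MvPolynomial.C ((1 : Matrix (Fin 3) (Fin 3) K) i j) * X j) :
      MvPolynomial (Fin 3) K →ₐ[K] MvPolynomial (Fin 3) K) = AlgHom.id _ _ := by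
    apply MvPolynomial.algHom_ext
    intro i
    fin_cases i <;> simp [Fin.sum_univ_three, Matrix.one_apply]
  exact DFunLike.congr_fun h F

theorem transformPoly_inv_left {g h : Matrix (Fin 3) (Fin 3) K} (hg : g * h = 1)
    (F : MvPolynomial (Fin 3) K) : transformPoly h (transformPoly g F) = F := by
  rw [transformPoly_comp, hg, transformPoly_one]

theorem transformPoly_isHomogeneous (g : Matrix (Fin 3) (Fin 3) K) {F : MvPolynomial (Fin 3) K}
    {d : ℕ} (hF : F.IsHomogeneous d) : (transformPoly g F).IsHomogeneous d := by
  have := hF.aeval (fun i => ∑ j, MvPolynomial.C (g i j) * X j : Fin 3 → MvPolynomial (Fin 3) K)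
    (n := 1) (fun i => IsHomogeneous.sum _ _ _ fun j _ => isHomogeneous_C_mul_X _ _)
  simpa [transformPoly] using this

theorem pderiv_transformPoly (g : Matrix (Fin 3) (Fin 3) K) (F : MvPolynomial (Fin 3) K)
    (i : Fin 3) : pderiv i (transformPoly g F) =
      ∑ j, MvPolynomial.C (g j i) * transformPoly g (pderiv j F) := by
  induction F using MvPolynomial.induction_on with
  | C a => simp [transformPoly]
  | add p q hp hq =>
    simp only [transformPoly_add, map_add, hp, hq, mul_add, Finset.sum_add_distrib]
  | mul_X p n hp =>
    have hX : transformPoly g (X n) = ∑ j, MvPolynomial.C (g n j) * X j := by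
      simp [transformPoly]
    have hdX : pderiv i (transformPoly g (X n)) = MvPolynomial.C (g n i) := by
      rw [hX]
      fin_cases i <;> simp [Fin.sum_univ_three, pderiv_X]
    rw [transformPoly_mul, Derivation.leibniz, hp, hdX]
    simp only [Derivation.leibniz, smul_eq_mul, transformPoly_add, transformPoly_mul, pderiv_X]
    simp only [Fin.sum_univ_three]
    fin_cases n <;> simp [transformPoly] <;> ring

theorem gradVec_transformPoly (g : Matrix (Fin 3) (Fin 3) K) (F : MvPolynomial (Fin 3) K)
    (p : Fin 3 → K) : gradVec (transformPoly g F) p =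
      g.transpose.mulVec (gradVec F (g.mulVec p)) := by
  funext i
  simp [gradVec, pderiv_transformPoly, eval_transformPoly, Matrix.mulVec, dotProduct]

theorem hessMat_transformPoly (g : Matrix (Fin 3) (Fin 3) K) (F : MvPolynomial (Fin 3) K)
    (p : Fin 3 → K) : hessMat (transformPoly g F) p =
      g.transpose * hessMat F (g.mulVec p) * g := by
  ext i j
  simp only [hessMat, pderiv_transformPoly, Matrix.of_apply, map_add, Derivation.leibniz,
    pderiv_C, smul_zero, map_zero, mul_zero, add_zero, smul_eq_mul, map_mul, MvPolynomial.eval_C, eval_transformPoly,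
    Matrix.mul_apply, Matrix.transpose_apply, Fin.sum_univ_three]
  ring

/-- Directional derivative. -/
def dirD (v : Fin 3 → K) (F : MvPolynomial (Fin 3) K) : MvPolynomial (Fin 3) K :=
  ∑ i, MvPolynomial.C (v i) * pderiv i F

theorem dirD_transformPoly (g : Matrix (Fin 3) (Fin 3) K) (F : MvPolynomial (Fin 3) K)
    (v : Fin 3 → K) : dirD v (transformPoly g F) = transformPoly g (dirD (g.mulVec v) F) := by
  have hC : ∀ c : K, transformPoly g (MvPolynomial.C c) = MvPolynomial.C c := by
    intro c; simp [transformPoly]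
  simp only [dirD, pderiv_transformPoly, Fin.sum_univ_three, transformPoly_add, transformPoly_mul,
    hC, Matrix.mulVec, dotProduct, map_add, map_mul]
  ring

theorem cubicForm_eq_dirD (F : MvPolynomial (Fin 3) K) (p v : Fin 3 → K) :
    cubicForm F p v = eval p (dirD v (dirD v (dirD v F))) := by
  simp only [cubicForm, dirD, map_add, Fin.sum_univ_three, Derivation.leibniz,
    pderiv_C, smul_zero, map_zero, mul_zero, add_zero, smul_eq_mul, map_mul, MvPolynomial.eval_C]
  ring

theorem cubicForm_transformPoly (g : Matrix (Fin 3) (Fin 3) K) (F : MvPolynomial (Fin 3) K)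
    (p v : Fin 3 → K) : cubicForm (transformPoly g F) p v =
      cubicForm F (g.mulVec p) (g.mulVec v) := by
  simp only [cubicForm_eq_dirD, dirD_transformPoly, eval_transformPoly]

theorem lineRestrict_transformPoly (g : Matrix (Fin 3) (Fin 3) K) (F : MvPolynomial (Fin 3) K)
    (a b : Fin 3 → K) : lineRestrict (transformPoly g F) a b =
      lineRestrict F (g.mulVec a) (g.mulVec b) := by
  have h : (MvPolynomial.aeval (fun i => Polynomial.C (a i) + Polynomial.C (b i) * Polynomial.X) :
      MvPolynomial (Fin 3) K →ₐ[K] Polynomial K).comp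
      (MvPolynomial.aeval (fun i => ∑ j, MvPolynomial.C (g i j) * X j)) =
      MvPolynomial.aeval (fun i => Polynomial.C (g.mulVec a i) +
        Polynomial.C (g.mulVec b i) * Polynomial.X) := by
    apply MvPolynomial.algHom_ext
    intro i
    simp [Matrix.mulVec, dotProduct, Fin.sum_univ_three]
    ring
  exact DFunLike.congr_fun h F

theorem transformPoly_irreducible {g h : Matrix (Fin 3) (Fin 3) K} (hg : g * h = 1)
    (hh : h * g = 1) {F : MvPolynomial (Fin 3) K} (hF : Irreducible F) :
    Irreducible (transformPoly g F) := by
  let e : MvPolynomial (Fin 3) K ≃* MvPolynomial (Fin 3) K :=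
    { toFun := transformPoly g
      invFun := transformPoly h
      left_inv := transformPoly_inv_left hg
      right_inv := transformPoly_inv_left hh
      map_mul' := transformPoly_mul g }
  exact (MulEquiv.irreducible_iff e).2 hF

theorem transformPoly_smul_one {d : ℕ} {F : MvPolynomial (Fin 3) K} (hF : F.IsHomogeneous d)
    (c : K) : transformPoly (c • (1 : Matrix (Fin 3) (Fin 3) K)) F = c ^ d • F := by
  have key : ∀ m : Fin 3 →₀ ℕ, ∀ a : K, transformPoly (c • (1 : Matrix (Fin 3) (Fin 3) K))
      (monomial m a) = c ^ m.degree • monomial m a := by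
    intro m a
    have : ∀ i : Fin 3, (∑ j, MvPolynomial.C ((c • (1 : Matrix (Fin 3) (Fin 3) K)) i j) * X j :
        MvPolynomial (Fin 3) K) = MvPolynomial.C c * X i := by
      intro i; fin_cases i <;> simp [Fin.sum_univ_three, Matrix.one_apply]
    simp only [transformPoly, this, MvPolynomial.aeval_monomial, mul_pow, MvPolynomial.smul_eq_C_mul]
    rw [MvPolynomial.monomial_eq, Finsupp.degree_eq_sum]
    simp [Finsupp.prod_fintype, Fin.prod_univ_three, Fin.sum_univ_three, pow_add,
      MvPolynomial.algebraMap_eq]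
    ring
  conv_lhs => rw [F.as_sum]
  conv_rhs => rw [F.as_sum]
  rw [Finset.smul_sum]
  simp only [transformPoly, map_sum]
  refine Finset.sum_congr rfl fun m hm => ?_
  have h1 := key m (coeff m F)
  rw [transformPoly] at h1
  rw [h1]
  have : m.degree = d := by
    by_contra hne
    exact (MvPolynomial.mem_support_iff.1 hm) (hF.coeff_eq_zero hne)
  rw [this]

/-! ### Coefficientwise application of a linear functional -/

def mapc {L : Type*} [Field L] [Algebra k L] (φ : L →ₗ[k] k) (P : MvPolynomial (Fin 3) L) :
    MvPolynomial (Fin 3) k := ∑ m ∈ P.support, monomial m (φ (coeff m P))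

section mapc
variable {L : Type*} [Field L] [Algebra k L] (φ : L →ₗ[k] k)

theorem coeff_mapc (P : MvPolynomial (Fin 3) L) (m : Fin 3 →₀ ℕ) :
    coeff m (mapc φ P) = φ (coeff m P) := by
  classical
  simp only [mapc, MvPolynomial.coeff_sum, MvPolynomial.coeff_monomial, Finset.sum_ite_eq']
  split_ifs with h
  · rfl
  · rw [MvPolynomial.notMem_support_iff.1 h, map_zero]

theorem mapc_add (P Q : MvPolynomial (Fin 3) L) : mapc φ (P + Q) = mapc φ P + mapc φ Q := by
  ext m; simp [coeff_mapc]

theorem mapc_zero : mapc φ (0 : MvPolynomial (Fin 3) L) = 0 := by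
  ext m; simp [coeff_mapc]

theorem mapc_monomial (m : Fin 3 →₀ ℕ) (c : L) : mapc φ (monomial m c) = monomial m (φ c) := by
  classical
  ext n; simp only [coeff_mapc, MvPolynomial.coeff_monomial]; split_ifs <;> simp

theorem mapc_map_mul (A : MvPolynomial (Fin 3) k) (P : MvPolynomial (Fin 3) L) :
    mapc φ (MvPolynomial.map (algebraMap k L) A * P) = A * mapc φ P := by
  classical
  ext m
  simp only [coeff_mapc, MvPolynomial.coeff_mul, MvPolynomial.coeff_map, map_sum]
  refine Finset.sum_congr rfl fun x _ => ?_
  rw [← Algebra.smul_def, map_smul, smul_eq_mul]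

theorem mapc_aeval (v : Fin 3 → MvPolynomial (Fin 3) k) (P : MvPolynomial (Fin 3) L) :
    mapc φ (MvPolynomial.aeval (fun i => MvPolynomial.map (algebraMap k L) (v i)) P) =
      MvPolynomial.aeval v (mapc φ P) := by
  induction P using MvPolynomial.induction_on' with
  | monomial m c =>
    have h1 : (MvPolynomial.aeval (fun i => MvPolynomial.map (algebraMap k L) (v i))
        (monomial m c) : MvPolynomial (Fin 3) L) =
        MvPolynomial.map (algebraMap k L) (m.prod fun i e => v i ^ e) * MvPolynomial.monomial 0 c := by
      rw [MvPolynomial.aeval_monomial, Finsupp.prod, Finsupp.prod, map_prod, mul_comm]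
      simp [MvPolynomial.algebraMap_eq]
    rw [h1, mapc_map_mul, mapc_monomial, mapc_monomial, MvPolynomial.aeval_monomial, mul_comm]
    rfl
  | add p q hp hq => rw [map_add, mapc_add, hp, hq, mapc_add, map_add]

theorem mapc_isHomogeneous {P : MvPolynomial (Fin 3) L} {d : ℕ} (hP : P.IsHomogeneous d) :
    (mapc φ P).IsHomogeneous d := by
  intro m hm
  apply hP
  intro h
  apply hm
  rw [coeff_mapc, h, map_zero]

theorem mapc_smul_map (c : L) (A : MvPolynomial (Fin 3) k) :
    mapc φ (c • MvPolynomial.map (algebraMap k L) A) = φ c • A := by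
  rw [MvPolynomial.smul_eq_C_mul, mul_comm, mapc_map_mul, MvPolynomial.smul_eq_C_mul, mul_comm]
  congr 1
  exact mapc_monomial φ 0 c

end mapc

theorem exists_functional {L : Type*} [Field L] [Algebra k L] {x : L} (hx : x ≠ 0) :
    ∃ φ : L →ₗ[k] k, φ x ≠ 0 := by
  by_contra! h
  exact hx ((Module.forall_dual_apply_eq_zero_iff k x).1 h)

theorem exists_mapc_ne_zero {L : Type*} [Field L] [Algebra k L] {P : MvPolynomial (Fin 3) L}
    (hP : P ≠ 0) : ∃ φ : L →ₗ[k] k, mapc φ P ≠ 0 := by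
  obtain ⟨m, hm⟩ := MvPolynomial.ne_zero_iff.1 hP
  obtain ⟨φ, hφ⟩ := exists_functional (k := k) hm
  exact ⟨φ, fun h => hφ (by rw [← coeff_mapc, h, MvPolynomial.coeff_zero])⟩

theorem bar_linearIndependent {n : ℕ} {b : Fin n → MvPolynomial (Fin 3) k}
    (hb : LinearIndependent k b) :
    LinearIndependent (AlgebraicClosure k) (fun i => bar (b i)) := by
  rw [Fintype.linearIndependent_iff] at hb ⊢
  intro c hc i
  rw [← Module.forall_dual_apply_eq_zero_iff k]
  intro φ
  have h1 : ∀ s : Finset (Fin n), mapc φ (∑ i ∈ s, c i • bar (b i)) = ∑ i ∈ s, φ (c i) • b i := by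
    intro s
    induction s using Finset.cons_induction with
    | empty => simp [mapc_zero]
    | cons a s ha ih => rw [Finset.sum_cons, mapc_add, ih, Finset.sum_cons, bar, mapc_smul_map]
  have h2 := h1 Finset.univ
  rw [hc, mapc_zero] at h2
  exact hb (fun i => φ (c i)) h2.symm i

theorem bar_injective : Function.Injective (bar : MvPolynomial (Fin 3) k → _) :=
  MvPolynomial.map_injective _ (algebraMap k (AlgebraicClosure k)).injective

/-- Proportionality over the algebraic closure descends. -/
theorem descend_smul {G G' : MvPolynomial (Fin 3) k} (hG' : G' ≠ 0) {c : AlgebraicClosure k}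
    (h : bar G' = c • bar G) : ∃ d : k, d ≠ 0 ∧ G' = d • G := by
  have hb : bar G' ≠ 0 := fun h0 => hG' (bar_injective (by rw [h0]; simp [bar]))
  obtain ⟨φ, hφ⟩ := exists_functional (k := k) (one_ne_zero (α := AlgebraicClosure k))
  have h1 : mapc φ (bar G') = φ 1 • G' := by
    have := mapc_smul_map φ (1 : AlgebraicClosure k) G'
    rwa [one_smul] at this
  have h2 : mapc φ (bar G') = φ c • G := by rw [h]; exact mapc_smul_map φ c G
  have h3 : G' = ((φ 1)⁻¹ * φ c) • G := by
    rw [mul_smul, ← h2, h1, smul_smul, inv_mul_cancel₀ hφ, one_smul]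
  refine ⟨_, ?_, h3⟩
  intro h0
  rw [h0, zero_smul] at h3
  exact hG' h3

/-! ### Two forms in three variables have a common zero -/

theorem exists_common_zero [IsAlgClosed K] {A B : MvPolynomial (Fin 3) K}
    (hA : eval 0 A = 0) (hB : eval 0 B = 0) :
    ∃ p : Fin 3 → K, p ≠ 0 ∧ eval p A = 0 ∧ eval p B = 0 := by
  by_contra! hcon
  let f1 : MvPolynomial (Fin 3) K →ₐ[K] MvPolynomial (Fin 3) K := MvPolynomial.aeval ![0, X 1, X 2]
  let f2 : MvPolynomial (Fin 3) K →ₐ[K] MvPolynomial (Fin 3) K := MvPolynomial.aeval ![0, 0, X 2]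
  let f3 : MvPolynomial (Fin 3) K →ₐ[K] K := MvPolynomial.aeval 0
  let P1 := RingHom.ker f1
  let P2 := RingHom.ker f2
  let P3 := RingHom.ker f3
  haveI : P1.IsPrime := RingHom.ker_isPrime f1
  haveI : P2.IsPrime := RingHom.ker_isPrime f2
  haveI : P3.IsPrime := RingHom.ker_isPrime f3
  have h12 : f2.comp f1 = f2 := by
    apply MvPolynomial.algHom_ext
    intro i
    fin_cases i <;> simp [f1, f2]
  have h23 : f3.comp f2 = f3 := by
    apply MvPolynomial.algHom_ext
    intro i
    fin_cases i <;> simp [f3, f2]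
  have l1 : (⊥ : Ideal (MvPolynomial (Fin 3) K)) < P1 := by
    refine SetLike.lt_iff_le_and_exists.2 ⟨bot_le, X 0, ?_, ?_⟩
    · simp [P1, RingHom.mem_ker, f1]
    · simp
  have l2 : P1 < P2 := by
    refine SetLike.lt_iff_le_and_exists.2 ⟨?_, X 1, ?_, ?_⟩
    · intro x hx
      simp only [P1, P2, RingHom.mem_ker] at hx ⊢
      rw [← h12, AlgHom.comp_apply, hx, map_zero]
    · simp [P2, RingHom.mem_ker, f2]
    · simp [P1, RingHom.mem_ker, f1]
  have l3 : P2 < P3 := by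
    refine SetLike.lt_iff_le_and_exists.2 ⟨?_, X 2, ?_, ?_⟩
    · intro x hx
      simp only [P3, P2, RingHom.mem_ker] at hx ⊢
      rw [← h23, AlgHom.comp_apply, hx, map_zero]
    · simp [P3, RingHom.mem_ker, f3]
    · simp [P2, RingHom.mem_ker, f2]
  haveI : (⊥ : Ideal (MvPolynomial (Fin 3) K)).IsPrime := Ideal.isPrime_bot
  have e1 := Ideal.height_add_one_le_of_lt_of_isPrime l1
  have e2 := Ideal.height_add_one_le_of_lt_of_isPrime l2
  have e3 := Ideal.height_add_one_le_of_lt_of_isPrime l3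
  have hht : (3 : ℕ∞) ≤ P3.height := by
    calc (3 : ℕ∞) = 0 + 1 + 1 + 1 := by norm_num
      _ ≤ (⊥ : Ideal (MvPolynomial (Fin 3) K)).height + 1 + 1 + 1 := by gcongr; exact bot_le
      _ ≤ P1.height + 1 + 1 := by gcongr
      _ ≤ P2.height + 1 := by gcongr
      _ ≤ _ := e3
  have hrad : P3 ≤ (Ideal.span {A, B}).radical := by
    rw [← MvPolynomial.vanishingIdeal_zeroLocus_eq_radical (K := K)]
    intro q hq
    rw [MvPolynomial.mem_vanishingIdeal_iff]
    intro x hx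
    rw [MvPolynomial.mem_zeroLocus_iff] at hx
    have hxA := hx A (Ideal.subset_span (by simp))
    have hxB := hx B (Ideal.subset_span (by simp))
    rw [MvPolynomial.aeval_eq_eval] at hxA hxB
    by_cases hx0 : x = 0
    · subst hx0; exact hq
    · exact absurd hxB (hcon x hx0 hxA)
  have hmin : P3 ∈ (Ideal.span {A, B}).minimalPrimes := by
    refine ⟨⟨inferInstance, ?_⟩, ?_⟩
    · rw [Ideal.span_le]
      rintro x (rfl | rfl)
      · simpa [P3, f3, RingHom.mem_ker, MvPolynomial.aeval_eq_eval] using hA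
      · simpa [P3, f3, RingHom.mem_ker, MvPolynomial.aeval_eq_eval] using hB
    · rintro J ⟨hJ, hJ2⟩ _
      exact hrad.trans ((Ideal.IsPrime.radical_le_iff hJ).2 hJ2)
  have := Ideal.height_le_card_of_mem_minimalPrimes_span (by simp) hmin
  have h2 : (({A, B} : Set (MvPolynomial (Fin 3) K)).ncard : ℕ∞) ≤ 2 := by
    exact_mod_cast (Set.ncard_insert_le A {B}).trans (by simp)
  have h3 := hht.trans (this.trans h2)
  exact absurd h3 (by decide)

/-! ### Factors of homogeneous polynomials -/

def gradT : MvPolynomial (Fin 3) K →ₐ[K] Polynomial (MvPolynomial (Fin 3) K) :=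
  MvPolynomial.aeval (fun i => Polynomial.monomial 1 (X i))

theorem gradT_monomial (m : Fin 3 →₀ ℕ) (c : K) :
    gradT (monomial m c) = Polynomial.monomial m.degree (monomial m c) := by
  have h1 : (algebraMap K (Polynomial (MvPolynomial (Fin 3) K))) c =
      Polynomial.monomial 0 (MvPolynomial.C c) := rfl
  rw [gradT, MvPolynomial.aeval_monomial, MvPolynomial.monomial_eq, Finsupp.degree_eq_sum, h1,
    Finsupp.prod_fintype _ _ (by simp), Finsupp.prod_fintype _ _ (by simp)]
  simp only [Fin.prod_univ_three, Fin.sum_univ_three,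
    Polynomial.monomial_pow, Polynomial.monomial_mul_monomial, one_mul, zero_add]

theorem coeff_coeff_gradT (A : MvPolynomial (Fin 3) K) (n : ℕ) (m : Fin 3 →₀ ℕ) :
    coeff m ((gradT A).coeff n) = if m.degree = n then coeff m A else 0 := by
  classical
  induction A using MvPolynomial.induction_on' with
  | monomial m' c =>
    rw [gradT_monomial, Polynomial.coeff_monomial]
    by_cases h : m' = m
    · subst h; split_ifs <;> simp
    · split_ifs <;> simp [MvPolynomial.coeff_monomial, h]
  | add p q hp hq =>
    rw [map_add, Polynomial.coeff_add, MvPolynomial.coeff_add, hp, hq]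
    split_ifs <;> simp

theorem isHomogeneous_of_gradT {A : MvPolynomial (Fin 3) K} {a : ℕ}
    (h : ∀ n, n ≠ a → (gradT A).coeff n = 0) : A.IsHomogeneous a := by
  intro m hm
  by_contra hne
  have hne' : m.degree ≠ a := by
    intro h'; apply hne; rw [← h', Finsupp.degree_eq_weight_one]; rfl
  have h1 := coeff_coeff_gradT A m.degree m
  rw [h _ hne', if_pos rfl] at h1
  exact hm (by simpa using h1.symm)

theorem gradT_of_isHomogeneous {A : MvPolynomial (Fin 3) K} {a : ℕ} (hA : A.IsHomogeneous a) :
    gradT A = Polynomial.monomial a A := by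
  ext n m
  rw [coeff_coeff_gradT, Polynomial.coeff_monomial]
  split_ifs with h1 h2 h2
  · rfl
  · rw [hA.coeff_eq_zero (by rw [h1]; exact fun h => h2 h.symm), MvPolynomial.coeff_zero]
  · rw [hA.coeff_eq_zero (by rw [h2.symm] at h1; exact h1)]
  · simp

theorem isHomogeneous_of_mul {A B : MvPolynomial (Fin 3) K} {d : ℕ}
    (h : (A * B).IsHomogeneous d) (h0 : A * B ≠ 0) :
    ∃ a b, A.IsHomogeneous a ∧ B.IsHomogeneous b ∧ a + b = d := by
  have e := gradT_of_isHomogeneous h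
  rw [map_mul] at e
  have hne : gradT A * gradT B ≠ 0 := by
    rw [e]; simpa using h0
  have hA : gradT A ≠ 0 := left_ne_zero_of_mul hne
  have hB : gradT B ≠ 0 := right_ne_zero_of_mul hne
  have d1 := Polynomial.natDegree_mul hA hB
  have d2 := Polynomial.natTrailingDegree_mul hA hB
  rw [e, Polynomial.natDegree_monomial_eq _ h0] at d1
  rw [e, Polynomial.natTrailingDegree_monomial h0] at d2
  have t1 := Polynomial.natTrailingDegree_le_natDegree (gradT A)
  have t2 := Polynomial.natTrailingDegree_le_natDegree (gradT B)
  refine ⟨(gradT A).natDegree, (gradT B).natDegree, ?_, ?_, d1.symm⟩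
  · apply isHomogeneous_of_gradT
    intro n hn
    rcases lt_or_gt_of_ne hn with h | h
    · exact Polynomial.coeff_eq_zero_of_lt_natTrailingDegree (by omega)
    · exact Polynomial.coeff_eq_zero_of_natDegree_lt h
  · apply isHomogeneous_of_gradT
    intro n hn
    rcases lt_or_gt_of_ne hn with h | h
    · exact Polynomial.coeff_eq_zero_of_lt_natTrailingDegree (by omega)
    · exact Polynomial.coeff_eq_zero_of_natDegree_lt h

theorem eval_zero_of_isHomogeneous {A : MvPolynomial (Fin 3) K} {a : ℕ} (hA : A.IsHomogeneous a)
    (ha : a ≠ 0) : eval 0 A = 0 := by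
  have := hA.coeff_eq_zero (d := 0) (by simpa using ha.symm)
  rw [← MvPolynomial.constantCoeff_eq, ] at this
  rw [MvPolynomial.eval_zero]
  exact this

theorem isUnit_of_isHomogeneous_zero {A : MvPolynomial (Fin 3) K} (hA : A.IsHomogeneous 0)
    (h0 : A ≠ 0) : IsUnit A := by
  have h1 : A.totalDegree = 0 := by
    have := hA.totalDegree h0; exact this
  rw [MvPolynomial.totalDegree_eq_zero_iff_eq_C] at h1
  rw [h1]
  apply IsUnit.map
  rw [isUnit_iff_ne_zero]
  intro h2
  rw [h2] at h1
  exact h0 (by rw [h1, map_zero])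

theorem smooth_irreducible [IsAlgClosed K] {F : MvPolynomial (Fin 3) K} {d : ℕ} (hd : d ≠ 0)
    (hF : IsSmoothCurve F d) : Irreducible F := by
  obtain ⟨hh, h0, hs⟩ := hF
  constructor
  · intro hu
    obtain ⟨c, hc, hcF⟩ := MvPolynomial.isUnit_iff_eq_C_of_isReduced.1 hu
    have := eval_zero_of_isHomogeneous hh hd
    rw [hcF] at this
    simp at this
    exact hc.ne_zero this
  · intro A B hAB
    by_contra! hcon
    rw [hAB] at hh h0
    obtain ⟨a, b, hA, hB, -⟩ := isHomogeneous_of_mul hh h0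
    have ha : a ≠ 0 := by
      rintro rfl
      exact hcon.1 (isUnit_of_isHomogeneous_zero hA (left_ne_zero_of_mul h0))
    have hb : b ≠ 0 := by
      rintro rfl
      exact hcon.2 (isUnit_of_isHomogeneous_zero hB (right_ne_zero_of_mul h0))
    obtain ⟨p, hp, hpA, hpB⟩ := exists_common_zero (eval_zero_of_isHomogeneous hA ha)
      (eval_zero_of_isHomogeneous hB hb)
    obtain ⟨i, hi⟩ := hs p hp (by rw [hAB, map_mul, hpA, zero_mul])
    apply hi
    rw [hAB]
    simp [hpA, hpB]

/-! ### Explicit expansions -/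

theorem isHomogeneous_expand {F : MvPolynomial (Fin 3) K} {d : ℕ} (hF : F.IsHomogeneous d) :
    ∃ c : ℕ → ℕ → K, F = ∑ i ∈ Finset.range (d + 1), ∑ j ∈ Finset.range (d + 1 - i),
      MvPolynomial.C (c i j) * X 0 ^ i * X 1 ^ j * X 2 ^ (d - i - j) := by
  classical
  let e : ℕ → ℕ → (Fin 3 →₀ ℕ) := fun i j =>
    Finsupp.single 0 i + Finsupp.single 1 j + Finsupp.single 2 (d - i - j)
  refine ⟨fun i j => coeff (e i j) F, ?_⟩
  have hmon : ∀ i j, (MvPolynomial.C (coeff (e i j) F) * X 0 ^ i * X 1 ^ j * X 2 ^ (d - i - j) :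
      MvPolynomial (Fin 3) K) = monomial (e i j) (coeff (e i j) F) := by
    intro i j
    simp only [e, MvPolynomial.C_mul_X_pow_eq_monomial, MvPolynomial.X_pow_eq_monomial,
      MvPolynomial.monomial_mul, mul_one, MvPolynomial.C_mul_monomial]
  simp only [hmon]
  ext m
  simp only [MvPolynomial.coeff_sum, MvPolynomial.coeff_monomial]
  have he : ∀ i j, e i j = m ↔ (i = m 0 ∧ j = m 1 ∧ d - i - j = m 2) := by
    intro i j
    constructor
    · intro h; subst h; simp [e]
    · rintro ⟨h1, h2, h3⟩
      ext t
      fin_cases t <;> simp [e, h1, h2, h3] <;> simp [← h1, ← h2, h3]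
  by_cases hm : m.degree = d
  · have hm' : m 0 + m 1 + m 2 = d := by
      rw [Finsupp.degree_eq_sum, Fin.sum_univ_three] at hm; exact hm
    rw [Finset.sum_eq_single (m 0), Finset.sum_eq_single (m 1)]
    · have := (he (m 0) (m 1)).2 ⟨rfl, rfl, by omega⟩
      rw [if_pos this, this]
    · intro j _ hj
      rw [if_neg]; rw [he]; tauto
    · intro h; exfalso; apply h; simp; omega
    · intro i _ hi
      apply Finset.sum_eq_zero
      intro j _
      rw [if_neg]; rw [he]; tauto
    · intro h; exfalso; apply h; simp; omega
  · rw [hF.coeff_eq_zero hm]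
    symm
    apply Finset.sum_eq_zero
    intro i hi
    apply Finset.sum_eq_zero
    intro j hj
    rw [if_neg]
    rw [he]
    rintro ⟨h1, h2, h3⟩
    apply hm
    rw [Finsupp.degree_eq_sum, Fin.sum_univ_three]
    simp at hi hj
    omega


/-! ### Transport along invertible linear substitutions -/

theorem mulVec_inv {g h : Matrix (Fin 3) (Fin 3) K} (hgh : g * h = 1) (p : Fin 3 → K) :
    g.mulVec (h.mulVec p) = p := by
  rw [Matrix.mulVec_mulVec, hgh, Matrix.one_mulVec]

theorem mulVec_ne_zero {g h : Matrix (Fin 3) (Fin 3) K} (hhg : h * g = 1) {p : Fin 3 → K}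
    (hp : p ≠ 0) : g.mulVec p ≠ 0 := by
  intro h0
  apply hp
  rw [← mulVec_inv hhg p, h0, Matrix.mulVec_zero]

theorem tr_inv {g h : Matrix (Fin 3) (Fin 3) K} (hgh : g * h = 1) :
    h.transpose * g.transpose = 1 := by
  rw [← Matrix.transpose_mul, hgh, Matrix.transpose_one]

theorem linInd_mulVec {g h : Matrix (Fin 3) (Fin 3) K} (hhg : h * g = 1) {a b : Fin 3 → K}
    (hab : LinearIndependent K ![a, b]) : LinearIndependent K ![g.mulVec a, g.mulVec b] := by
  rw [LinearIndependent.pair_iff] at hab ⊢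
  intro s t hst
  apply hab
  have := congrArg (h.mulVec) hst
  rw [Matrix.mulVec_add, Matrix.mulVec_smul, Matrix.mulVec_smul, mulVec_inv hhg, mulVec_inv hhg,
    Matrix.mulVec_zero] at this
  exact this

theorem smooth_transform {g h : Matrix (Fin 3) (Fin 3) K} (hgh : g * h = 1) (hhg : h * g = 1)
    {F : MvPolynomial (Fin 3) K} {d : ℕ} (hF : IsSmoothCurve F d) :
    IsSmoothCurve (transformPoly g F) d := by
  obtain ⟨h1, h2, h3⟩ := hF
  refine ⟨transformPoly_isHomogeneous g h1, ?_, ?_⟩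
  · intro h0
    apply h2
    rw [← transformPoly_inv_left hgh F, h0]
    exact map_zero _
  · intro p hp hpF
    rw [eval_transformPoly] at hpF
    obtain ⟨i, hi⟩ := h3 _ (mulVec_ne_zero hhg hp) hpF
    by_contra! hcon
    have h4 : gradVec (transformPoly g F) p = 0 := by
      funext i; exact hcon i
    rw [gradVec_transformPoly] at h4
    have h5 : gradVec F (g.mulVec p) ≠ 0 := fun h => hi (congrFun h i)
    exact mulVec_ne_zero (tr_inv hgh) h5 h4

theorem dotv_eq (w p : Fin 3 → K) : dotv w p = w ⬝ᵥ p := rfl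

theorem dotv_tr (g : Matrix (Fin 3) (Fin 3) K) (w p : Fin 3 → K) :
    dotv (g.transpose.mulVec w) p = dotv w (g.mulVec p) := by
  rw [dotv_eq, dotv_eq, Matrix.mulVec_transpose, Matrix.dotProduct_mulVec]

theorem infl_transform {g h : Matrix (Fin 3) (Fin 3) K} (hgh : g * h = 1) (hhg : h * g = 1)
    {F : MvPolynomial (Fin 3) K} {w : Fin 3 → K} (hw : IsInflLine F w) :
    IsInflLine (transformPoly g F) (g.transpose.mulVec w) := by
  obtain ⟨h0, a, b, ha, hb, hab, hl, hc⟩ := hw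
  refine ⟨mulVec_ne_zero (tr_inv hgh) h0, h.mulVec a, h.mulVec b, ?_, ?_, linInd_mulVec hgh hab,
    ?_, ?_⟩
  · rw [dotv_tr, mulVec_inv hgh, ha]
  · rw [dotv_tr, mulVec_inv hgh, hb]
  · rw [lineRestrict_transformPoly, mulVec_inv hgh, mulVec_inv hgh]; exact hl
  · rw [contactAt, lineRestrict_transformPoly, mulVec_inv hgh, mulVec_inv hgh]; exact hc

theorem rank_conj {g h : Matrix (Fin 3) (Fin 3) K} (hgh : g * h = 1) (hhg : h * g = 1)
    (M : Matrix (Fin 3) (Fin 3) K) : (g.transpose * M * g).rank = M.rank := by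
  have hg : IsUnit g.det := by
    rw [← Matrix.isUnit_iff_isUnit_det]; exact ⟨⟨g, h, hgh, hhg⟩, rfl⟩
  rw [Matrix.rank_mul_eq_left_of_isUnit_det _ _ hg, Matrix.rank_mul_eq_right_of_isUnit_det]
  rwa [Matrix.det_transpose]

theorem sing_transform {g h : Matrix (Fin 3) (Fin 3) K}
    {G : MvPolynomial (Fin 3) K} {p : Fin 3 → K} (hp : SingAt G (g.mulVec p)) :
    SingAt (transformPoly g G) p := by
  refine ⟨by rw [eval_transformPoly]; exact hp.1, fun i => ?_⟩
  have h1 : gradVec G (g.mulVec p) = 0 := funext hp.2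
  have := gradVec_transformPoly g G p
  rw [h1, Matrix.mulVec_zero] at this
  exact congrFun this i

theorem cusp_transform {g h : Matrix (Fin 3) (Fin 3) K} (hgh : g * h = 1) (hhg : h * g = 1)
    {G : MvPolynomial (Fin 3) K} {p : Fin 3 → K} (hp : IsCuspAt G (g.mulVec p)) :
    IsCuspAt (transformPoly g G) p := by
  obtain ⟨h1, h2, h3⟩ := hp
  refine ⟨sing_transform (h := h) h1, ?_, ?_⟩
  · rw [hessMat_transformPoly, rank_conj hgh hhg, h2]
  · intro v hv hpv
    rw [cubicForm_transformPoly]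
    apply h3 _ _ (linInd_mulVec hhg hpv)
    rw [hessMat_transformPoly, ← Matrix.mulVec_mulVec, ← Matrix.mulVec_mulVec] at hv
    by_contra hne
    exact mulVec_ne_zero (tr_inv hgh) hne hv

theorem hessMat_smul (c : K) (G : MvPolynomial (Fin 3) K) (p : Fin 3 → K) :
    hessMat (c • G) p = c • hessMat G p := by
  ext i j; simp [hessMat, MvPolynomial.smul_eval]

theorem cubicForm_smul (c : K) (G : MvPolynomial (Fin 3) K) (p v : Fin 3 → K) :
    cubicForm (c • G) p v = c * cubicForm G p v := by
  simp only [cubicForm, Derivation.map_smul, MvPolynomial.smul_eval, Finset.mul_sum]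
  simp only [mul_assoc]

theorem cusp_smul {c : K} (hc : c ≠ 0) {G : MvPolynomial (Fin 3) K} {p : Fin 3 → K}
    (hp : IsCuspAt G p) : IsCuspAt (c • G) p := by
  obtain ⟨h1, h2, h3⟩ := hp
  refine ⟨⟨by rw [MvPolynomial.smul_eval, h1.1, mul_zero], fun i => ?_⟩, ?_, ?_⟩
  · rw [Derivation.map_smul, MvPolynomial.smul_eval, h1.2, mul_zero]
  · rw [hessMat_smul]
    have : (c • hessMat G p) = (c • (1 : Matrix (Fin 3) (Fin 3) K)) * hessMat G p := by simp
    rw [this, Matrix.rank_mul_eq_right_of_isUnit_det, h2]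
    simp [hc]
  · intro v hv hpv
    rw [cubicForm_smul]
    apply mul_ne_zero hc (h3 v _ hpv)
    rw [hessMat_smul, Matrix.smul_mulVec] at hv
    exact (smul_eq_zero.1 hv).resolve_left hc

/-- `A` vanishes identically on the image of the Gauss map, as a divisibility statement. -/
def DualVan (A F : MvPolynomial (Fin 3) K) : Prop := F ∣ MvPolynomial.aeval (ggrad F) A

theorem aeval_ggrad_transform {g h : Matrix (Fin 3) (Fin 3) K} (hgh : g * h = 1)
    (A F : MvPolynomial (Fin 3) K) :
    MvPolynomial.aeval (ggrad (transformPoly g F)) (transformPoly h.transpose A) =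
      transformPoly g (MvPolynomial.aeval (ggrad F) A) := by
  have h1 : (MvPolynomial.aeval (ggrad (transformPoly g F)) :
      MvPolynomial (Fin 3) K →ₐ[K] MvPolynomial (Fin 3) K).comp
      (MvPolynomial.aeval (fun i => ∑ j, MvPolynomial.C (h.transpose i j) * X j)) =
      (MvPolynomial.aeval (fun i => ∑ j, MvPolynomial.C (g i j) * X j) :
      MvPolynomial (Fin 3) K →ₐ[K] MvPolynomial (Fin 3) K).comp (MvPolynomial.aeval (ggrad F)) := by
    apply MvPolynomial.algHom_ext
    intro i
    have hc : ∀ c : K, MvPolynomial.aeval (ggrad (transformPoly g F)) (MvPolynomial.C c) =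
      (MvPolynomial.C c : MvPolynomial (Fin 3) K) := fun c => MvPolynomial.aeval_C _ c
    simp only [AlgHom.comp_apply, MvPolynomial.aeval_X, map_sum, map_mul, hc, ggrad,
      pderiv_transformPoly, Matrix.transpose_apply]
    change _ = transformPoly g (pderiv i F)
    have : ∀ l, (∑ j, g l j * h j i) = (1 : Matrix (Fin 3) (Fin 3) K) l i := by
      intro l; rw [← hgh]; rfl
    calc _ = ∑ l, MvPolynomial.C (∑ j, g l j * h j i) * transformPoly g (pderiv l F) := by
          simp only [Fin.sum_univ_three, map_add, map_mul]; ring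
      _ = _ := by
          simp only [this, Matrix.one_apply]
          simp
  exact DFunLike.congr_fun h1 A

theorem dualVan_transform {g h : Matrix (Fin 3) (Fin 3) K} (hgh : g * h = 1)
    {A F : MvPolynomial (Fin 3) K} (hA : DualVan A F) :
    DualVan (transformPoly h.transpose A) (transformPoly g F) := by
  obtain ⟨R, hR⟩ := hA
  rw [DualVan, aeval_ggrad_transform hgh, hR, transformPoly_mul]
  exact dvd_mul_right _ _

theorem eval_aeval_ggrad (A F : MvPolynomial (Fin 3) K) (p : Fin 3 → K) :
    eval p (MvPolynomial.aeval (ggrad F) A) = eval (gradVec F p) A := by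
  have h1 : (MvPolynomial.aeval p : MvPolynomial (Fin 3) K →ₐ[K] K).comp
      (MvPolynomial.aeval (ggrad F)) = MvPolynomial.aeval (gradVec F p) := by
    apply MvPolynomial.algHom_ext
    intro i
    simp [gradVec, MvPolynomial.aeval_eq_eval]
  have := DFunLike.congr_fun h1 A
  simpa [MvPolynomial.aeval_eq_eval] using this

theorem containsGauss_of_dualVan {A F : MvPolynomial (Fin 3) K} (hA : DualVan A F) :
    ContainsGaussImage A F := by
  intro p _ hp
  obtain ⟨R, hR⟩ := hA
  rw [← eval_aeval_ggrad, hR, map_mul, hp, zero_mul]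


/-! ### Cubics in explicit form and their flexes -/

def cub (c : ℕ → ℕ → K) : MvPolynomial (Fin 3) K :=
  MvPolynomial.C (c 3 0) * X 0 ^ 3 + MvPolynomial.C (c 0 3) * X 1 ^ 3
  + MvPolynomial.C (c 0 0) * X 2 ^ 3
  + MvPolynomial.C (c 2 1) * X 0 ^ 2 * X 1 + MvPolynomial.C (c 2 0) * X 0 ^ 2 * X 2
  + MvPolynomial.C (c 1 2) * X 0 * X 1 ^ 2 + MvPolynomial.C (c 0 2) * X 1 ^ 2 * X 2
  + MvPolynomial.C (c 1 0) * X 0 * X 2 ^ 2 + MvPolynomial.C (c 0 1) * X 1 * X 2 ^ 2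
  + MvPolynomial.C (c 1 1) * X 0 * X 1 * X 2

theorem exists_cub {F : MvPolynomial (Fin 3) K} (hF : F.IsHomogeneous 3) :
    ∃ c : ℕ → ℕ → K, F = cub c := by
  obtain ⟨c, hc⟩ := isHomogeneous_expand hF
  refine ⟨c, hc.trans ?_⟩
  simp only [Finset.sum_range_succ, Finset.sum_range_zero, cub, Nat.add_one_sub_one, Nat.reduceSub,
    Nat.reduceAdd, pow_zero, mul_one, zero_add, pow_one]
  ring

theorem eval_cub (c : ℕ → ℕ → K) (p : Fin 3 → K) : eval p (cub c) =
    c 3 0 * p 0 ^ 3 + c 0 3 * p 1 ^ 3 + c 0 0 * p 2 ^ 3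
    + c 2 1 * p 0 ^ 2 * p 1 + c 2 0 * p 0 ^ 2 * p 2 + c 1 2 * p 0 * p 1 ^ 2 + c 0 2 * p 1 ^ 2 * p 2
    + c 1 0 * p 0 * p 2 ^ 2 + c 0 1 * p 1 * p 2 ^ 2 + c 1 1 * p 0 * p 1 * p 2 := by
  simp [cub]

theorem eval_pderiv_cub (c : ℕ → ℕ → K) (p : Fin 3 → K) :
    eval p (pderiv 0 (cub c)) = 3 * c 3 0 * p 0 ^ 2 + 2 * c 2 1 * p 0 * p 1 + 2 * c 2 0 * p 0 * p 2
      + c 1 2 * p 1 ^ 2 + c 1 0 * p 2 ^ 2 + c 1 1 * p 1 * p 2 ∧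
    eval p (pderiv 1 (cub c)) = 3 * c 0 3 * p 1 ^ 2 + c 2 1 * p 0 ^ 2 + 2 * c 1 2 * p 0 * p 1
      + 2 * c 0 2 * p 1 * p 2 + c 0 1 * p 2 ^ 2 + c 1 1 * p 0 * p 2 ∧
    eval p (pderiv 2 (cub c)) = 3 * c 0 0 * p 2 ^ 2 + c 2 0 * p 0 ^ 2 + c 0 2 * p 1 ^ 2
      + 2 * c 1 0 * p 0 * p 2 + 2 * c 0 1 * p 1 * p 2 + c 1 1 * p 0 * p 1 := by
  refine ⟨?_, ?_, ?_⟩ <;>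
  · simp [cub, pderiv_X, Pi.single_apply, Derivation.leibniz, Derivation.leibniz_pow]
    ring

/-- quadratic part of `F(a + t b)` -/
def qpart (c : ℕ → ℕ → K) (a b : Fin 3 → K) : K :=
  c 3 0 * 3 * a 0 * b 0 ^ 2 + c 0 3 * 3 * a 1 * b 1 ^ 2 + c 0 0 * 3 * a 2 * b 2 ^ 2
  + c 2 1 * (b 0 ^ 2 * a 1 + 2 * a 0 * b 0 * b 1) + c 2 0 * (b 0 ^ 2 * a 2 + 2 * a 0 * b 0 * b 2)
  + c 1 2 * (b 1 ^ 2 * a 0 + 2 * a 1 * b 1 * b 0) + c 0 2 * (b 1 ^ 2 * a 2 + 2 * a 1 * b 1 * b 2)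
  + c 1 0 * (b 2 ^ 2 * a 0 + 2 * a 2 * b 2 * b 0) + c 0 1 * (b 2 ^ 2 * a 1 + 2 * a 2 * b 2 * b 1)
  + c 1 1 * (a 0 * b 1 * b 2 + b 0 * a 1 * b 2 + b 0 * b 1 * a 2)

theorem lineRestrict_cub (c : ℕ → ℕ → K) (a b : Fin 3 → K) : lineRestrict (cub c) a b =
    Polynomial.C (eval a (cub c)) + Polynomial.C (dotv (gradVec (cub c) a) b) * Polynomial.X
    + Polynomial.C (qpart c a b) * Polynomial.X ^ 2
    + Polynomial.C (eval b (cub c)) * Polynomial.X ^ 3 := by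
  obtain ⟨h0, h1, h2⟩ := eval_pderiv_cub c a
  rw [dotv, Fin.sum_univ_three]
  simp only [gradVec, h0, h1, h2, eval_cub, qpart]
  have hC : ∀ x : K, (algebraMap K (Polynomial K)) x = Polynomial.C x := fun _ => rfl
  simp only [lineRestrict, cub, map_add, map_mul, map_pow, MvPolynomial.aeval_X, MvPolynomial.aeval_C,
    hC, map_ofNat]
  ring

theorem coeff_two_lineRestrict_cub (c : ℕ → ℕ → K) (a b : Fin 3 → K) :
    (lineRestrict (cub c) a b).coeff 2 = qpart c a b := by
  rw [lineRestrict_cub]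
  simp [Polynomial.coeff_X, Polynomial.coeff_C]

/-- The cubic cutting out the flexes. -/
def flexc (c : ℕ → ℕ → K) : MvPolynomial (Fin 3) K :=
  let x : MvPolynomial (Fin 3) K := X 0
  let y : MvPolynomial (Fin 3) K := X 1
  let z : MvPolynomial (Fin 3) K := X 2
  let D0 := MvPolynomial.C (3 * c 3 0) * x + MvPolynomial.C (c 2 1) * y + MvPolynomial.C (c 2 0) * z
  let D1 := MvPolynomial.C (c 1 2) * x + MvPolynomial.C (3 * c 0 3) * y + MvPolynomial.C (c 0 2) * z
  let D2 := MvPolynomial.C (c 1 0) * x + MvPolynomial.C (c 0 1) * y + MvPolynomial.C (3 * c 0 0) * z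
  let O0 := MvPolynomial.C (c 0 2) * y + MvPolynomial.C (c 0 1) * z
  let O1 := MvPolynomial.C (c 2 0) * x + MvPolynomial.C (c 1 0) * z
  let O2 := MvPolynomial.C (c 2 1) * x + MvPolynomial.C (c 1 2) * y
  let m := MvPolynomial.C (c 1 1)
  D0 * D1 * D2 + 2 * O0 * O1 * O2 + m * (O0 * O1 * z + O1 * O2 * x + O0 * O2 * y)
   - (D0 * O0 ^ 2 + D1 * O1 ^ 2 + D2 * O2 ^ 2) - m * (D0 * O0 * x + D1 * O1 * y + D2 * O2 * z)
   - m ^ 2 * (MvPolynomial.C (c 3 0) * x ^ 3 + MvPolynomial.C (c 0 3) * y ^ 3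
      + MvPolynomial.C (c 0 0) * z ^ 3)

def flexe (c : ℕ → ℕ → K) (a : Fin 3 → K) : K :=
  let x := a 0
  let y := a 1
  let z := a 2
  let D0 := (3 * c 3 0) * x + (c 2 1) * y + (c 2 0) * z
  let D1 := (c 1 2) * x + (3 * c 0 3) * y + (c 0 2) * z
  let D2 := (c 1 0) * x + (c 0 1) * y + (3 * c 0 0) * z
  let O0 := (c 0 2) * y + (c 0 1) * z
  let O1 := (c 2 0) * x + (c 1 0) * z
  let O2 := (c 2 1) * x + (c 1 2) * y
  let m := (c 1 1)
  D0 * D1 * D2 + 2 * O0 * O1 * O2 + m * (O0 * O1 * z + O1 * O2 * x + O0 * O2 * y)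
   - (D0 * O0 ^ 2 + D1 * O1 ^ 2 + D2 * O2 ^ 2) - m * (D0 * O0 * x + D1 * O1 * y + D2 * O2 * z)
   - m ^ 2 * ((c 3 0) * x ^ 3 + (c 0 3) * y ^ 3 + (c 0 0) * z ^ 3)

theorem eval_flexc (c : ℕ → ℕ → K) (a : Fin 3 → K) : eval a (flexc c) = flexe c a := by
  simp only [flexc, flexe, map_add, map_sub, map_mul, map_pow, MvPolynomial.eval_C,
    MvPolynomial.eval_X, map_ofNat]

def crs (v e : Fin 3 → K) : Fin 3 → K :=
  ![v 1 * e 2 - v 2 * e 1, v 2 * e 0 - v 0 * e 2, v 0 * e 1 - v 1 * e 0]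

set_option maxHeartbeats 1000000 in
theorem qpart_crs_2 (c : ℕ → ℕ → K) (a : Fin 3 → K) :
    ∃ r, qpart c a (crs (gradVec (cub c) a) (Pi.single 2 1)) =
      - a 2 ^ 2 * flexe c a + r * eval a (cub c) := by
  obtain ⟨h0, h1, h2⟩ := eval_pderiv_cub c a
  refine ⟨3 * ((3 * c 3 0) * a 0 + (c 2 1) * a 1 + (c 2 0) * a 2) *
    ((c 1 2) * a 0 + (3 * c 0 3) * a 1 + (c 0 2) * a 2)
    - 3 * ((c 2 1) * a 0 + (c 1 2) * a 1) ^ 2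
    - 3 * c 1 1 * ((c 2 1) * a 0 + (c 1 2) * a 1) * a 2 - c 1 1 ^ 2 * a 2 ^ 2, ?_⟩
  simp [gradVec, h0, h1, h2, eval_cub, qpart, crs, flexe]
  ring

set_option maxHeartbeats 1000000 in
theorem qpart_crs_1 (c : ℕ → ℕ → K) (a : Fin 3 → K) :
    ∃ r, qpart c a (crs (gradVec (cub c) a) (Pi.single 1 1)) =
      - a 1 ^ 2 * flexe c a + r * eval a (cub c) := by
  obtain ⟨h0, h1, h2⟩ := eval_pderiv_cub c a
  refine ⟨3 * ((3 * c 3 0) * a 0 + (c 2 1) * a 1 + (c 2 0) * a 2) *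
    ((c 1 0) * a 0 + (c 0 1) * a 1 + (3 * c 0 0) * a 2)
    - 3 * ((c 2 0) * a 0 + (c 1 0) * a 2) ^ 2
    - 3 * c 1 1 * ((c 2 0) * a 0 + (c 1 0) * a 2) * a 1 - c 1 1 ^ 2 * a 1 ^ 2, ?_⟩
  simp [gradVec, h0, h1, h2, eval_cub, qpart, crs, flexe]
  ring

set_option maxHeartbeats 1000000 in
theorem qpart_crs_0 (c : ℕ → ℕ → K) (a : Fin 3 → K) :
    ∃ r, qpart c a (crs (gradVec (cub c) a) (Pi.single 0 1)) =
      - a 0 ^ 2 * flexe c a + r * eval a (cub c) := by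
  obtain ⟨h0, h1, h2⟩ := eval_pderiv_cub c a
  refine ⟨3 * ((c 1 2) * a 0 + (3 * c 0 3) * a 1 + (c 0 2) * a 2) *
    ((c 1 0) * a 0 + (c 0 1) * a 1 + (3 * c 0 0) * a 2)
    - 3 * ((c 0 2) * a 1 + (c 0 1) * a 2) ^ 2
    - 3 * c 1 1 * ((c 0 2) * a 1 + (c 0 1) * a 2) * a 0 - c 1 1 ^ 2 * a 0 ^ 2, ?_⟩
  simp [gradVec, h0, h1, h2, eval_cub, qpart, crs, flexe]
  ring

theorem qpart_crs (c : ℕ → ℕ → K) (a : Fin 3 → K) (i : Fin 3) :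
    ∃ r, qpart c a (crs (gradVec (cub c) a) (Pi.single i 1)) =
      - a i ^ 2 * flexe c a + r * eval a (cub c) := by
  fin_cases i
  · exact qpart_crs_0 c a
  · exact qpart_crs_1 c a
  · exact qpart_crs_2 c a


/-! ### Projective equivalence and the Hesse normal form -/

def Equivv (F F' : MvPolynomial (Fin 3) K) : Prop :=
  ∃ g h : Matrix (Fin 3) (Fin 3) K, g * h = 1 ∧ h * g = 1 ∧ transformPoly g F = F'

theorem Equivv.trans {F F' F'' : MvPolynomial (Fin 3) K} (h1 : Equivv F F') (h2 : Equivv F' F'') :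
    Equivv F F'' := by
  obtain ⟨g, h, e1, e2, rfl⟩ := h1
  obtain ⟨g', h', e1', e2', rfl⟩ := h2
  refine ⟨g * g', h' * h, ?_, ?_, ?_⟩
  · rw [Matrix.mul_assoc, ← Matrix.mul_assoc g', e1', Matrix.one_mul, e1]
  · rw [Matrix.mul_assoc, ← Matrix.mul_assoc h, e2, Matrix.one_mul, e2']
  · rw [transformPoly_comp]

theorem Equivv.symm {F F' : MvPolynomial (Fin 3) K} (h1 : Equivv F F') : Equivv F' F := by
  obtain ⟨g, h, e1, e2, rfl⟩ := h1
  exact ⟨h, g, e2, e1, transformPoly_inv_left e1 F⟩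

theorem Equivv.smooth {F F' : MvPolynomial (Fin 3) K} {d : ℕ} (h1 : Equivv F F')
    (hF : IsSmoothCurve F d) : IsSmoothCurve F' d := by
  obtain ⟨g, h, e1, e2, rfl⟩ := h1
  exact smooth_transform e1 e2 hF

theorem equivv_det {g : Matrix (Fin 3) (Fin 3) K} (hg : g.det ≠ 0) (F : MvPolynomial (Fin 3) K) :
    Equivv F (transformPoly g F) := by
  have : IsUnit g.det := isUnit_iff_ne_zero.2 hg
  exact ⟨g, g⁻¹, Matrix.mul_nonsing_inv g this, Matrix.nonsing_inv_mul g this, rfl⟩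

theorem equivv_of_eval [Infinite K] {g : Matrix (Fin 3) (Fin 3) K} (hg : g.det ≠ 0)
    {F F' : MvPolynomial (Fin 3) K} (h : ∀ p, eval (g.mulVec p) F = eval p F') : Equivv F F' := by
  have : transformPoly g F = F' := MvPolynomial.funext fun p => by rw [eval_transformPoly, h]
  rw [← this]
  exact equivv_det hg F

theorem crs_det (v a e s : Fin 3 → K) (hva : dotv v a = 0) :
    (Matrix.of ![![crs v e 0, a 0, s 0], ![crs v e 1, a 1, s 1], ![crs v e 2, a 2, s 2]]).det =
      - (dotv v s) * (dotv e a) := by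
  rw [dotv, Fin.sum_univ_three] at *
  rw [dotv, Fin.sum_univ_three]
  rw [Matrix.det_fin_three]
  simp [crs]
  linear_combination (e 0 * s 0 + e 1 * s 1 + e 2 * s 2) * hva

theorem euler_cub (c : ℕ → ℕ → K) (a : Fin 3 → K) :
    dotv (gradVec (cub c) a) a = 3 * eval a (cub c) := by
  obtain ⟨h0, h1, h2⟩ := eval_pderiv_cub c a
  rw [dotv, Fin.sum_univ_three]
  simp only [gradVec, h0, h1, h2, eval_cub]
  ring

theorem dotv_single (v : Fin 3 → K) (j : Fin 3) : dotv v (Pi.single j 1) = v j := by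
  simp [dotv, Pi.single_apply]

theorem single_dotv (v : Fin 3 → K) (j : Fin 3) : dotv (Pi.single j 1) v = v j := by
  simp [dotv, Pi.single_apply]

/-- Moving a flex to `(0:1:0)` with tangent `z = 0`. -/
theorem normal_step1 [IsAlgClosed K] {F : MvPolynomial (Fin 3) K} (hF : IsSmoothCurve F 3) :
    ∃ c : ℕ → ℕ → K, Equivv F (cub c) ∧ c 0 3 = 0 ∧ c 1 2 = 0 ∧ c 2 1 = 0 ∧ c 0 2 ≠ 0 := by
  obtain ⟨c, rfl⟩ := exists_cub hF.1
  obtain ⟨a, ha, hFa, hha⟩ := exists_common_zero (A := cub c) (B := flexc c)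
    (by rw [eval_cub]; simp) (by rw [eval_flexc]; simp [flexe])
  rw [eval_flexc] at hha
  obtain ⟨j, hj⟩ := hF.2.2 a ha hFa
  obtain ⟨i, hi⟩ : ∃ i, a i ≠ 0 := by
    by_contra! h; exact ha (funext h)
  set v := gradVec (cub c) a with hv
  have hva : dotv v a = 0 := by rw [hv, euler_cub, hFa, mul_zero]
  set e : Fin 3 → K := Pi.single i 1 with he
  set s : Fin 3 → K := Pi.single j 1 with hs
  set g : Matrix (Fin 3) (Fin 3) K :=
    Matrix.of ![![crs v e 0, a 0, s 0], ![crs v e 1, a 1, s 1], ![crs v e 2, a 2, s 2]] with hg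
  have hdet : g.det ≠ 0 := by
    rw [hg, crs_det _ _ _ _ hva, he, hs, dotv_single, single_dotv]
    exact mul_ne_zero (neg_ne_zero.2 hj) hi
  obtain ⟨c', hc'⟩ := exists_cub (transformPoly_isHomogeneous g hF.1)
  have hE := equivv_det hdet (cub c)
  rw [hc'] at hE
  have g0 : g.mulVec ![1, 0, 0] = crs v e := by
    ext t; fin_cases t <;> simp [hg, Matrix.mulVec, dotProduct, Fin.sum_univ_three]
  have g1 : g.mulVec ![0, 1, 0] = a := by
    ext t; fin_cases t <;> simp [hg, Matrix.mulVec, dotProduct, Fin.sum_univ_three]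
  have e1 : c' 0 3 = 0 := by
    have := eval_transformPoly g (cub c) ![0, 1, 0]
    rw [hc', g1, hFa, eval_cub] at this
    simpa using this
  have e2 := gradVec_transformPoly g (cub c) ![0, 1, 0]
  rw [hc', g1, ← hv] at e2
  obtain ⟨p0, p1, p2⟩ := eval_pderiv_cub c' ![0, 1, 0]
  refine ⟨c', hE, e1, ?_, ?_, ?_⟩
  · have h1 := congrFun e2 0
    simp only [gradVec] at h1
    rw [p0] at h1
    simp [Matrix.mulVec, dotProduct, Fin.sum_univ_three, hg] at h1
    rw [h1]
    simp [crs]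
    ring
  · have h1 := lineRestrict_transformPoly g (cub c) ![0, 1, 0] ![1, 0, 0]
    rw [hc', g1, g0] at h1
    have h2 := congrArg (fun P => P.coeff 2) h1
    simp only [coeff_two_lineRestrict_cub] at h2
    obtain ⟨r, hr⟩ := qpart_crs c a i
    rw [← hv, ← he, hha, hFa] at hr
    rw [hr] at h2
    simpa [qpart] using h2
  · have h1 := congrFun e2 2
    simp only [gradVec] at h1
    rw [p2] at h1
    have h3 : (g.transpose.mulVec v) 2 = v j := by
      rw [← dotv_single v j]
      simp [Matrix.mulVec, dotProduct, Fin.sum_univ_three, hg, dotv]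
      ring
    rw [h3] at h1
    simp [e1] at h1
    rw [h1]
    exact hj

theorem exists_root2 [IsAlgClosed K] (a b c : K) (ha : a ≠ 0) : ∃ x, a * x ^ 2 + b * x + c = 0 := by
  have hd : (Polynomial.C a * Polynomial.X ^ 2 + Polynomial.C b * Polynomial.X + Polynomial.C c).degree
      = 2 := Polynomial.degree_quadratic ha
  obtain ⟨x, hx⟩ := IsAlgClosed.exists_root _ (by rw [hd]; decide)
  exact ⟨x, by simpa [Polynomial.IsRoot] using hx⟩

theorem exists_root4 [IsAlgClosed K] (a b c d e : K) (ha : a ≠ 0) :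
    ∃ x, a * x ^ 4 + b * x ^ 3 + c * x ^ 2 + d * x + e = 0 := by
  let P : Polynomial K := Polynomial.C a * Polynomial.X ^ 4 +
    (Polynomial.C b * Polynomial.X ^ 3 + Polynomial.C c * Polynomial.X ^ 2
      + Polynomial.C d * Polynomial.X + Polynomial.C e)
  have hd : P.degree = 4 := by
    have h1 : (Polynomial.C a * Polynomial.X ^ 4).degree = 4 := Polynomial.degree_C_mul_X_pow 4 ha
    have h2 := Polynomial.degree_cubic_lt (R := K) (a := b) (b := c) (c := d) (d := e)
    rw [Polynomial.degree_add_eq_left_of_degree_lt, h1]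
    rw [h1]; exact h2
  obtain ⟨x, hx⟩ := IsAlgClosed.exists_root P (by rw [hd]; decide)
  refine ⟨x, ?_⟩
  simp [P, Polynomial.IsRoot] at hx
  linear_combination hx

theorem exists_cbrt [IsAlgClosed K] (a : K) : ∃ x, x ^ 3 = a :=
  IsAlgClosed.exists_pow_nat_eq a (by norm_num)

/-- Weierstrass equation with free coefficients. -/
def wei (a1 a2 a3 a4 a6 : K) : MvPolynomial (Fin 3) K :=
  wpoly (⟨a1, a2, a3, a4, a6⟩ : WeierstrassCurve K)

theorem eval_wei (a1 a2 a3 a4 a6 : K) (p : Fin 3 → K) : eval p (wei a1 a2 a3 a4 a6) =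
    p 1 ^ 2 * p 2 + a1 * p 0 * p 1 * p 2 + a3 * p 1 * p 2 ^ 2 - p 0 ^ 3 - a2 * p 0 ^ 2 * p 2
      - a4 * p 0 * p 2 ^ 2 - a6 * p 2 ^ 3 := by
  simp [wei, wpoly]

theorem eval_pderiv_wei (a1 a2 a3 a4 a6 : K) (p : Fin 3 → K) :
    eval p (pderiv 0 (wei a1 a2 a3 a4 a6)) = a1 * p 1 * p 2 - 3 * p 0 ^ 2 - 2 * a2 * p 0 * p 2
      - a4 * p 2 ^ 2 ∧
    eval p (pderiv 1 (wei a1 a2 a3 a4 a6)) = 2 * p 1 * p 2 + a1 * p 0 * p 2 + a3 * p 2 ^ 2 ∧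
    eval p (pderiv 2 (wei a1 a2 a3 a4 a6)) = p 1 ^ 2 + a1 * p 0 * p 1 + 2 * a3 * p 1 * p 2
      - a2 * p 0 ^ 2 - 2 * a4 * p 0 * p 2 - 3 * a6 * p 2 ^ 2 := by
  refine ⟨?_, ?_, ?_⟩ <;>
  · simp [wei, wpoly, pderiv_X, Pi.single_apply, Derivation.leibniz, Derivation.leibniz_pow]
    ring

theorem det_mat (a b c d e f g h i : K) : (Matrix.of ![![a, b, c], ![d, e, f], ![g, h, i]]).det =
    a * e * i - a * f * h - b * d * i + b * f * g + c * d * h - c * e * g := by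
  rw [Matrix.det_fin_three]; simp

theorem mulVec_mat (a b c d e f g h i : K) (p : Fin 3 → K) :
    (Matrix.of ![![a, b, c], ![d, e, f], ![g, h, i]]).mulVec p =
    ![a * p 0 + b * p 1 + c * p 2, d * p 0 + e * p 1 + f * p 2, g * p 0 + h * p 1 + i * p 2] := by
  ext t; fin_cases t <;> simp [Matrix.mulVec, dotProduct, Fin.sum_univ_three]

theorem normal_step2 [IsAlgClosed K] {c : ℕ → ℕ → K} (hF : IsSmoothCurve (cub c) 3)
    (h03 : c 0 3 = 0) (h12 : c 1 2 = 0) (h21 : c 2 1 = 0) (h02 : c 0 2 ≠ 0) :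
    ∃ a1 a2 a3 a4 a6 : K, Equivv (cub c) (wei a1 a2 a3 a4 a6) := by
  have hd : c 3 0 ≠ 0 := by
    intro h30
    obtain ⟨y, hy⟩ := exists_root2 (c 0 2) (c 1 1) (c 2 0) h02
    obtain ⟨i, hi⟩ := hF.2.2 ![1, y, 0] (by intro h; simpa using congrFun h 0)
      (by rw [eval_cub]; simp [h03, h12, h21, h30])
    obtain ⟨p0, p1, p2⟩ := eval_pderiv_cub c ![1, y, 0]
    fin_cases i
    · apply hi; refine p0.trans ?_; simp [h03, h12, h21, h30]
    · apply hi; refine p1.trans ?_; simp [h03, h12, h21, h30]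
    · apply hi; refine p2.trans ?_; simp [h03, h12, h21, h30]; linear_combination hy
  obtain ⟨s, hs⟩ := exists_cbrt (-1 / c 3 0)
  have hs' : c 3 0 * s ^ 3 = -1 := by rw [hs]; field_simp
  have hs0 : s ≠ 0 := by rintro rfl; simp at hs'
  have ht : c 0 2 * (c 0 2)⁻¹ = 1 := mul_inv_cancel₀ h02
  set t := (c 0 2)⁻¹ with htd
  have ht0 : t ≠ 0 := inv_ne_zero h02
  have : Infinite K := IsAlgClosed.instInfinite
  refine ⟨c 1 1 * s * t, -c 2 0 * s ^ 2 * t, c 0 1 * t ^ 2, -c 1 0 * s * t ^ 2, -c 0 0 * t ^ 3,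
    equivv_of_eval (g := Matrix.of ![![s, 0, 0], ![0, 1, 0], ![0, 0, t]]) ?_ ?_⟩
  · rw [det_mat]; simp [hs0, ht0]
  · intro p
    rw [mulVec_mat, eval_cub, eval_wei]
    simp [h03, h12, h21]
    linear_combination p 0 ^ 3 * hs' + p 1 ^ 2 * p 2 * ht

theorem normal_step3 [IsAlgClosed K] (h3 : (3 : K) ≠ 0) (a1 a2 a3 a4 a6 : K) :
    ∃ b1 b2 b3 b4 : K, Equivv (wei a1 a2 a3 a4 a6) (wei b1 b2 b3 b4 0) ∧
      -b1 * b3 * b4 + b2 * b3 ^ 2 - b4 ^ 2 = 0 := by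
  obtain ⟨x, hx⟩ := exists_root4 3 (a1 ^ 2 + 4 * a2) (3 * (2 * a4 + a1 * a3))
    (3 * (a3 ^ 2 + 4 * a6))
    (a1 ^ 2 * a6 + 4 * a2 * a6 - a1 * a3 * a4 + a2 * a3 ^ 2 - a4 ^ 2) h3
  obtain ⟨y, hy⟩ := exists_root2 1 (a1 * x + a3) (-(x ^ 3 + a2 * x ^ 2 + a4 * x + a6)) one_ne_zero
  have : Infinite K := IsAlgClosed.instInfinite
  refine ⟨a1, a2 + 3 * x, a3 + a1 * x + 2 * y, a4 + 2 * a2 * x + 3 * x ^ 2 - a1 * y,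
    equivv_of_eval (g := Matrix.of ![![1, 0, x], ![0, 1, y], ![0, 0, 1]]) ?_ ?_, ?_⟩
  · rw [det_mat]; simp
  · intro p
    rw [mulVec_mat, eval_wei, eval_wei]
    simp
    linear_combination p 2 ^ 3 * hy
  · linear_combination hx + (a1 ^ 2 + 4 * (a2 + 3 * x)) * hy

theorem normal_step4 [IsAlgClosed K] {b1 b2 b3 b4 : K} (hF : IsSmoothCurve (wei b1 b2 b3 b4 0) 3)
    (h : -b1 * b3 * b4 + b2 * b3 ^ 2 - b4 ^ 2 = 0) :
    ∃ A B : K, B ≠ 0 ∧ Equivv (wei b1 b2 b3 b4 0) (wei A 0 B 0 0) := by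
  have h3 : b3 ≠ 0 := by
    rintro rfl
    have h4 : b4 = 0 := by simpa using h
    obtain ⟨i, hi⟩ := hF.2.2 ![0, 0, 1] (by intro h; simpa using congrFun h 2)
      (by rw [eval_wei]; simp)
    obtain ⟨p0, p1, p2⟩ := eval_pderiv_wei b1 b2 0 b4 0 ![0, 0, 1]
    fin_cases i
    · apply hi; refine p0.trans ?_; simp [h4]
    · apply hi; refine p1.trans ?_; simp [h4]
    · apply hi; refine p2.trans ?_; simp [h4]
  have : Infinite K := IsAlgClosed.instInfinite
  obtain ⟨r, hr⟩ : ∃ r, b3 * r = b4 := ⟨b4 / b3, by field_simp⟩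
  have hr2 : r ^ 2 + b1 * r - b2 = 0 := by
    have : b3 ^ 2 * (r ^ 2 + b1 * r - b2) = 0 := by
      rw [← hr] at h; linear_combination -h
    exact (mul_eq_zero.1 this).resolve_left (pow_ne_zero 2 h3)
  refine ⟨b1 + 2 * r, b3, h3, equivv_of_eval
    (g := Matrix.of ![![1, 0, 0], ![r, 1, 0], ![0, 0, 1]]) ?_ ?_⟩
  · rw [det_mat]; simp
  · intro p
    rw [mulVec_mat, eval_wei, eval_wei]
    simp
    linear_combination p 0 ^ 2 * p 2 * hr2 + p 0 * p 2 ^ 2 * hr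

def hesse (l : K) : MvPolynomial (Fin 3) K :=
  X 0 ^ 3 + X 1 ^ 3 + X 2 ^ 3 + MvPolynomial.C l * X 0 * X 1 * X 2

theorem eval_hesse (l : K) (p : Fin 3 → K) : eval p (hesse l) =
    p 0 ^ 3 + p 1 ^ 3 + p 2 ^ 3 + l * p 0 * p 1 * p 2 := by
  simp [hesse]

theorem eval_pderiv_hesse (l : K) (p : Fin 3 → K) :
    eval p (pderiv 0 (hesse l)) = 3 * p 0 ^ 2 + l * p 1 * p 2 ∧
    eval p (pderiv 1 (hesse l)) = 3 * p 1 ^ 2 + l * p 0 * p 2 ∧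
    eval p (pderiv 2 (hesse l)) = 3 * p 2 ^ 2 + l * p 0 * p 1 := by
  refine ⟨?_, ?_, ?_⟩ <;>
  · simp [hesse, pderiv_X, Pi.single_apply, Derivation.leibniz, Derivation.leibniz_pow]
    try ring

theorem hesse_smooth_imp (h3 : (3 : K) ≠ 0) {l : K} (h : IsSmoothCurve (hesse l) 3) :
    l ^ 3 + 27 ≠ 0 := by
  intro h0
  have hl : l ≠ 0 := by
    rintro rfl
    apply h3
    have : (3 : K) ^ 3 = 0 := by linear_combination h0
    exact pow_eq_zero_iff (n := 3) (by norm_num) |>.1 this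
  obtain ⟨t, ht⟩ : ∃ t, l * t = -3 := ⟨-3 / l, by field_simp⟩
  have ht2 : 3 * t ^ 2 + l = 0 := by
    have : l ^ 2 * (3 * t ^ 2 + l) = 0 := by linear_combination h0 + 3 * (l * t - 3) * ht
    exact (mul_eq_zero.1 this).resolve_left (pow_ne_zero 2 hl)
  have ht3 : t ^ 3 = 1 := by
    have : 3 * (t ^ 3 - 1) = 0 := by linear_combination t * ht2 - ht
    exact sub_eq_zero.1 ((mul_eq_zero.1 this).resolve_left h3)
  obtain ⟨p0, p1, p2⟩ := eval_pderiv_hesse l ![1, 1, t]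
  obtain ⟨i, hi⟩ := h.2.2 ![1, 1, t] (by intro h; simpa using congrFun h 0)
      (by rw [eval_hesse]; simp; linear_combination ht3 + ht)
  fin_cases i
  · apply hi; refine p0.trans ?_; simp; linear_combination ht
  · apply hi; refine p1.trans ?_; simp; linear_combination ht
  · apply hi; refine p2.trans ?_; simp; linear_combination ht2

theorem exists_omega [IsAlgClosed K] : ∃ w : K, w ^ 2 + w + 1 = 0 := by
  obtain ⟨w, hw⟩ := exists_root2 (1 : K) 1 1 one_ne_zero
  exact ⟨w, by linear_combination hw⟩

/-- The Fourier substitution. -/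
theorem normal_step5 [IsAlgClosed K] (h3 : (3 : K) ≠ 0) {A B : K} (hB : B ≠ 0) :
    ∃ c : ℕ → ℕ → K, Equivv (wei A 0 B 0 0) (cub c) ∧ c 2 1 = 0 ∧ c 2 0 = 0 ∧ c 1 2 = 0 ∧
      c 0 2 = 0 ∧ c 1 0 = 0 ∧ c 0 1 = 0 ∧ c 0 3 ≠ 0 ∧ c 0 0 ≠ 0 ∧ c 1 1 = -A * B := by
  have : Infinite K := IsAlgClosed.instInfinite
  obtain ⟨w, hw⟩ := exists_omega (K := K)
  have hw3 : w ^ 3 = 1 := by linear_combination (w - 1) * hw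
  obtain ⟨r, hr⟩ : ∃ r, 3 * B * r = - A := ⟨-A / (3 * B), by field_simp⟩
  refine ⟨fun i j => if i = 3 ∧ j = 0 then -1 - B ^ 2 * r ^ 3 else if i = 0 ∧ j = 3 then -B ^ 2 else
    if i = 0 ∧ j = 0 then -B ^ 2 else if i = 1 ∧ j = 1 then -A * B else 0,
    equivv_of_eval (g := Matrix.of ![![1, 0, 0], ![B * r, B, B], ![r, w, w ^ 2]]) ?_ ?_, ?_⟩
  · rw [det_mat]
    have : B * (w ^ 2 - w) ≠ 0 := by
      refine mul_ne_zero hB fun h => h3 ?_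
      linear_combination -(w ^ 2 - w) * h + (w ^ 2 - 3 * w + 3) * hw
    intro h; apply this; linear_combination h
  · intro p
    rw [mulVec_mat, eval_wei, eval_cub]
    simp
    linear_combination (p 0 * (B * (r * p 0 + p 1 + p 2)) * (r * p 0 + w * p 1 + w ^ 2 * p 2)
      + B * p 0 * p 1 * p 2) * hr + (- B ^ 2 * (r * p 0 + p 1 + p 2) *
      (r * p 0 * p 1 + r * p 0 * p 2 + (w - 1) * (p 1 ^ 2 + p 2 ^ 2) + (1 + w * (w - 1)) * p 1 * p 2)
      + B ^ 2 * (r * p 0 + p 1 + p 2) * (r * p 0 + w * p 1 + w ^ 2 * p 2) * (p 1 + p 2)) * hw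
  · simp [hB]

theorem normal_step6 [IsAlgClosed K] {c : ℕ → ℕ → K} (hF : IsSmoothCurve (cub c) 3)
    (h1 : c 2 1 = 0) (h2 : c 2 0 = 0) (h4 : c 1 2 = 0) (h5 : c 0 2 = 0) (h6 : c 1 0 = 0)
    (h7 : c 0 1 = 0) (h8 : c 0 3 ≠ 0) (h9 : c 0 0 ≠ 0) :
    ∃ l : K, Equivv (cub c) (hesse l) ∧ (c 1 1 = 0 → l = 0) := by
  have : Infinite K := IsAlgClosed.instInfinite
  have h10 : c 3 0 ≠ 0 := by
    intro h30
    obtain ⟨i, hi⟩ := hF.2.2 ![1, 0, 0] (by intro h; simpa using congrFun h 0)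
      (by rw [eval_cub]; simp [*])
    obtain ⟨p0, p1, p2⟩ := eval_pderiv_cub c ![1, 0, 0]
    fin_cases i
    · apply hi; refine p0.trans ?_; simp [*]
    · apply hi; refine p1.trans ?_; simp [*]
    · apply hi; refine p2.trans ?_; simp [*]
  have key : ∀ a : K, a ≠ 0 → ∃ s, s ≠ 0 ∧ a * s ^ 3 = 1 := by
    intro a ha
    obtain ⟨s, hs⟩ := exists_cbrt (a⁻¹)
    refine ⟨s, ?_, by rw [hs, mul_inv_cancel₀ ha]⟩
    rintro rfl
    exact inv_ne_zero ha (by simpa using hs.symm)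
  obtain ⟨s, hs, hs'⟩ := key _ h10
  obtain ⟨t, ht, ht'⟩ := key _ h8
  obtain ⟨u, hu, hu'⟩ := key _ h9
  refine ⟨c 1 1 * s * t * u, equivv_of_eval
    (g := Matrix.of ![![s, 0, 0], ![0, t, 0], ![0, 0, u]]) ?_ ?_, fun h => by simp [h]⟩
  · rw [det_mat]; simp [hs, ht, hu]
  · intro p
    rw [mulVec_mat, eval_cub, eval_hesse]
    simp [h1, h2, h4, h5, h6, h7]
    linear_combination p 0 ^ 3 * hs' + p 1 ^ 3 * ht' + p 2 ^ 3 * hu'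

theorem hesse_normal_form [IsAlgClosed K] (h3 : (3 : K) ≠ 0) {F : MvPolynomial (Fin 3) K}
    (hF : IsSmoothCurve F 3) : ∃ l : K, Equivv F (hesse l) ∧ l ^ 3 + 27 ≠ 0 := by
  obtain ⟨c, e1, a1, a2, a3, a4⟩ := normal_step1 hF
  obtain ⟨b1, b2, b3, b4, b6, e2⟩ := normal_step2 (e1.smooth hF) a1 a2 a3 a4
  have e2 := e1.trans e2
  obtain ⟨c1, c2, c3, c4, e3, hc⟩ := normal_step3 h3 b1 b2 b3 b4 b6
  have e3 := e2.trans e3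
  obtain ⟨A, B, hB, e4⟩ := normal_step4 (e3.smooth hF) hc
  have e4 := e3.trans e4
  obtain ⟨d, e5, d1, d2, d3, d4, d5, d6, d7, d8, d9⟩ := normal_step5 h3 (A := A) hB
  have e5 := e4.trans e5
  obtain ⟨l, e6, -⟩ := normal_step6 (e5.smooth hF) d1 d2 d3 d4 d5 d6 d7 d8
  have e6 := e5.trans e6
  exact ⟨l, e6, hesse_smooth_imp h3 (e6.smooth hF)⟩


/-! ### Inflection lines of smooth cubics, and of the Hesse cubic -/

theorem hesse_isHomogeneous (l : K) : (hesse l).IsHomogeneous 3 := by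
  have hx : ∀ i : Fin 3, (X i : MvPolynomial (Fin 3) K).IsHomogeneous 1 := isHomogeneous_X K
  refine (((hx 0).pow 3).add ((hx 1).pow 3)).add ((hx 2).pow 3) |>.add ?_
  exact ((((isHomogeneous_C (Fin 3) l).mul (hx 0)).mul (hx 1)).mul (hx 2))

theorem hesse_smooth (h3 : (3 : K) ≠ 0) {l : K} (hl : l ^ 3 + 27 ≠ 0) :
    IsSmoothCurve (hesse l) 3 := by
  refine ⟨hesse_isHomogeneous l, ?_, ?_⟩
  · intro h
    have := eval_hesse l ![1, 0, 0]
    rw [h] at this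
    simp at this
  · intro p hp _
    by_contra! hcon
    obtain ⟨p0, p1, p2⟩ := eval_pderiv_hesse l p
    rw [hcon] at p0 p1 p2
    have e1 : (l ^ 3 + 27) * (p 0 * p 1 * p 2) ^ 2 = 0 := by
      linear_combination -(9 * p 1 ^ 2 * p 2 ^ 2) * p0 + 3 * l * p 1 * p 2 * p 2 ^ 2 * p1
        - l ^ 2 * p 1 * p 2 * p 0 * p 2 * p2
    have e2 : p 0 * p 1 * p 2 = 0 := by
      simpa using (mul_eq_zero.1 e1).resolve_left hl
    have e3 : ∀ x : K, 3 * x ^ 3 = 0 → x = 0 := by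
      intro x hx; simpa using (mul_eq_zero.1 hx).resolve_left h3
    apply hp
    funext i
    fin_cases i
    · show p 0 = 0; apply e3; linear_combination -p 0 * p0 - l * e2
    · show p 1 = 0; apply e3; linear_combination -p 1 * p1 - l * e2
    · show p 2 = 0; apply e3; linear_combination -p 2 * p2 - l * e2

theorem crs_ne_zero {a b : Fin 3 → K} (h : LinearIndependent K ![a, b]) : crs a b ≠ 0 := by
  rw [LinearIndependent.pair_iff] at h
  intro h0
  have c0 := congrFun h0 0
  have c1 := congrFun h0 1
  have c2 := congrFun h0 2
  simp [crs] at c0 c1 c2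
  have key : ∀ i, a i = 0 := by
    intro i
    have := (h (b i) (-a i) (by
      ext j
      fin_cases i <;> fin_cases j <;> simp <;> first | ring1 | linear_combination c0 | linear_combination -c0 | linear_combination c1 | linear_combination -c1 | linear_combination c2 | linear_combination -c2)).2
    simpa using this
  have := (h 1 0 (by ext j; simp [key]))
  simp at this

theorem prop_of_crs {w n : Fin 3 → K} (hn : n ≠ 0) (h : crs w n = 0) : ∃ t : K, w = t • n := by
  have c0 := congrFun h 0
  have c1 := congrFun h 1
  have c2 := congrFun h 2
  simp [crs] at c0 c1 c2
  obtain ⟨i, hi⟩ : ∃ i, n i ≠ 0 := by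
    by_contra! h; exact hn (funext h)
  refine ⟨w i / n i, ?_⟩
  ext j
  simp only [Pi.smul_apply, smul_eq_mul]
  field_simp
  fin_cases i <;> fin_cases j <;> simp <;> first | ring1 | linear_combination c0 | linear_combination -c0 | linear_combination c1 | linear_combination -c1 | linear_combination c2 | linear_combination -c2

theorem crs_crs (w a b : Fin 3 → K) (ha : dotv w a = 0) (hb : dotv w b = 0) :
    crs w (crs a b) = 0 := by
  rw [dotv, Fin.sum_univ_three] at ha hb
  ext j
  fin_cases j <;> simp [crs]
  · linear_combination a 0 * hb - b 0 * ha
  · linear_combination a 1 * hb - b 1 * ha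
  · linear_combination a 2 * hb - b 2 * ha

theorem prop_of_orth {a b v w : Fin 3 → K} (hab : LinearIndependent K ![a, b]) (hv : v ≠ 0)
    (va : dotv v a = 0) (vb : dotv v b = 0) (wa : dotv w a = 0) (wb : dotv w b = 0) :
    ∃ t : K, w = t • v := by
  have hn := crs_ne_zero hab
  obtain ⟨s, hs⟩ := prop_of_crs hn (crs_crs v a b va vb)
  obtain ⟨t, ht⟩ := prop_of_crs hn (crs_crs w a b wa wb)
  have hs0 : s ≠ 0 := by rintro rfl; exact hv (by simpa using hs)
  refine ⟨t / s, ?_⟩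
  rw [hs, ht, smul_smul, div_mul_cancel₀ _ hs0]

/-- anything orthogonal to `v` is in the span of two independent vectors orthogonal to `v`. -/
theorem span_of_orth {a b v u : Fin 3 → K} (hab : LinearIndependent K ![a, b]) (hv : v ≠ 0)
    (va : dotv v a = 0) (vb : dotv v b = 0) (vu : dotv v u = 0) :
    ∃ s t : K, u = s • a + t • b := by
  have hn := crs_ne_zero hab
  obtain ⟨r, hr⟩ := prop_of_crs hn (crs_crs v a b va vb)
  have hr0 : r ≠ 0 := by rintro rfl; exact hv (by simpa using hr)
  obtain ⟨i, hi⟩ : ∃ i, crs a b i ≠ 0 := by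
    by_contra! h; exact hn (funext h)
  have hd : dotv (crs a b) u = 0 := by
    have : r * dotv (crs a b) u = 0 := by
      rw [← vu, hr]; simp [dotv, Finset.mul_sum, mul_assoc]
    exact (mul_eq_zero.1 this).resolve_left hr0
  rw [dotv, Fin.sum_univ_three] at hd
  refine ⟨crs u b i / crs a b i, crs a u i / crs a b i, ?_⟩
  ext j
  simp only [Pi.add_apply, Pi.smul_apply, smul_eq_mul]
  field_simp
  simp [crs] at hd
  fin_cases i <;> fin_cases j <;> simp [crs] <;>
    first | ring1 | linear_combination hd | linear_combination -hd

def IsFlex (F : MvPolynomial (Fin 3) K) (a : Fin 3 → K) : Prop :=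
  a ≠ 0 ∧ eval a F = 0 ∧ ∃ b, LinearIndependent K ![a, b] ∧ (lineRestrict F a b).coeff 1 = 0 ∧
    (lineRestrict F a b).coeff 2 = 0

theorem flex_transform {g h : Matrix (Fin 3) (Fin 3) K} (hgh : g * h = 1) (hhg : h * g = 1)
    {F : MvPolynomial (Fin 3) K} {a : Fin 3 → K} (ha : IsFlex (transformPoly g F) a) :
    IsFlex F (g.mulVec a) := by
  obtain ⟨h0, h1, b, h2, h3, h4⟩ := ha
  rw [eval_transformPoly] at h1
  rw [lineRestrict_transformPoly] at h3 h4
  exact ⟨mulVec_ne_zero hhg h0, h1, g.mulVec b, linInd_mulVec hhg h2, h3, h4⟩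

theorem coeff_one_lineRestrict_cub (c : ℕ → ℕ → K) (a b : Fin 3 → K) :
    (lineRestrict (cub c) a b).coeff 1 = dotv (gradVec (cub c) a) b := by
  rw [lineRestrict_cub]
  simp [Polynomial.coeff_X, Polynomial.coeff_C]

theorem coeff_zero_lineRestrict_cub (c : ℕ → ℕ → K) (a b : Fin 3 → K) :
    (lineRestrict (cub c) a b).coeff 0 = eval a (cub c) := by
  rw [lineRestrict_cub]
  simp [Polynomial.coeff_X, Polynomial.coeff_C]

theorem qpart_span (c : ℕ → ℕ → K) (a b : Fin 3 → K) (s t : K) :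
    qpart c a (s • a + t • b) = 3 * s ^ 2 * eval a (cub c)
      + 2 * s * t * dotv (gradVec (cub c) a) b + t ^ 2 * qpart c a b := by
  obtain ⟨h0, h1, h2⟩ := eval_pderiv_cub c a
  rw [dotv, Fin.sum_univ_three]
  simp only [gradVec, h0, h1, h2, eval_cub, qpart, Pi.add_apply, Pi.smul_apply, smul_eq_mul]
  ring

theorem dotv_crs (v e : Fin 3 → K) : dotv v (crs v e) = 0 := by
  rw [dotv, Fin.sum_univ_three]; simp [crs]; ring

theorem flexe_of_isFlex {c : ℕ → ℕ → K} (hF : IsSmoothCurve (cub c) 3) {a : Fin 3 → K}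
    (ha : IsFlex (cub c) a) : flexe c a = 0 := by
  obtain ⟨h0, h1, b, hab, h3, h4⟩ := ha
  rw [coeff_one_lineRestrict_cub] at h3
  rw [coeff_two_lineRestrict_cub] at h4
  obtain ⟨i, hi⟩ : ∃ i, a i ≠ 0 := by
    by_contra! h; exact h0 (funext h)
  have hv : gradVec (cub c) a ≠ 0 := by
    obtain ⟨j, hj⟩ := hF.2.2 a h0 h1
    intro h; exact hj (congrFun h j)
  obtain ⟨r, hr⟩ := qpart_crs c a i
  obtain ⟨s, t, hst⟩ := span_of_orth hab hv (by rw [euler_cub, h1, mul_zero]) h3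
    (dotv_crs _ (Pi.single i 1))
  rw [hst, qpart_span, h1, h3, h4] at hr
  have : a i ^ 2 * flexe c a = 0 := by linear_combination hr
  exact (mul_eq_zero.1 this).resolve_left (pow_ne_zero 2 hi)

theorem isFlex_of_flexe {c : ℕ → ℕ → K} (hF : IsSmoothCurve (cub c) 3) {a : Fin 3 → K} (h0 : a ≠ 0)
    (h1 : eval a (cub c) = 0) (h : flexe c a = 0) : IsFlex (cub c) a := by
  obtain ⟨i, hi⟩ : ∃ i, a i ≠ 0 := by
    by_contra! h; exact h0 (funext h)
  set v := gradVec (cub c) a with hvd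
  obtain ⟨j, hj⟩ := hF.2.2 a h0 h1
  have hv : v j ≠ 0 := hj
  obtain ⟨r, hr⟩ := qpart_crs c a i
  refine ⟨h0, h1, crs v (Pi.single i 1), ?_, ?_, ?_⟩
  · rw [LinearIndependent.pair_iff]
    have hva : dotv v a = 0 := by rw [hvd, euler_cub, h1, mul_zero]
    rw [dotv, Fin.sum_univ_three] at hva
    intro s t hst
    have ht : t = 0 := by
      have c0 := congrFun hst 0
      have c1 := congrFun hst 1
      have c2 := congrFun hst 2
      simp [crs] at c0 c1 c2
      have : t * a i * v j = 0 := by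
        fin_cases i <;> fin_cases j <;> simp at c0 c1 c2 ⊢ <;> grind
      simpa [hi, hv] using this
    subst ht
    refine ⟨?_, rfl⟩
    have := congrFun hst i
    simpa [hi] using this
  · rw [coeff_one_lineRestrict_cub]; exact dotv_crs _ _
  · rw [coeff_two_lineRestrict_cub, hvd, hr, h, h1]; ring

/-- Every inflection line is the tangent at a flex. -/
theorem flex_of_infl {c : ℕ → ℕ → K} (hF : IsSmoothCurve (cub c) 3) {w : Fin 3 → K}
    (hw : IsInflLine (cub c) w) :
    ∃ a, IsFlex (cub c) a ∧ ∃ t : K, t ≠ 0 ∧ w = t • gradVec (cub c) a := by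
  obtain ⟨h0, a, b, ha, hb, hab, hl, hc⟩ := hw
  have hd : Polynomial.X ^ 3 ∣ lineRestrict (cub c) a b := by
    have := (Polynomial.le_rootMultiplicity_iff hl).1 hc
    simpa using this
  rw [Polynomial.X_pow_dvd_iff] at hd
  have e0 := hd 0 (by norm_num)
  have e1 := hd 1 (by norm_num)
  have e2 := hd 2 (by norm_num)
  rw [coeff_zero_lineRestrict_cub] at e0
  have ha0 : a ≠ 0 := by simpa using hab.ne_zero 0
  refine ⟨a, ⟨ha0, e0, b, hab, e1, e2⟩, ?_⟩
  rw [coeff_one_lineRestrict_cub] at e1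
  have hv : gradVec (cub c) a ≠ 0 := by
    obtain ⟨j, hj⟩ := hF.2.2 a ha0 e0
    intro h; exact hj (congrFun h j)
  obtain ⟨t, ht⟩ := prop_of_orth hab hv (by rw [euler_cub, e0, mul_zero]) e1 ha hb
  refine ⟨t, ?_, ht⟩
  rintro rfl
  exact h0 (by simpa using ht)


/-! ### The nine inflection lines of the Hesse cubic -/

def hc (l : K) : ℕ → ℕ → K := fun i j =>
  if i = 1 ∧ j = 1 then l else if (i = 3 ∧ j = 0) ∨ (i = 0 ∧ j = 3) ∨ (i = 0 ∧ j = 0) then 1 else 0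

theorem hesse_eq_cub (l : K) : hesse l = cub (hc l) := by
  simp [hesse, cub, hc]

theorem flexe_hesse (l : K) (a : Fin 3 → K) : flexe (hc l) a =
    (l ^ 3 + 27) * (a 0 * a 1 * a 2) - l ^ 2 * eval a (hesse l) := by
  rw [eval_hesse]; simp [flexe, hc]; ring

/-- cyclic permutation -/
def cyc : Matrix (Fin 3) (Fin 3) K := Matrix.of ![![0, 1, 0], ![0, 0, 1], ![1, 0, 0]]

def cyci : Matrix (Fin 3) (Fin 3) K := Matrix.of ![![0, 0, 1], ![1, 0, 0], ![0, 1, 0]]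

def dia (e : K) : Matrix (Fin 3) (Fin 3) K := Matrix.of ![![1, 0, 0], ![0, e, 0], ![0, 0, e ^ 2]]

theorem cyc_mulVec (p : Fin 3 → K) : cyc.mulVec p = ![p 1, p 2, p 0] := by
  rw [cyc, mulVec_mat]; simp

theorem cyci_mulVec (p : Fin 3 → K) : cyci.mulVec p = ![p 2, p 0, p 1] := by
  rw [cyci, mulVec_mat]; simp

theorem dia_mulVec (e : K) (p : Fin 3 → K) : (dia e).mulVec p = ![p 0, e * p 1, e ^ 2 * p 2] := by
  rw [dia, mulVec_mat]; simp

theorem cyc_cyci : (cyc * cyci : Matrix (Fin 3) (Fin 3) K) = 1 := by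
  ext i j; fin_cases i <;> fin_cases j <;> simp [cyc, cyci, Matrix.mul_apply, Fin.sum_univ_three]

theorem cyci_cyc : (cyci * cyc : Matrix (Fin 3) (Fin 3) K) = 1 := by
  ext i j; fin_cases i <;> fin_cases j <;> simp [cyc, cyci, Matrix.mul_apply, Fin.sum_univ_three]

theorem cyci_transpose : (cyci : Matrix (Fin 3) (Fin 3) K).transpose = cyc := by
  ext i j; fin_cases i <;> fin_cases j <;> simp [cyc, cyci]

theorem dia_transpose (e : K) : (dia e).transpose = dia e := by
  ext i j; fin_cases i <;> fin_cases j <;> simp [dia]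

theorem dia_mul {e : K} (he : e ^ 3 = 1) : dia e * dia (e ^ 2) = 1 := by
  ext i j; fin_cases i <;> fin_cases j <;> simp [dia, Matrix.mul_apply, Fin.sum_univ_three]
  · linear_combination he
  · linear_combination (e ^ 3 + 1) * he

theorem dia_mul2 {e : K} (he : e ^ 3 = 1) : dia (e ^ 2) * dia e = 1 := by
  ext i j; fin_cases i <;> fin_cases j <;> simp [dia, Matrix.mul_apply, Fin.sum_univ_three]
  · linear_combination he
  · linear_combination (e ^ 3 + 1) * he

theorem funext_poly [Infinite K] {P Q : MvPolynomial (Fin 3) K} (h : ∀ p, eval p P = eval p Q) :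
    P = Q := MvPolynomial.funext h

theorem hesse_cyci [Infinite K] (l : K) : transformPoly cyci (hesse l) = hesse l := by
  apply funext_poly; intro p
  rw [eval_transformPoly, cyci_mulVec, eval_hesse, eval_hesse]; simp; ring

theorem hesse_dia [Infinite K] (l : K) {e : K} (he : e ^ 3 = 1) :
    transformPoly (dia e) (hesse l) = hesse l := by
  apply funext_poly; intro p
  rw [eval_transformPoly, dia_mulVec, eval_hesse, eval_hesse]; simp
  linear_combination (p 1 ^ 3 + (e ^ 3 + 1) * p 2 ^ 3 + l * p 0 * p 1 * p 2) * he

theorem infl_cyc [Infinite K] {l : K} {w : Fin 3 → K} (hw : IsInflLine (hesse l) w) :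
    IsInflLine (hesse l) (cyc.mulVec w) := by
  have := infl_transform cyci_cyc cyc_cyci hw
  rwa [hesse_cyci, cyci_transpose] at this

theorem infl_dia [Infinite K] {l : K} {w : Fin 3 → K} (hw : IsInflLine (hesse l) w) {e : K}
    (he : e ^ 3 = 1) : IsInflLine (hesse l) ((dia e).mulVec w) := by
  have := infl_transform (dia_mul he) (dia_mul2 he) hw
  rwa [hesse_dia l he, dia_transpose] at this

def P0 (l : K) : Fin 3 → K := ![-l, 3, 3]

theorem infl_P0 (h3 : (3 : K) ≠ 0) {l : K} (hl : l ^ 3 + 27 ≠ 0) : IsInflLine (hesse l) (P0 l) := by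
  have hlr : lineRestrict (hesse l) ![0, 1, -1] ![3, l, 0] = Polynomial.C (27 + l ^ 3) * Polynomial.X ^ 3 := by
    rw [hesse_eq_cub, lineRestrict_cub, ← hesse_eq_cub, eval_hesse, eval_hesse]
    have e1 : dotv (gradVec (hesse l) ![0, 1, -1]) ![3, l, 0] = 0 := by
      obtain ⟨p0, p1, p2⟩ := eval_pderiv_hesse l ![0, 1, -1]
      rw [dotv, Fin.sum_univ_three]; simp only [gradVec, p0, p1, p2]; simp; ring
    have e2 : qpart (hc l) ![0, 1, -1] ![3, l, 0] = 0 := by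
      simp [qpart, hc]; ring
    rw [e1, e2]
    have e3 : (![(0:K), 1, -1] 0 ^ 3 + ![(0:K), 1, -1] 1 ^ 3 + ![(0:K), 1, -1] 2 ^ 3 + l * ![(0:K), 1, -1] 0 * ![(0:K), 1, -1] 1 * ![(0:K), 1, -1] 2) = 0 := by simp; norm_num
    have e4 : (![(3:K), l, 0] 0 ^ 3 + ![(3:K), l, 0] 1 ^ 3 + ![(3:K), l, 0] 2 ^ 3 + l * ![(3:K), l, 0] 0 * ![(3:K), l, 0] 1 * ![(3:K), l, 0] 2) = 27 + l ^ 3 := by simp; norm_num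
    rw [e3, e4]
    simp only [Polynomial.C_0, zero_mul, zero_add]
  have hne : (27 + l ^ 3 : K) ≠ 0 := by rwa [add_comm]
  have hlr0 : lineRestrict (hesse l) ![0, 1, -1] ![3, l, 0] ≠ 0 := by
    rw [hlr]
    exact mul_ne_zero (Polynomial.C_ne_zero.2 hne) (pow_ne_zero 3 Polynomial.X_ne_zero)
  refine ⟨fun h => h3 (by simpa [P0] using congrFun h 1), ![0, 1, -1], ![3, l, 0], ?_, ?_, ?_, ?_, ?_⟩
  · simp [P0, dotv, Fin.sum_univ_three]
  · simp [P0, dotv, Fin.sum_univ_three]; ring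
  · rw [LinearIndependent.pair_iff]
    intro s t h
    have c0 := congrFun h 0
    have c2 := congrFun h 2
    simp [h3] at c0 c2
    exact ⟨c2, c0⟩
  · exact hlr0
  · have hX : (Polynomial.X ^ 3 : Polynomial K) = (Polynomial.X - Polynomial.C 0) ^ 3 := by simp
    rw [contactAt, Polynomial.le_rootMultiplicity_iff hlr0, hlr, hX]
    exact dvd_mul_left _ _

theorem infl_induction [Infinite K] (h3 : (3 : K) ≠ 0) {l : K} (hl : l ^ 3 + 27 ≠ 0)
    (Pred : (Fin 3 → K) → Prop) (hs : ∀ (s : K) w, s ≠ 0 → Pred w → Pred (s • w))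
    (hcyc : ∀ w, Pred w → Pred (cyc.mulVec w))
    (hdia : ∀ (e : K) w, e ^ 3 = 1 → Pred w → Pred ((dia e).mulVec w)) (h0 : Pred (P0 l)) :
    ∀ w, IsInflLine (hesse l) w → Pred w := by
  intro w hw
  have hsm := hesse_smooth h3 hl
  rw [hesse_eq_cub] at hsm hw
  obtain ⟨a, hf, t, ht, rfl⟩ := flex_of_infl hsm hw
  have h1 := flexe_of_isFlex hsm hf
  rw [← hesse_eq_cub] at hf
  obtain ⟨ha, hfa, -⟩ := hf
  rw [flexe_hesse, hfa, mul_zero, sub_zero] at h1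
  have h2 := (mul_eq_zero.1 h1).resolve_left hl
  apply hs _ _ ht
  rw [← hesse_eq_cub]
  rw [eval_hesse] at hfa
  obtain ⟨p0, p1, p2⟩ := eval_pderiv_hesse l a
  have key : ∀ x y : K, x ^ 3 + y ^ 3 = 0 → (x ≠ 0 ∨ y ≠ 0) → Pred ![l * x * y, 3 * x ^ 2, 3 * y ^ 2] := by
    intro x y hxy hne
    have hx : x ≠ 0 := by
      rintro rfl
      have : y = 0 := by simpa using hxy
      simp [this] at hne
    have hy : y ≠ 0 := by
      rintro rfl
      have : x = 0 := by simpa using hxy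
      simp [this] at hne
    obtain ⟨e, he⟩ : ∃ e, e * y = - x := ⟨-x / y, by field_simp⟩
    have he3 : e ^ 3 = 1 := by
      have : y ^ 3 * (e ^ 3 - 1) = 0 := by
        linear_combination (e ^ 2 * y ^ 2 - e * y * x + x ^ 2) * he - hxy
      exact sub_eq_zero.1 ((mul_eq_zero.1 this).resolve_left (pow_ne_zero 3 hy))
    have hx' : e ^ 2 * x = -y := by
      linear_combination e ^ 2 * he - y * he3
    have h5 := hs (-x * y) _ (mul_ne_zero (neg_ne_zero.2 hx) hy) (hdia e _ he3 h0)
    convert h5 using 1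
    rw [dia_mulVec]
    ext j
    fin_cases j <;> simp [P0]
    · ring
    · linear_combination 3 * x * he
    · linear_combination 3 * y * hx'
  have hz : ∀ b : Fin 3 → K, b 0 = 0 → b ≠ 0 → (b 1 ≠ 0 ∨ b 2 ≠ 0) := by
    intro b h0 hb
    by_contra! h
    apply hb; ext j; fin_cases j <;> simp [h0, h]
  rcases mul_eq_zero.1 h2 with h2 | h2
  · rcases mul_eq_zero.1 h2 with h2 | h2
    · have := key (a 1) (a 2) (by rw [h2] at hfa; linear_combination hfa) (by
        by_contra! h
        apply ha; ext j; fin_cases j <;> simp [h2, h])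
      convert this using 1
      ext j; fin_cases j <;> simp [gradVec, p0, p1, p2, h2]
    · have := key (a 2) (a 0) (by rw [h2] at hfa; linear_combination hfa) (by
        by_contra! h
        apply ha; ext j; fin_cases j <;> simp [h2, h])
      convert hcyc _ (hcyc _ this) using 1
      rw [cyc_mulVec, cyc_mulVec]
      ext j; fin_cases j <;> simp [gradVec, p0, p1, p2, h2] <;> ring
  · have := key (a 0) (a 1) (by rw [h2] at hfa; linear_combination hfa) (by
      by_contra! h
      apply ha; ext j; fin_cases j <;> simp [h2, h])
    convert (hcyc _ this) using 1
    rw [cyc_mulVec]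
    ext j; fin_cases j <;> simp [gradVec, p0, p1, p2, h2]

/-- the twisted points -/
theorem infl_Pe [Infinite K] (h3 : (3 : K) ≠ 0) {l : K} (hl : l ^ 3 + 27 ≠ 0) {e : K} (he : e ^ 3 = 1) :
    IsInflLine (hesse l) ![-l, 3 * e, 3 * e ^ 2] := by
  have := infl_dia (infl_P0 h3 hl) he
  rw [dia_mulVec] at this
  convert this using 1
  ext j; fin_cases j <;> simp [P0] <;> ring

/-- separation of weights -/
theorem sep [IsAlgClosed K] (h3 : (3 : K) ≠ 0) {x y z : K}
    (h : ∀ e : K, e ^ 3 = 1 → x + e * y + e ^ 2 * z = 0) : x = 0 ∧ y = 0 ∧ z = 0 := by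
  obtain ⟨w, hw⟩ := exists_omega (K := K)
  have hw3 : w ^ 3 = 1 := by linear_combination (w - 1) * hw
  have a1 := h 1 (by ring)
  have a2 := h w hw3
  have a3 := h (w ^ 2) (by linear_combination (w ^ 3 + 1) * hw3)
  refine ⟨?_, ?_, ?_⟩ <;> refine (mul_eq_zero.1 (?_ : (3 : K) * _ = 0)).resolve_left h3
  · linear_combination a1 + a2 + a3 - y * hw - z * (w ^ 2 - w + 1) * hw
  · linear_combination a1 + w ^ 2 * a2 + w * a3 - x * hw - 2 * y * hw3 - z * (w ^ 3 - w + 1) * hw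
  · linear_combination a1 + w * a2 + w ^ 2 * a3 - x * hw - y * (w ^ 2 - w + 1) * hw - z * (w ^ 3 + 2) * hw3


/-! ### Cubics through the nine points -/

def rotc (c : ℕ → ℕ → K) : ℕ → ℕ → K := fun a b => c b (3 - a - b)

theorem eval_rotc (c : ℕ → ℕ → K) (p : Fin 3 → K) :
    eval p (cub (rotc c)) = eval (cyc.mulVec p) (cub c) := by
  rw [cyc_mulVec, eval_cub, eval_cub]; simp [rotc]; ring

theorem cubics_base [IsAlgClosed K] (h3 : (3 : K) ≠ 0) {l : K} (hl : l ^ 3 + 27 ≠ 0)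
    {c : ℕ → ℕ → K} (h : ∀ w, IsInflLine (hesse l) w → eval w (cub c) = 0) :
    -l ^ 3 * c 3 0 + 27 * (c 0 3 + c 0 0) - 9 * l * c 1 1 = 0 ∧
    l ^ 2 * c 2 1 + 9 * c 0 2 - 3 * l * c 1 0 = 0 ∧
    l ^ 2 * c 2 0 + 9 * c 0 1 - 3 * l * c 1 2 = 0 := by
  haveI : Infinite K := IsAlgClosed.instInfinite
  have h' : ∀ e : K, e ^ 3 = 1 → (-l ^ 3 * c 3 0 + 27 * (c 0 3 + c 0 0) - 9 * l * c 1 1)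
      + e * (3 * (l ^ 2 * c 2 1 + 9 * c 0 2 - 3 * l * c 1 0))
      + e ^ 2 * (3 * (l ^ 2 * c 2 0 + 9 * c 0 1 - 3 * l * c 1 2)) = 0 := by
    intro e he
    have := h _ (infl_Pe h3 hl he)
    rw [eval_cub] at this
    simp at this
    linear_combination this - (27 * c 0 3 + 27 * c 0 0 * (e ^ 3 + 1) + 27 * e * c 0 2 - 9 * l * e * c 1 0 + 27 * e ^ 2 * c 0 1 - 9 * l * c 1 1) * he
  obtain ⟨a1, a2, a3⟩ := sep h3 h'
  exact ⟨a1, (mul_eq_zero.1 a2).resolve_left h3, (mul_eq_zero.1 a3).resolve_left h3⟩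

theorem circ_zero {l x y z : K} (h3 : (3 : K) ≠ 0) (hl : l ^ 3 + 27 ≠ 0) 
    (e1 : l ^ 2 * x + 9 * y - 3 * l * z = 0) (e3 : l ^ 2 * z + 9 * x - 3 * l * y = 0) : x = 0 := by
  refine (mul_eq_zero.1 (?_ : (l ^ 3 + 27) * x = 0)).resolve_left hl
  linear_combination l * e1 + 3 * e3

theorem cubics_thru [IsAlgClosed K] (h3 : (3 : K) ≠ 0) {l : K} (hl : l ^ 3 + 27 ≠ 0)
    {c : ℕ → ℕ → K} (h : ∀ w, IsInflLine (hesse l) w → eval w (cub c) = 0) :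
    (c 2 1 = 0 ∧ c 0 2 = 0 ∧ c 1 0 = 0 ∧ c 2 0 = 0 ∧ c 0 1 = 0 ∧ c 1 2 = 0) ∧
    c 0 3 = c 3 0 ∧ c 0 0 = c 3 0 ∧ (54 - l ^ 3) * c 3 0 = 9 * l * c 1 1 := by
  haveI : Infinite K := IsAlgClosed.instInfinite
  have h' : ∀ w, IsInflLine (hesse l) w → eval w (cub (rotc c)) = 0 := fun w hw => by
    rw [eval_rotc]; exact h _ (infl_cyc hw)
  have h'' : ∀ w, IsInflLine (hesse l) w → eval w (cub (rotc (rotc c))) = 0 := fun w hw => by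
    rw [eval_rotc]; exact h' _ (infl_cyc hw)
  obtain ⟨a1, a2, a3⟩ := cubics_base h3 hl h
  obtain ⟨b1, b2, b3⟩ := cubics_base h3 hl h'
  obtain ⟨c1, c2, c3⟩ := cubics_base h3 hl h''
  simp [rotc] at b1 b2 b3 c1 c2 c3
  have hd : ∀ x : K, (l ^ 3 + 27) * x = 0 → x = 0 := fun x hx => (mul_eq_zero.1 hx).resolve_left hl
  have q1 : c 0 3 - c 3 0 = 0 := by
    apply hd
    first
    | linear_combination a1 - b1
    | linear_combination a1 - c1
    | linear_combination b1 - a1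
    | linear_combination c1 - a1
  have q2 : c 0 0 - c 3 0 = 0 := by
    apply hd
    first
    | linear_combination a1 - b1
    | linear_combination a1 - c1
    | linear_combination b1 - a1
    | linear_combination c1 - a1
  refine ⟨⟨?_, ?_, ?_, ?_, ?_, ?_⟩, sub_eq_zero.1 q1, sub_eq_zero.1 q2, ?_⟩
  iterate 6
    first
    | exact circ_zero h3 hl a2 b2
    | exact circ_zero h3 hl a2 c2
    | exact circ_zero h3 hl b2 c2
    | exact circ_zero h3 hl b2 a2
    | exact circ_zero h3 hl c2 a2
    | exact circ_zero h3 hl c2 b2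
    | exact circ_zero h3 hl a3 b3
    | exact circ_zero h3 hl a3 c3
    | exact circ_zero h3 hl b3 c3
    | exact circ_zero h3 hl b3 a3
    | exact circ_zero h3 hl c3 a3
    | exact circ_zero h3 hl c3 b3
  linear_combination a1 - 27 * q1 - 27 * q2


/-! ### Sextics singular at the nine points -/

def sext (c : ℕ → ℕ → K) : MvPolynomial (Fin 3) K :=
  MvPolynomial.C (c 0 0) * X 2 ^ 6
  + MvPolynomial.C (c 0 1) * X 1 * X 2 ^ 5
  + MvPolynomial.C (c 0 2) * X 1 ^ 2 * X 2 ^ 4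
  + MvPolynomial.C (c 0 3) * X 1 ^ 3 * X 2 ^ 3
  + MvPolynomial.C (c 0 4) * X 1 ^ 4 * X 2 ^ 2
  + MvPolynomial.C (c 0 5) * X 1 ^ 5 * X 2
  + MvPolynomial.C (c 0 6) * X 1 ^ 6
  + MvPolynomial.C (c 1 0) * X 0 * X 2 ^ 5
  + MvPolynomial.C (c 1 1) * X 0 * X 1 * X 2 ^ 4
  + MvPolynomial.C (c 1 2) * X 0 * X 1 ^ 2 * X 2 ^ 3
  + MvPolynomial.C (c 1 3) * X 0 * X 1 ^ 3 * X 2 ^ 2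
  + MvPolynomial.C (c 1 4) * X 0 * X 1 ^ 4 * X 2
  + MvPolynomial.C (c 1 5) * X 0 * X 1 ^ 5
  + MvPolynomial.C (c 2 0) * X 0 ^ 2 * X 2 ^ 4
  + MvPolynomial.C (c 2 1) * X 0 ^ 2 * X 1 * X 2 ^ 3
  + MvPolynomial.C (c 2 2) * X 0 ^ 2 * X 1 ^ 2 * X 2 ^ 2
  + MvPolynomial.C (c 2 3) * X 0 ^ 2 * X 1 ^ 3 * X 2
  + MvPolynomial.C (c 2 4) * X 0 ^ 2 * X 1 ^ 4
  + MvPolynomial.C (c 3 0) * X 0 ^ 3 * X 2 ^ 3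
  + MvPolynomial.C (c 3 1) * X 0 ^ 3 * X 1 * X 2 ^ 2
  + MvPolynomial.C (c 3 2) * X 0 ^ 3 * X 1 ^ 2 * X 2
  + MvPolynomial.C (c 3 3) * X 0 ^ 3 * X 1 ^ 3
  + MvPolynomial.C (c 4 0) * X 0 ^ 4 * X 2 ^ 2
  + MvPolynomial.C (c 4 1) * X 0 ^ 4 * X 1 * X 2
  + MvPolynomial.C (c 4 2) * X 0 ^ 4 * X 1 ^ 2
  + MvPolynomial.C (c 5 0) * X 0 ^ 5 * X 2
  + MvPolynomial.C (c 5 1) * X 0 ^ 5 * X 1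
  + MvPolynomial.C (c 6 0) * X 0 ^ 6

theorem exists_sext {F : MvPolynomial (Fin 3) K} (hF : F.IsHomogeneous 6) :
    ∃ c : ℕ → ℕ → K, F = sext c := by
  obtain ⟨c, hc⟩ := isHomogeneous_expand hF
  refine ⟨c, hc.trans ?_⟩
  simp only [Finset.sum_range_succ, Finset.sum_range_zero, sext, Nat.add_one_sub_one, Nat.reduceSub,
    Nat.reduceAdd, pow_zero, mul_one, zero_add, pow_one]
  ring

theorem eval_sext (c : ℕ → ℕ → K) (p : Fin 3 → K) : eval p (sext c) =
    c 0 0 * p 2 ^ 6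
    + c 0 1 * p 1 * p 2 ^ 5
    + c 0 2 * p 1 ^ 2 * p 2 ^ 4
    + c 0 3 * p 1 ^ 3 * p 2 ^ 3
    + c 0 4 * p 1 ^ 4 * p 2 ^ 2
    + c 0 5 * p 1 ^ 5 * p 2
    + c 0 6 * p 1 ^ 6
    + c 1 0 * p 0 * p 2 ^ 5
    + c 1 1 * p 0 * p 1 * p 2 ^ 4
    + c 1 2 * p 0 * p 1 ^ 2 * p 2 ^ 3
    + c 1 3 * p 0 * p 1 ^ 3 * p 2 ^ 2
    + c 1 4 * p 0 * p 1 ^ 4 * p 2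
    + c 1 5 * p 0 * p 1 ^ 5
    + c 2 0 * p 0 ^ 2 * p 2 ^ 4
    + c 2 1 * p 0 ^ 2 * p 1 * p 2 ^ 3
    + c 2 2 * p 0 ^ 2 * p 1 ^ 2 * p 2 ^ 2
    + c 2 3 * p 0 ^ 2 * p 1 ^ 3 * p 2
    + c 2 4 * p 0 ^ 2 * p 1 ^ 4
    + c 3 0 * p 0 ^ 3 * p 2 ^ 3
    + c 3 1 * p 0 ^ 3 * p 1 * p 2 ^ 2
    + c 3 2 * p 0 ^ 3 * p 1 ^ 2 * p 2
    + c 3 3 * p 0 ^ 3 * p 1 ^ 3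
    + c 4 0 * p 0 ^ 4 * p 2 ^ 2
    + c 4 1 * p 0 ^ 4 * p 1 * p 2
    + c 4 2 * p 0 ^ 4 * p 1 ^ 2
    + c 5 0 * p 0 ^ 5 * p 2
    + c 5 1 * p 0 ^ 5 * p 1
    + c 6 0 * p 0 ^ 6 := by
  simp [sext]

theorem eval_pderiv_sext0 (c : ℕ → ℕ → K) (p : Fin 3 → K) : eval p (pderiv 0 (sext c)) =
    c 1 0 * p 2 ^ 5
    + c 1 1 * p 1 * p 2 ^ 4
    + c 1 2 * p 1 ^ 2 * p 2 ^ 3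
    + c 1 3 * p 1 ^ 3 * p 2 ^ 2
    + c 1 4 * p 1 ^ 4 * p 2
    + c 1 5 * p 1 ^ 5
    + 2 * c 2 0 * p 0 * p 2 ^ 4
    + 2 * c 2 1 * p 0 * p 1 * p 2 ^ 3
    + 2 * c 2 2 * p 0 * p 1 ^ 2 * p 2 ^ 2
    + 2 * c 2 3 * p 0 * p 1 ^ 3 * p 2
    + 2 * c 2 4 * p 0 * p 1 ^ 4
    + 3 * c 3 0 * p 0 ^ 2 * p 2 ^ 3
    + 3 * c 3 1 * p 0 ^ 2 * p 1 * p 2 ^ 2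
    + 3 * c 3 2 * p 0 ^ 2 * p 1 ^ 2 * p 2
    + 3 * c 3 3 * p 0 ^ 2 * p 1 ^ 3
    + 4 * c 4 0 * p 0 ^ 3 * p 2 ^ 2
    + 4 * c 4 1 * p 0 ^ 3 * p 1 * p 2
    + 4 * c 4 2 * p 0 ^ 3 * p 1 ^ 2
    + 5 * c 5 0 * p 0 ^ 4 * p 2
    + 5 * c 5 1 * p 0 ^ 4 * p 1
    + 6 * c 6 0 * p 0 ^ 5 := by
  simp [sext, pderiv_X, Pi.single_apply, Derivation.leibniz, Derivation.leibniz_pow]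
  ring

theorem eval_pderiv_sext1 (c : ℕ → ℕ → K) (p : Fin 3 → K) : eval p (pderiv 1 (sext c)) =
    c 0 1 * p 2 ^ 5
    + 2 * c 0 2 * p 1 * p 2 ^ 4
    + 3 * c 0 3 * p 1 ^ 2 * p 2 ^ 3
    + 4 * c 0 4 * p 1 ^ 3 * p 2 ^ 2
    + 5 * c 0 5 * p 1 ^ 4 * p 2
    + 6 * c 0 6 * p 1 ^ 5
    + c 1 1 * p 0 * p 2 ^ 4
    + 2 * c 1 2 * p 0 * p 1 * p 2 ^ 3
    + 3 * c 1 3 * p 0 * p 1 ^ 2 * p 2 ^ 2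
    + 4 * c 1 4 * p 0 * p 1 ^ 3 * p 2
    + 5 * c 1 5 * p 0 * p 1 ^ 4
    + c 2 1 * p 0 ^ 2 * p 2 ^ 3
    + 2 * c 2 2 * p 0 ^ 2 * p 1 * p 2 ^ 2
    + 3 * c 2 3 * p 0 ^ 2 * p 1 ^ 2 * p 2
    + 4 * c 2 4 * p 0 ^ 2 * p 1 ^ 3
    + c 3 1 * p 0 ^ 3 * p 2 ^ 2
    + 2 * c 3 2 * p 0 ^ 3 * p 1 * p 2
    + 3 * c 3 3 * p 0 ^ 3 * p 1 ^ 2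
    + c 4 1 * p 0 ^ 4 * p 2
    + 2 * c 4 2 * p 0 ^ 4 * p 1
    + c 5 1 * p 0 ^ 5 := by
  simp [sext, pderiv_X, Pi.single_apply, Derivation.leibniz, Derivation.leibniz_pow]
  ring

theorem eval_pderiv_sext2 (c : ℕ → ℕ → K) (p : Fin 3 → K) : eval p (pderiv 2 (sext c)) =
    6 * c 0 0 * p 2 ^ 5
    + 5 * c 0 1 * p 1 * p 2 ^ 4
    + 4 * c 0 2 * p 1 ^ 2 * p 2 ^ 3
    + 3 * c 0 3 * p 1 ^ 3 * p 2 ^ 2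
    + 2 * c 0 4 * p 1 ^ 4 * p 2
    + c 0 5 * p 1 ^ 5
    + 5 * c 1 0 * p 0 * p 2 ^ 4
    + 4 * c 1 1 * p 0 * p 1 * p 2 ^ 3
    + 3 * c 1 2 * p 0 * p 1 ^ 2 * p 2 ^ 2
    + 2 * c 1 3 * p 0 * p 1 ^ 3 * p 2
    + c 1 4 * p 0 * p 1 ^ 4
    + 4 * c 2 0 * p 0 ^ 2 * p 2 ^ 3
    + 3 * c 2 1 * p 0 ^ 2 * p 1 * p 2 ^ 2
    + 2 * c 2 2 * p 0 ^ 2 * p 1 ^ 2 * p 2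
    + c 2 3 * p 0 ^ 2 * p 1 ^ 3
    + 3 * c 3 0 * p 0 ^ 3 * p 2 ^ 2
    + 2 * c 3 1 * p 0 ^ 3 * p 1 * p 2
    + c 3 2 * p 0 ^ 3 * p 1 ^ 2
    + 2 * c 4 0 * p 0 ^ 4 * p 2
    + c 4 1 * p 0 ^ 4 * p 1
    + c 5 0 * p 0 ^ 5 := by
  simp [sext, pderiv_X, Pi.single_apply, Derivation.leibniz, Derivation.leibniz_pow]
  ring

theorem sext_base [IsAlgClosed K] (h3 : (3 : K) ≠ 0) {l : K}
    {c : ℕ → ℕ → K} (h : ∀ e : K, e ^ 3 = 1 → SingAt (sext c) ![-l, 3 * e, 3 * e ^ 2]) :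
    (243) * c 1 1 + (243) * c 1 4 + (-162) * l ^ 1 * c 2 2 + (81) * l ^ 2 * c 3 0 + (81) * l ^ 2 * c 3 3 + (-36) * l ^ 3 * c 4 1 + (-6) * l ^ 5 * c 6 0 = 0 ∧
    (729) * c 0 3 + (1458) * c 0 6 + (-81) * l ^ 1 * c 1 1 + (-324) * l ^ 1 * c 1 4 + (54) * l ^ 2 * c 2 2 + (-27) * l ^ 3 * c 3 3 + (3) * l ^ 4 * c 4 1 = 0 ∧
    (1458) * c 0 0 + (729) * c 0 3 + (-324) * l ^ 1 * c 1 1 + (-81) * l ^ 1 * c 1 4 + (54) * l ^ 2 * c 2 2 + (-27) * l ^ 3 * c 3 0 + (3) * l ^ 4 * c 4 1 = 0 ∧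
    (243) * c 1 0 + (243) * c 1 3 + (-162) * l ^ 1 * c 2 1 + (-162) * l ^ 1 * c 2 4 + (81) * l ^ 2 * c 3 2 + (-36) * l ^ 3 * c 4 0 + (15) * l ^ 4 * c 5 1 = 0 ∧
    (486) * c 0 2 + (1215) * c 0 5 + (-243) * l ^ 1 * c 1 3 + (27) * l ^ 2 * c 2 1 + (108) * l ^ 2 * c 2 4 + (-18) * l ^ 3 * c 3 2 + (-1) * l ^ 5 * c 5 1 = 0 ∧
    (972) * c 0 2 + (243) * c 0 5 + (-405) * l ^ 1 * c 1 0 + (-162) * l ^ 1 * c 1 3 + (81) * l ^ 2 * c 2 1 + (-9) * l ^ 3 * c 3 2 + (6) * l ^ 4 * c 4 0 = 0 := by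
  have h0 : ∀ e : K, e ^ 3 = 1 → ((243) * c 1 1 + (243) * c 1 4 + (-162) * l ^ 1 * c 2 2 + (81) * l ^ 2 * c 3 0 + (81) * l ^ 2 * c 3 3 + (-36) * l ^ 3 * c 4 1 + (-6) * l ^ 5 * c 6 0) + e * ((243) * c 1 0 + (243) * c 1 3 + (-162) * l ^ 1 * c 2 1 + (-162) * l ^ 1 * c 2 4 + (81) * l ^ 2 * c 3 2 + (-36) * l ^ 3 * c 4 0 + (15) * l ^ 4 * c 5 1) + e ^ 2 * ((243) * c 1 2 + (243) * c 1 5 + (-162) * l ^ 1 * c 2 0 + (-162) * l ^ 1 * c 2 3 + (81) * l ^ 2 * c 3 1 + (-36) * l ^ 3 * c 4 2 + (15) * l ^ 4 * c 5 0) = 0 := by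
    intro e he
    have := (h e he).2 0
    rw [eval_pderiv_sext0] at this
    simp only [Matrix.cons_val] at this
    linear_combination this - ((243) * c 1 0 * (e ^ 7 + e ^ 4 + e ^ 1) + (243) * c 1 1 * (e ^ 6 + e ^ 3 + e ^ 0) + (243) * c 1 2 * (e ^ 5 + e ^ 2) + (243) * c 1 3 * (e ^ 4 + e ^ 1) + (243) * c 1 4 * (e ^ 3 + e ^ 0) + (243) * c 1 5 * (e ^ 2) + (-162) * l ^ 1 * c 2 0 * (e ^ 5 + e ^ 2) + (-162) * l ^ 1 * c 2 1 * (e ^ 4 + e ^ 1) + (-162) * l ^ 1 * c 2 2 * (e ^ 3 + e ^ 0) + (-162) * l ^ 1 * c 2 3 * (e ^ 2) + (-162) * l ^ 1 * c 2 4 * (e ^ 1) + (81) * l ^ 2 * c 3 0 * (e ^ 3 + e ^ 0) + (81) * l ^ 2 * c 3 1 * (e ^ 2) + (81) * l ^ 2 * c 3 2 * (e ^ 1) + (81) * l ^ 2 * c 3 3 * (e ^ 0) + (-36) * l ^ 3 * c 4 0 * (e ^ 1) + (-36) * l ^ 3 * c 4 1 * (e ^ 0)) * he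
  have h1 : ∀ e : K, e ^ 3 = 1 → ((729) * c 0 3 + (1458) * c 0 6 + (-81) * l ^ 1 * c 1 1 + (-324) * l ^ 1 * c 1 4 + (54) * l ^ 2 * c 2 2 + (-27) * l ^ 3 * c 3 3 + (3) * l ^ 4 * c 4 1) + e * ((486) * c 0 2 + (1215) * c 0 5 + (-243) * l ^ 1 * c 1 3 + (27) * l ^ 2 * c 2 1 + (108) * l ^ 2 * c 2 4 + (-18) * l ^ 3 * c 3 2 + (-1) * l ^ 5 * c 5 1) + e ^ 2 * ((243) * c 0 1 + (972) * c 0 4 + (-162) * l ^ 1 * c 1 2 + (-405) * l ^ 1 * c 1 5 + (81) * l ^ 2 * c 2 3 + (-9) * l ^ 3 * c 3 1 + (6) * l ^ 4 * c 4 2) = 0 := by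
    intro e he
    have := (h e he).2 1
    rw [eval_pderiv_sext1] at this
    simp only [Matrix.cons_val] at this
    linear_combination e ^ 1 * this - ((243) * c 0 1 * (e ^ 8 + e ^ 5 + e ^ 2) + (486) * c 0 2 * (e ^ 7 + e ^ 4 + e ^ 1) + (729) * c 0 3 * (e ^ 6 + e ^ 3 + e ^ 0) + (972) * c 0 4 * (e ^ 5 + e ^ 2) + (1215) * c 0 5 * (e ^ 4 + e ^ 1) + (1458) * c 0 6 * (e ^ 3 + e ^ 0) + (-81) * l ^ 1 * c 1 1 * (e ^ 6 + e ^ 3 + e ^ 0) + (-162) * l ^ 1 * c 1 2 * (e ^ 5 + e ^ 2) + (-243) * l ^ 1 * c 1 3 * (e ^ 4 + e ^ 1) + (-324) * l ^ 1 * c 1 4 * (e ^ 3 + e ^ 0) + (-405) * l ^ 1 * c 1 5 * (e ^ 2) + (27) * l ^ 2 * c 2 1 * (e ^ 4 + e ^ 1) + (54) * l ^ 2 * c 2 2 * (e ^ 3 + e ^ 0) + (81) * l ^ 2 * c 2 3 * (e ^ 2) + (108) * l ^ 2 * c 2 4 * (e ^ 1) + (-9) * l ^ 3 * c 3 1 *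 (e ^ 2) + (-18) * l ^ 3 * c 3 2 * (e ^ 1) + (-27) * l ^ 3 * c 3 3 * (e ^ 0) + (3) * l ^ 4 * c 4 1 * (e ^ 0)) * he
  have h2 : ∀ e : K, e ^ 3 = 1 → ((1458) * c 0 0 + (729) * c 0 3 + (-324) * l ^ 1 * c 1 1 + (-81) * l ^ 1 * c 1 4 + (54) * l ^ 2 * c 2 2 + (-27) * l ^ 3 * c 3 0 + (3) * l ^ 4 * c 4 1) + e * ((972) * c 0 2 + (243) * c 0 5 + (-405) * l ^ 1 * c 1 0 + (-162) * l ^ 1 * c 1 3 + (81) * l ^ 2 * c 2 1 + (-9) * l ^ 3 * c 3 2 + (6) * l ^ 4 * c 4 0) + e ^ 2 * ((1215) * c 0 1 + (486) * c 0 4 + (-243) * l ^ 1 * c 1 2 + (108) * l ^ 2 * c 2 0 + (27) * l ^ 2 * c 2 3 + (-18) * l ^ 3 * c 3 1 + (-1) * l ^ 5 * c 5 0) = 0 := by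
    intro e he
    have := (h e he).2 2
    rw [eval_pderiv_sext2] at this
    simp only [Matrix.cons_val] at this
    linear_combination e ^ 2 * this - ((1458) * c 0 0 * (e ^ 9 + e ^ 6 + e ^ 3 + e ^ 0) + (1215) * c 0 1 * (e ^ 8 + e ^ 5 + e ^ 2) + (972) * c 0 2 * (e ^ 7 + e ^ 4 + e ^ 1) + (729) * c 0 3 * (e ^ 6 + e ^ 3 + e ^ 0) + (486) * c 0 4 * (e ^ 5 + e ^ 2) + (243) * c 0 5 * (e ^ 4 + e ^ 1) + (-405) * l ^ 1 * c 1 0 * (e ^ 7 + e ^ 4 + e ^ 1) + (-324) * l ^ 1 * c 1 1 * (e ^ 6 + e ^ 3 + e ^ 0) + (-243) * l ^ 1 * c 1 2 * (e ^ 5 + e ^ 2) + (-162) * l ^ 1 * c 1 3 * (e ^ 4 + e ^ 1) + (-81) * l ^ 1 * c 1 4 * (e ^ 3 + e ^ 0) + (108) * l ^ 2 * c 2 0 * (e ^ 5 + e ^ 2) + (81) * l ^ 2 * c 2 1 * (e ^ 4 + e ^ 1) + (54) * l ^ 2 * c 2 2 * (e ^ 3 + e ^ 0) + (27) * l ^ 2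 * c 2 3 * (e ^ 2) + (-27) * l ^ 3 * c 3 0 * (e ^ 3 + e ^ 0) + (-18) * l ^ 3 * c 3 1 * (e ^ 2) + (-9) * l ^ 3 * c 3 2 * (e ^ 1) + (6) * l ^ 4 * c 4 0 * (e ^ 1) + (3) * l ^ 4 * c 4 1 * (e ^ 0)) * he
  obtain ⟨a0, a1, -⟩ := sep h3 h0
  obtain ⟨b0, b1, -⟩ := sep h3 h1
  obtain ⟨c0, c1, -⟩ := sep h3 h2
  exact ⟨a0, b0, c0, a1, b1, c1⟩

theorem sext_class1 {l x0 x1 x2 y0 y1 y2 z0 z1 z2 : K} (h2 : (2 : K) ≠ 0) (h3 : (3 : K) ≠ 0) (hl : l ^ 3 + 27 ≠ 0)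
    (e00 : (243) * x1 + (243) * z2 + (-162) * l ^ 1 * z1 + (-162) * l ^ 1 * y2 + (81) * l ^ 2 * z0 + (-36) * l ^ 3 * y0 + (15) * l ^ 4 * x0 = 0)
    (e01 : (486) * y1 + (1215) * x2 + (-243) * l ^ 1 * z2 + (27) * l ^ 2 * z1 + (108) * l ^ 2 * y2 + (-18) * l ^ 3 * z0 + (-1) * l ^ 5 * x0 = 0)
    (e02 : (972) * y1 + (243) * x2 + (-405) * l ^ 1 * x1 + (-162) * l ^ 1 * z2 + (81) * l ^ 2 * z1 + (-9) * l ^ 3 * z0 + (6) * l ^ 4 * y0 = 0)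
    (e10 : (243) * x2 + (243) * z0 + (-162) * l ^ 1 * z2 + (-162) * l ^ 1 * y0 + (81) * l ^ 2 * z1 + (-36) * l ^ 3 * y1 + (15) * l ^ 4 * x1 = 0)
    (e11 : (486) * y2 + (1215) * x0 + (-243) * l ^ 1 * z0 + (27) * l ^ 2 * z2 + (108) * l ^ 2 * y0 + (-18) * l ^ 3 * z1 + (-1) * l ^ 5 * x1 = 0)
    (e12 : (972) * y2 + (243) * x0 + (-405) * l ^ 1 * x2 + (-162) * l ^ 1 * z0 + (81) * l ^ 2 * z2 + (-9) * l ^ 3 * z1 + (6) * l ^ 4 * y1 = 0)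
    (e20 : (243) * x0 + (243) * z1 + (-162) * l ^ 1 * z0 + (-162) * l ^ 1 * y1 + (81) * l ^ 2 * z2 + (-36) * l ^ 3 * y2 + (15) * l ^ 4 * x2 = 0)
    (e21 : (486) * y0 + (1215) * x1 + (-243) * l ^ 1 * z1 + (27) * l ^ 2 * z0 + (108) * l ^ 2 * y1 + (-18) * l ^ 3 * z2 + (-1) * l ^ 5 * x2 = 0)
    (e22 : (972) * y0 + (243) * x1 + (-405) * l ^ 1 * x0 + (-162) * l ^ 1 * z1 + (81) * l ^ 2 * z0 + (-9) * l ^ 3 * z2 + (6) * l ^ 4 * y2 = 0) :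
    x0 = 0 ∧ y0 = 0 ∧ z0 = 0 := by
  have key : ∀ x : K, 486 * (l ^ 3 + 27) ^ 3 * x = 0 → x = 0 := by
    intro x hx
    have : (486 : K) ≠ 0 := by
      have e : (486 : K) = 2 * 3 ^ 5 := by norm_num
      rw [e]; exact mul_ne_zero h2 (pow_ne_zero 5 h3)
    exact (mul_eq_zero.1 hx).resolve_left (mul_ne_zero this (pow_ne_zero 3 hl))
  refine ⟨key _ ?_, key _ ?_, key _ ?_⟩
  · linear_combination ((2430) * l ^ 2 + (36) * l ^ 5) * e00 + ((-2916) * l ^ 1 + (54) * l ^ 4) * e01 + ((1458) * l ^ 1 + (216) * l ^ 4) * e02 + ((5832) * l ^ 1 + (54) * l ^ 4) * e10 + ((8748) + (810) * l ^ 3) * e11 + ((-4374) + (324) * l ^ 3) * e12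
  · linear_combination ((-81) * l ^ 3 + (-3) * l ^ 6) * e00 + ((-1215) * l ^ 2 + (-45) * l ^ 5) * e01 + ((1701) * l ^ 2 + (63) * l ^ 5) * e02 + ((1944) * l ^ 2 + (18) * l ^ 5) * e10 + ((2916) * l ^ 1 + (270) * l ^ 4) * e11 + ((-1458) * l ^ 1 + (108) * l ^ 4) * e12 + ((5103) * l ^ 1 + (27) * l ^ 4) * e20 + ((-2187) + (405) * l ^ 3) * e21 + ((10935) + (891) * l ^ 3) * e22
  · linear_combination ((20412) * l ^ 1 + (54) * l ^ 4 + (-2) * l ^ 7) * e00 + ((-8748) + (810) * l ^ 3 + (-30) * l ^ 6) * e01 + ((4374) + (1782) * l ^ 3 + (-12) * l ^ 6) * e02 + ((39366) + (-162) * l ^ 3 + (-6) * l ^ 6) * e10 + ((1944) * l ^ 2 + (-90) * l ^ 5) * e11 + ((3402) * l ^ 2 + (-36) * l ^ 5) * e12 + ((1458) * l ^ 2) * e20 + ((-4374) * l ^ 1) * e21 + ((8748) * l ^ 1 + (486) * l ^ 4) * e22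
theorem sext_class0 {l p0 p1 p2 q0 q1 q2 r0 r1 r2 s : K} (h2 : (2 : K) ≠ 0) (h3 : (3 : K) ≠ 0) (hl : l ^ 3 + 27 ≠ 0)
    (e00 : (243) * r1 + (243) * r2 + (-162) * l ^ 1 * s + (81) * l ^ 2 * q1 + (81) * l ^ 2 * q0 + (-36) * l ^ 3 * r0 + (-6) * l ^ 5 * p0 = 0)
    (e01 : (729) * q2 + (1458) * p2 + (-81) * l ^ 1 * r1 + (-324) * l ^ 1 * r2 + (54) * l ^ 2 * s + (-27) * l ^ 3 * q0 + (3) * l ^ 4 * r0 = 0)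
    (e02 : (1458) * p1 + (729) * q2 + (-324) * l ^ 1 * r1 + (-81) * l ^ 1 * r2 + (54) * l ^ 2 * s + (-27) * l ^ 3 * q1 + (3) * l ^ 4 * r0 = 0)
    (e10 : (243) * r2 + (243) * r0 + (-162) * l ^ 1 * s + (81) * l ^ 2 * q2 + (81) * l ^ 2 * q1 + (-36) * l ^ 3 * r1 + (-6) * l ^ 5 * p1 = 0)
    (e11 : (729) * q0 + (1458) * p0 + (-81) * l ^ 1 * r2 + (-324) * l ^ 1 * r0 + (54) * l ^ 2 * s + (-27) * l ^ 3 * q1 + (3) * l ^ 4 * r1 = 0)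
    (e12 : (1458) * p2 + (729) * q0 + (-324) * l ^ 1 * r2 + (-81) * l ^ 1 * r0 + (54) * l ^ 2 * s + (-27) * l ^ 3 * q2 + (3) * l ^ 4 * r1 = 0)
    (e20 : (243) * r0 + (243) * r1 + (-162) * l ^ 1 * s + (81) * l ^ 2 * q0 + (81) * l ^ 2 * q2 + (-36) * l ^ 3 * r2 + (-6) * l ^ 5 * p2 = 0)
    (e21 : (729) * q1 + (1458) * p1 + (-81) * l ^ 1 * r0 + (-324) * l ^ 1 * r1 + (54) * l ^ 2 * s + (-27) * l ^ 3 * q2 + (3) * l ^ 4 * r2 = 0)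
    (e22 : (1458) * p0 + (729) * q1 + (-324) * l ^ 1 * r0 + (-81) * l ^ 1 * r1 + (54) * l ^ 2 * s + (-27) * l ^ 3 * q0 + (3) * l ^ 4 * r2 = 0) :
    p0 - p1 = 0 ∧ q0 - q1 = 0 ∧ r0 - r1 = 0 := by
  have key : ∀ x : K, 486 * (l ^ 3 + 27) ^ 3 * x = 0 → x = 0 := by
    intro x hx
    have : (486 : K) ≠ 0 := by
      have e : (486 : K) = 2 * 3 ^ 5 := by norm_num
      rw [e]; exact mul_ne_zero h2 (pow_ne_zero 5 h3)
    exact (mul_eq_zero.1 hx).resolve_left (mul_ne_zero this (pow_ne_zero 3 hl))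
  refine ⟨key _ ?_, key _ ?_, key _ ?_⟩
  · linear_combination ((-6561) * l ^ 1 + (-81) * l ^ 4) * (e00 - e10) + ((2187) + (-405) * l ^ 3) * (e01 - e11) + ((-2187) + (-567) * l ^ 3) * (e02 - e12) + ((4374) + (162) * l ^ 3) * (e11 - e21) + ((-4374) + (-162) * l ^ 3) * (e12 - e22)
  · linear_combination ((-4374) + (-486) * l ^ 3 + (-12) * l ^ 6) * (e01 - e11) + ((4374) + (486) * l ^ 3 + (12) * l ^ 6) * (e02 - e12) + ((4374) * l ^ 1) * (e10 - e20) + ((4374) + (486) * l ^ 3 + (-6) * l ^ 6) * (e11 - e21) + ((8748) + (972) * l ^ 3 + (6) * l ^ 6) * (e12 - e22)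
  · linear_combination ((-39366)) * (e00 - e10) + ((-2916) * l ^ 2 + (54) * l ^ 5) * (e01 - e11) + ((-1458) * l ^ 2 + (108) * l ^ 5) * (e02 - e12) + ((-1458) * l ^ 2 + (-54) * l ^ 5) * (e11 - e21) + ((1458) * l ^ 2 + (54) * l ^ 5) * (e12 - e22)


def rots (c : ℕ → ℕ → K) : ℕ → ℕ → K := fun a b => c b (6 - a - b)

def swps (c : ℕ → ℕ → K) : ℕ → ℕ → K := fun a b => c a (6 - a - b)

def swp : Matrix (Fin 3) (Fin 3) K := Matrix.of ![![1, 0, 0], ![0, 0, 1], ![0, 1, 0]]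

theorem swp_mulVec (p : Fin 3 → K) : swp.mulVec p = ![p 0, p 2, p 1] := by
  rw [swp, mulVec_mat]; simp

theorem swp_swp : (swp * swp : Matrix (Fin 3) (Fin 3) K) = 1 := by
  ext i j; fin_cases i <;> fin_cases j <;> simp [swp, Matrix.mul_apply, Fin.sum_univ_three]

theorem swp_transpose : (swp : Matrix (Fin 3) (Fin 3) K).transpose = swp := by
  ext i j; fin_cases i <;> fin_cases j <;> simp [swp]

theorem hesse_swp [Infinite K] (l : K) : transformPoly swp (hesse l) = hesse l := by
  apply funext_poly; intro p
  rw [eval_transformPoly, swp_mulVec, eval_hesse, eval_hesse]; simp; ring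

theorem infl_swp [Infinite K] {l : K} {w : Fin 3 → K} (hw : IsInflLine (hesse l) w) :
    IsInflLine (hesse l) (swp.mulVec w) := by
  have := infl_transform swp_swp swp_swp hw
  rwa [hesse_swp, swp_transpose] at this

theorem transform_rots [Infinite K] (c : ℕ → ℕ → K) : transformPoly cyc (sext c) = sext (rots c) := by
  apply funext_poly; intro p
  rw [eval_transformPoly, cyc_mulVec, eval_sext, eval_sext]
  simp only [rots, Matrix.cons_val, Nat.reduceSub]
  ring

theorem transform_swps [Infinite K] (c : ℕ → ℕ → K) : transformPoly swp (sext c) = sext (swps c) := by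
  apply funext_poly; intro p
  rw [eval_transformPoly, swp_mulVec, eval_sext, eval_sext]
  simp only [swps, Matrix.cons_val, Nat.reduceSub]
  ring

/-- singular at all nine points -/
def SingAll (l : K) (A : MvPolynomial (Fin 3) K) : Prop := ∀ w, IsInflLine (hesse l) w → SingAt A w

theorem singAll_rots [Infinite K] {l : K} {c : ℕ → ℕ → K} (h : SingAll l (sext c)) :
    SingAll l (sext (rots c)) := by
  intro w hw
  rw [← transform_rots]
  exact sing_transform (h := cyci) (h _ (infl_cyc hw))

theorem singAll_swps [Infinite K] {l : K} {c : ℕ → ℕ → K} (h : SingAll l (sext c)) :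
    SingAll l (sext (swps c)) := by
  intro w hw
  rw [← transform_swps]
  exact sing_transform (h := swp) (h _ (infl_swp hw))

theorem sext_cls [IsAlgClosed K] (h2 : (2 : K) ≠ 0) (h3 : (3 : K) ≠ 0) {l : K} (hl : l ^ 3 + 27 ≠ 0)
    {c : ℕ → ℕ → K} (h : SingAll l (sext c)) :
    (c 5 1 = 0 ∧ c 4 0 = 0 ∧ c 3 2 = 0) ∧ c 6 0 - c 0 0 = 0 ∧ c 3 3 - c 3 0 = 0 ∧ c 4 1 - c 1 1 = 0 := by
  haveI : Infinite K := IsAlgClosed.instInfinite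
  have h' := singAll_rots h
  have h'' := singAll_rots h'
  obtain ⟨a0, b0, c0, a1, b1, c1⟩ := sext_base h3 (fun e he => h _ (infl_Pe h3 hl he))
  obtain ⟨d0, f0, g0, d1, f1, g1⟩ := sext_base h3 (fun e he => h' _ (infl_Pe h3 hl he))
  obtain ⟨i0, j0, k0, i1, j1, k1⟩ := sext_base h3 (fun e he => h'' _ (infl_Pe h3 hl he))
  simp only [rots, Nat.reduceSub] at d0 f0 g0 d1 f1 g1 i0 j0 k0 i1 j1 k1
  exact ⟨sext_class1 h2 h3 hl a1 b1 c1 d1 f1 g1 i1 j1 k1, sext_class0 h2 h3 hl a0 b0 c0 d0 f0 g0 i0 j0 k0⟩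

def Gd (l : K) : MvPolynomial (Fin 3) K :=
  MvPolynomial.C 27 * (X 0 ^ 6 + X 1 ^ 6 + X 2 ^ 6)
  - MvPolynomial.C (54 + 4 * l ^ 3) * (X 0 ^ 3 * X 1 ^ 3 + X 1 ^ 3 * X 2 ^ 3 + X 0 ^ 3 * X 2 ^ 3)
  - MvPolynomial.C (18 * l ^ 2) * (X 0 * X 1 * X 2 * (X 0 ^ 3 + X 1 ^ 3 + X 2 ^ 3))
  - MvPolynomial.C (108 * l + l ^ 4) * (X 0 ^ 2 * X 1 ^ 2 * X 2 ^ 2)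

def Qd (l : K) : MvPolynomial (Fin 3) K :=
  MvPolynomial.C (9 * l) * (X 0 ^ 3 + X 1 ^ 3 + X 2 ^ 3) + MvPolynomial.C (54 - l ^ 3) * (X 0 * X 1 * X 2)

theorem eval_Gd (l : K) (p : Fin 3 → K) : eval p (Gd l) = 27 * (p 0 ^ 6 + p 1 ^ 6 + p 2 ^ 6)
  - (54 + 4 * l ^ 3) * (p 0 ^ 3 * p 1 ^ 3 + p 1 ^ 3 * p 2 ^ 3 + p 0 ^ 3 * p 2 ^ 3)
  - (18 * l ^ 2) * (p 0 * p 1 * p 2 * (p 0 ^ 3 + p 1 ^ 3 + p 2 ^ 3))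
  - (108 * l + l ^ 4) * (p 0 ^ 2 * p 1 ^ 2 * p 2 ^ 2) := by
  simp only [Gd, map_add, map_sub, map_mul, map_pow, MvPolynomial.eval_X, MvPolynomial.eval_C]

theorem eval_Qd (l : K) (p : Fin 3 → K) : eval p (Qd l) =
    (9 * l) * (p 0 ^ 3 + p 1 ^ 3 + p 2 ^ 3) + (54 - l ^ 3) * (p 0 * p 1 * p 2) := by
  simp only [Qd, map_add, map_sub, map_mul, map_pow, MvPolynomial.eval_X, MvPolynomial.eval_C]

theorem sext_solve (h2 : (2 : K) ≠ 0) (h3 : (3 : K) ≠ 0) {l : K} (hl : l ^ 3 + 27 ≠ 0) {p q r s : K}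
    (E0 : -6 * l ^ 5 * p + 162 * l ^ 2 * q + 6 * (81 - 6 * l ^ 3) * r - 162 * l * s = 0)
    (E1 : 3 * (486 * p + 9 * (27 - l ^ 3) * q - l * (135 - l ^ 3) * r + 18 * l ^ 2 * s) = 0) :
    ∃ α β : K, p = 27 * α + 81 * l ^ 2 * β ∧ q = -(54 + 4 * l ^ 3) * α + 162 * l ^ 2 * β ∧
      r = -18 * l ^ 2 * α + 18 * l * (54 - l ^ 3) * β ∧
      s = -(108 * l + l ^ 4) * α + (54 - l ^ 3) ^ 2 * β := by
  have f0 : -2 * (l ^ 3 - 27) * p + 27 * q - 9 * l * r = 0 := by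
    refine (mul_eq_zero.1 (?_ : 3 * (l ^ 3 + 27) * _ = 0)).resolve_left (mul_ne_zero h3 hl)
    linear_combination l * E0 + 3 * E1
  have h4 : (4 : K) ≠ 0 := by
    have e : (4 : K) = 2 * 2 := by norm_num
    rw [e]; exact mul_ne_zero h2 h2
  have hN : (2916 * 81 : K) ≠ 0 := by
    have e : (2916 * 81 : K) = 2 ^ 2 * 3 ^ 10 := by norm_num
    rw [e]; exact mul_ne_zero (pow_ne_zero _ h2) (pow_ne_zero _ h3)
  obtain ⟨α, hα⟩ : ∃ α : K, 4 * (l ^ 3 + 27) * α = 2 * p - q :=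
    ⟨(2 * p - q) / (4 * (l ^ 3 + 27)), by field_simp⟩
  obtain ⟨p', hp⟩ : ∃ p', p' = p - 27 * α := ⟨_, rfl⟩
  obtain ⟨r', hr⟩ : ∃ r', r' = r + 18 * l ^ 2 * α := ⟨_, rfl⟩
  obtain ⟨s', hs⟩ : ∃ s', s' = s + (108 * l + l ^ 4) * α := ⟨_, rfl⟩
  obtain ⟨β, hβ⟩ : ∃ β : K, (2916 * 81) * β = 81 * s' + l * (108 - l ^ 3) * p' :=
    ⟨(81 * s' + l * (108 - l ^ 3) * p') / (2916 * 81), mul_div_cancel₀ _ hN⟩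
  have f1 : 2 * (54 - l ^ 3) * p' = 9 * l * r' := by
    rw [hp, hr]; linear_combination f0 - 27 * hα
  have hc : ∀ (n : K), n ≠ 0 → ∀ x y : K, n * (x - y) = 0 → x = y := fun n hn x y h =>
    sub_eq_zero.1 ((mul_eq_zero.1 h).resolve_left hn)
  have hq : q + (54 + 4 * l ^ 3) * α = 2 * p' := by
    rw [hp]; linear_combination hα
  have g1 : 6 * (l ^ 2 * (54 - l ^ 3) * p' + (81 - 6 * l ^ 3) * r' - 27 * l * s') = 0 := by
    rw [hs, hr]
    have hq' : q = 2 * p' - (54 + 4 * l ^ 3) * α := by linear_combination hq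
    have hp' : p = p' + 27 * α := by linear_combination -hp
    rw [hq', hp'] at E0
    linear_combination E0
  have f2 : (54 - l ^ 3) * r' = 18 * l * s' := by
    refine hc 9 (by have e : (9 : K) = 3 * 3 := by norm_num
                    rw [e]; exact mul_ne_zero h3 h3) _ _ ?_
    linear_combination g1 - 3 * l ^ 2 * f1
  have hN2 : (2 * (2916 * 81) : K) ≠ 0 := mul_ne_zero h2 hN
  have k1 : p' = 81 * l ^ 2 * β := by
    refine hc (2 * (2916 * 81)) hN2 _ _ ?_
    linear_combination -162 * l ^ 2 * hβ + 81 * (54 - l ^ 3) * f1 + 729 * l * f2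
  refine ⟨α, β, ?_, ?_, ?_, ?_⟩
  · linear_combination k1 - hp
  · linear_combination hq + 2 * k1
  · refine hc (2916 * 81) hN _ _ ?_
    linear_combination -2916 * 81 * hr - 18 * l * (54 - l ^ 3) * hβ + 81 * (54 - l ^ 3) * f2
      - 9 * l ^ 2 * (108 - l ^ 3) * f1
  · refine hc (2 * (2916 * 81)) hN2 _ _ ?_
    linear_combination -2 * 2916 * 81 * hs - 2 * (54 - l ^ 3) ^ 2 * hβ
      - (54 - l ^ 3) * l * (108 - l ^ 3) * f1 - 9 * l ^ 2 * (108 - l ^ 3) * f2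

theorem sext_span [IsAlgClosed K] (h2 : (2 : K) ≠ 0) (h3 : (3 : K) ≠ 0) {l : K} (hl : l ^ 3 + 27 ≠ 0)
    {A : MvPolynomial (Fin 3) K} (hA : A.IsHomogeneous 6) (h : SingAll l A) :
    ∃ α β : K, A = α • Gd l + β • (Qd l) ^ 2 := by
  haveI : Infinite K := IsAlgClosed.instInfinite
  obtain ⟨c, rfl⟩ := exists_sext hA
  have h' := singAll_rots h
  have h'' := singAll_rots h'
  obtain ⟨⟨a1, a2, a3⟩, a4, a5, a6⟩ := sext_cls h2 h3 hl h
  obtain ⟨⟨b1, b2, b3⟩, b4, b5, b6⟩ := sext_cls h2 h3 hl h'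
  obtain ⟨⟨c1, c2, c3⟩, -, -, -⟩ := sext_cls h2 h3 hl h''
  obtain ⟨⟨d1, d2, d3⟩, -⟩ := sext_cls h2 h3 hl (singAll_swps h)
  obtain ⟨⟨f1, f2, f3⟩, -⟩ := sext_cls h2 h3 hl (singAll_swps h')
  obtain ⟨⟨g1, g2, g3⟩, -⟩ := sext_cls h2 h3 hl (singAll_swps h'')
  obtain ⟨E0, E1, -⟩ := sext_base h3 (fun e he => h _ (infl_Pe h3 hl he))
  simp only [rots, swps, Nat.reduceSub] at b1 b2 b3 b4 b5 b6 c1 c2 c3 d1 d2 d3 f1 f2 f3 g1 g2 g3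
  obtain ⟨α, β, k1, k2, k3, k4⟩ := sext_solve (p := c 6 0) (q := c 3 3) (r := c 4 1) (s := c 2 2) h2 h3 hl
    (by
      have w1 : c 0 0 = c 6 0 := by linear_combination -a4
      have w2 : c 0 6 = c 6 0 := by linear_combination -a4 - b4
      have w3 : c 3 0 = c 3 3 := by linear_combination -a5
      have w4 : c 0 3 = c 3 3 := by linear_combination -a5 - b5
      have w5 : c 1 1 = c 4 1 := by linear_combination -a6
      have w6 : c 1 4 = c 4 1 := by linear_combination -a6 - b6
      rw [w3, w5, w6] at E0
      linear_combination E0)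
    (by
      have w1 : c 0 0 = c 6 0 := by linear_combination -a4
      have w2 : c 0 6 = c 6 0 := by linear_combination -a4 - b4
      have w3 : c 3 0 = c 3 3 := by linear_combination -a5
      have w4 : c 0 3 = c 3 3 := by linear_combination -a5 - b5
      have w5 : c 1 1 = c 4 1 := by linear_combination -a6
      have w6 : c 1 4 = c 4 1 := by linear_combination -a6 - b6
      rw [w2, w4, w5, w6] at E1
      linear_combination E1)
  refine ⟨α, β, ?_⟩
  apply funext_poly
  intro p
  have w1 : c 0 0 = c 6 0 := by linear_combination -a4
  have w2 : c 0 6 = c 6 0 := by linear_combination -a4 - b4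
  have w3 : c 3 0 = c 3 3 := by linear_combination -a5
  have w4 : c 0 3 = c 3 3 := by linear_combination -a5 - b5
  have w5 : c 1 1 = c 4 1 := by linear_combination -a6
  have w6 : c 1 4 = c 4 1 := by linear_combination -a6 - b6
  rw [map_add, MvPolynomial.smul_eval, MvPolynomial.smul_eval, map_pow, eval_Gd, eval_Qd, eval_sext]
  rw [w1, w2, w3, w4, w5, w6, a1, a2, a3, b1, b2, b3, c1, c2, c3, d1, d2, d3, f1, f2, f3, g1, g2, g3,
    k1, k2, k3, k4]
  ring


/-! ### Forms vanishing on the dual curve -/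

def Rd (l : K) : MvPolynomial (Fin 3) K :=
  MvPolynomial.C ((19683)) * (X 0 ^ 9)
  + MvPolynomial.C ((19683) * l ^ 1 + (-1458) * l ^ 4) * (X 0 ^ 7 * X 1 ^ 1 * X 2 ^ 1)
  + MvPolynomial.C ((-19683) + (-5832) * l ^ 3 + (-108) * l ^ 6) * (X 0 ^ 6 * X 1 ^ 3)
  + MvPolynomial.C ((-19683) + (-5832) * l ^ 3 + (-108) * l ^ 6) * (X 0 ^ 6 * X 2 ^ 3)
  + MvPolynomial.C ((-26244) * l ^ 2 + (-3402) * l ^ 5 + (-9) * l ^ 8) * (X 0 ^ 5 * X 1 ^ 2 * X 2 ^ 2)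
  + MvPolynomial.C ((-39366) * l ^ 1 + (-8748) * l ^ 4 + (-108) * l ^ 7) * (X 0 ^ 4 * X 1 ^ 4 * X 2 ^ 1)
  + MvPolynomial.C ((-39366) * l ^ 1 + (-8748) * l ^ 4 + (-108) * l ^ 7) * (X 0 ^ 4 * X 1 ^ 1 * X 2 ^ 4)
  + MvPolynomial.C ((-19683) + (-5832) * l ^ 3 + (-108) * l ^ 6) * (X 0 ^ 3 * X 1 ^ 6)
  + MvPolynomial.C ((39366) + (-26244) * l ^ 3 + (-1620) * l ^ 6 + (-1) * l ^ 9) * (X 0 ^ 3 * X 1 ^ 3 * X 2 ^ 3)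
  + MvPolynomial.C ((-19683) + (-5832) * l ^ 3 + (-108) * l ^ 6) * (X 0 ^ 3 * X 2 ^ 6)
  + MvPolynomial.C ((-26244) * l ^ 2 + (-3402) * l ^ 5 + (-9) * l ^ 8) * (X 0 ^ 2 * X 1 ^ 5 * X 2 ^ 2)
  + MvPolynomial.C ((-26244) * l ^ 2 + (-3402) * l ^ 5 + (-9) * l ^ 8) * (X 0 ^ 2 * X 1 ^ 2 * X 2 ^ 5)
  + MvPolynomial.C ((19683) * l ^ 1 + (-1458) * l ^ 4) * (X 0 ^ 1 * X 1 ^ 7 * X 2 ^ 1)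
  + MvPolynomial.C ((-39366) * l ^ 1 + (-8748) * l ^ 4 + (-108) * l ^ 7) * (X 0 ^ 1 * X 1 ^ 4 * X 2 ^ 4)
  + MvPolynomial.C ((19683) * l ^ 1 + (-1458) * l ^ 4) * (X 0 ^ 1 * X 1 ^ 1 * X 2 ^ 7)
  + MvPolynomial.C ((19683)) * (X 1 ^ 9)
  + MvPolynomial.C ((-19683) + (-5832) * l ^ 3 + (-108) * l ^ 6) * (X 1 ^ 6 * X 2 ^ 3)
  + MvPolynomial.C ((-19683) + (-5832) * l ^ 3 + (-108) * l ^ 6) * (X 1 ^ 3 * X 2 ^ 6)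
  + MvPolynomial.C ((19683)) * (X 2 ^ 9)

theorem dualVan_Gd [Infinite K] (l : K) : DualVan (Gd l) (hesse l) := by
  refine ⟨Rd l, ?_⟩
  apply funext_poly
  intro p
  obtain ⟨p0, p1, p2⟩ := eval_pderiv_hesse l p
  rw [eval_aeval_ggrad, eval_Gd, map_mul, eval_hesse]
  simp only [gradVec, p0, p1, p2, Rd, map_add, map_mul, map_pow, MvPolynomial.eval_X, MvPolynomial.eval_C]
  ring

theorem taylor {S : Type*} [CommRing S] [Algebra K S] (P : Fin 3 → K) (ε : S) (z : Fin 3 → S)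
    (A : MvPolynomial (Fin 3) K) :
    ∃ R : S, MvPolynomial.aeval (fun i => algebraMap K S (P i) + ε * z i) A =
      algebraMap K S (eval P A) + ε * ∑ i, algebraMap K S (eval P (pderiv i A)) * z i + ε ^ 2 * R := by
  induction A using MvPolynomial.induction_on with
  | C a => exact ⟨0, by simp⟩
  | add a b ha hb =>
    obtain ⟨r, hr⟩ := ha
    obtain ⟨s, hs⟩ := hb
    refine ⟨r + s, ?_⟩
    simp only [map_add, hr, hs, Fin.sum_univ_three]
    ring
  | mul_X a j ha =>
    obtain ⟨r, hr⟩ := ha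
    refine ⟨(∑ i, algebraMap K S (eval P (pderiv i a)) * z i) * z j + r * (algebraMap K S (P j) + ε * z j), ?_⟩
    rw [map_mul, hr, MvPolynomial.aeval_X]
    have : ∀ i, eval P (pderiv i (a * X j)) = eval P (pderiv i a) * P j + eval P a * (if i = j then 1 else 0) := by
      intro i
      rw [Derivation.leibniz, pderiv_X]
      simp [Pi.single_apply, eq_comm]
      split_ifs <;> [ring; (rw [map_zero]; ring)]
    simp only [this, map_mul, map_add, MvPolynomial.eval_X, add_mul, Finset.sum_add_distrib]
    have e2 : ∑ x, algebraMap K S (eval P a) * algebraMap K S (if x = j then 1 else 0) * z x =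
        algebraMap K S (eval P a) * z j := by
      rw [Finset.sum_eq_single j]
      · simp
      · intro b _ hb; simp [hb]
      · simp
    have e1 : ∑ x, algebraMap K S (eval P (pderiv x a)) * algebraMap K S (P j) * z x =
        (∑ x, algebraMap K S (eval P (pderiv x a)) * z x) * algebraMap K S (P j) := by
      rw [Finset.sum_mul]; exact Finset.sum_congr rfl (fun _ _ => by ring)
    rw [e1, e2]
    ring

theorem coeffs_zero {a b c : K} {T : Polynomial K}
    (h : Polynomial.C a + Polynomial.X ^ 2 * (Polynomial.C b + Polynomial.C c * Polynomial.X) = Polynomial.X ^ 4 * T) :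
    a = 0 ∧ b = 0 ∧ c = 0 := by
  have h0 := congrArg (fun p => Polynomial.coeff p 0) h
  have h2 := congrArg (fun p => Polynomial.coeff p 2) h
  have h3 := congrArg (fun p => Polynomial.coeff p 3) h
  simp [Polynomial.coeff_X_pow_mul', Polynomial.coeff_C] at h0 h2 h3
  exact ⟨h0, h2, h3⟩

theorem euler_form {A : MvPolynomial (Fin 3) K} {d : ℕ} (hA : A.IsHomogeneous d) (p : Fin 3 → K) :
    ∑ i, eval p (pderiv i A) * p i = d * eval p A := by
  have := congrArg (MvPolynomial.eval p) (hA.sum_X_mul_pderiv)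
  simp only [map_sum, map_mul, MvPolynomial.eval_X, map_nsmul, nsmul_eq_mul, map_natCast] at this
  rw [← this]
  exact Finset.sum_congr rfl (fun _ _ => by ring)

theorem sing_P0_of_dualVan (h2 : (2 : K) ≠ 0) (h3 : (3 : K) ≠ 0) {l : K} (hl : l ^ 3 + 27 ≠ 0)
    {A : MvPolynomial (Fin 3) K} {d : ℕ} (hA : A.IsHomogeneous d) (h : DualVan A (hesse l)) :
    SingAt A (P0 l) := by
  obtain ⟨R, hR⟩ := h
  -- a parametrised arc on the cubic up to order four
  obtain ⟨e, he⟩ : ∃ e : Polynomial K, e = 3 * Polynomial.C l * Polynomial.X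
    - 36 * (Polynomial.C l ^ 3 + 27) * Polynomial.X ^ 3 := ⟨_, rfl⟩
  obtain ⟨x, hx⟩ : ∃ x : Fin 3 → Polynomial K, x = ![18 * Polynomial.X, 1 + e, -1 + e] := ⟨_, rfl⟩
  have hcomp : MvPolynomial.aeval x (MvPolynomial.aeval (ggrad (hesse l)) A) =
      MvPolynomial.aeval (fun i => MvPolynomial.aeval x (pderiv i (hesse l))) A := by
    rw [← AlgHom.comp_apply]
    congr 1
    apply MvPolynomial.algHom_ext
    intro i
    simp [ggrad]
  have hH : ∃ T, MvPolynomial.aeval x (hesse l) = Polynomial.X ^ 4 * T := by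
    refine ⟨-(36 * (Polynomial.C l ^ 3 + 27)) * Polynomial.X * (2 * ((3 * Polynomial.C l - 36 * (Polynomial.C l ^ 3 + 27) * Polynomial.X ^ 2) ^ 2 + 3 * Polynomial.C l * (3 * Polynomial.C l - 36 * (Polynomial.C l ^ 3 + 27) * Polynomial.X ^ 2) + 9 * Polynomial.C l ^ 2) + 18 * Polynomial.C l * ((3 * Polynomial.C l - 36 * (Polynomial.C l ^ 3 + 27) * Polynomial.X ^ 2) + 3 * Polynomial.C l)), ?_⟩
    simp only [hesse, map_add, map_mul, map_pow, MvPolynomial.aeval_X, MvPolynomial.aeval_C, hx, he, Matrix.cons_val,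
      Polynomial.algebraMap_eq]
    ring
  obtain ⟨T, hT⟩ := hH
  have hg : ∃ z' : Fin 3 → Polynomial K, ∀ i, MvPolynomial.aeval x (pderiv i (hesse l)) =
      algebraMap K (Polynomial K) (P0 l i) + Polynomial.X ^ 2 *
        (Polynomial.C (![972 + 9 * l ^ 3, 81 * l ^ 2, 81 * l ^ 2] i) +
         Polynomial.C (![0, -216 * (l ^ 3 + 27), 216 * (l ^ 3 + 27)] i) * Polynomial.X
         + Polynomial.X ^ 2 * z' i) := by
    obtain ⟨y, hy⟩ : ∃ y : Polynomial K, y = -6 * Polynomial.C l * (36 * (Polynomial.C l ^ 3 + 27)) + (36 * (Polynomial.C l ^ 3 + 27)) ^ 2 * Polynomial.X ^ 2 := ⟨_, rfl⟩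
    have hn : ∀ n : ℕ, [n.AtLeastTwo] → (Polynomial.C (OfNat.ofNat n : K)) = OfNat.ofNat n := fun n _ => rfl
    refine ⟨![Polynomial.C l * y, 3 * y - 18 * Polynomial.C l * (36 * (Polynomial.C l ^ 3 + 27)), 3 * y - 18 * Polynomial.C l * (36 * (Polynomial.C l ^ 3 + 27))], ?_⟩
    intro i
    fin_cases i <;>
    · simp [hesse, pderiv_X, Pi.single_apply, Derivation.leibniz, Derivation.leibniz_pow, hx, he, hy, P0, hn]
      ring
  obtain ⟨z', hz'⟩ := hg
  obtain ⟨R', hR'⟩ := taylor (S := Polynomial K) (P0 l) (Polynomial.X ^ 2) _ A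
  have main := congrArg (MvPolynomial.aeval x) hR
  rw [hcomp, map_mul, hT, funext hz', hR'] at main
  simp only [Fin.sum_univ_three, Polynomial.algebraMap_eq] at main
  have E := euler_form hA (P0 l)
  rw [Fin.sum_univ_three] at E
  obtain ⟨A0, hA0⟩ : ∃ y, y = eval (P0 l) A := ⟨_, rfl⟩
  obtain ⟨a, ha⟩ : ∃ y, y = eval (P0 l) (pderiv 0 A) := ⟨_, rfl⟩
  obtain ⟨b, hb⟩ : ∃ y, y = eval (P0 l) (pderiv 1 A) := ⟨_, rfl⟩
  obtain ⟨c, hc⟩ : ∃ y, y = eval (P0 l) (pderiv 2 A) := ⟨_, rfl⟩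
  rw [← hA0, ← ha, ← hb, ← hc] at main E
  obtain ⟨k0, k1, k2⟩ := coeffs_zero (a := A0) (b := a * (972 + 9 * l ^ 3) + b * (81 * l ^ 2) + c * (81 * l ^ 2))
    (c := b * (-216 * (l ^ 3 + 27)) + c * (216 * (l ^ 3 + 27)))
    (T := T * MvPolynomial.aeval x R - R' - (Polynomial.C a * z' 0 + Polynomial.C b * z' 1 + Polynomial.C c * z' 2)) (by
      simp only [Matrix.cons_val, Polynomial.C_add, Polynomial.C_mul, Polynomial.C_0] at main ⊢
      linear_combination main)
  have h216 : (216 : K) ≠ 0 := by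
    have e : (216 : K) = 2 ^ 3 * 3 ^ 3 := by norm_num
    rw [e]; exact mul_ne_zero (pow_ne_zero _ h2) (pow_ne_zero _ h3)
  have h36 : (36 : K) ≠ 0 := by
    have e : (36 : K) = 2 ^ 2 * 3 ^ 2 := by norm_num
    rw [e]; exact mul_ne_zero (pow_ne_zero _ h2) (pow_ne_zero _ h3)
  have h6 : (6 : K) ≠ 0 := by
    have e : (6 : K) = 2 * 3 := by norm_num
    rw [e]; exact mul_ne_zero h2 h3
  have bc : c - b = 0 := by
    refine (mul_eq_zero.1 (?_ : (216 * (l ^ 3 + 27)) * _ = 0)).resolve_left (mul_ne_zero h216 hl)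
    linear_combination k2
  rw [k0] at E
  simp [P0] at E
  have a0 : a = 0 := by
    refine (mul_eq_zero.1 (?_ : (36 * (l ^ 3 + 27)) * _ = 0)).resolve_left (mul_ne_zero h36 hl)
    linear_combination k1 - 27 * l ^ 2 * E
  have b0 : b = 0 := by
    refine (mul_eq_zero.1 (?_ : (6 : K) * _ = 0)).resolve_left h6
    rw [a0] at E
    linear_combination E - 3 * bc
  have c0 : c = 0 := by linear_combination bc + b0
  refine ⟨hA0 ▸ k0, fun i => ?_⟩
  fin_cases i
  · exact ha ▸ a0
  · exact hb ▸ b0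
  · exact hc ▸ c0

theorem sing_of_transform {g h : Matrix (Fin 3) (Fin 3) K} (hgh : g * h = 1) (hhg : h * g = 1)
    {A : MvPolynomial (Fin 3) K} {w : Fin 3 → K} (hw : SingAt (transformPoly g A) w) :
    SingAt A (g.mulVec w) := by
  have : h.mulVec (g.mulVec w) = w := by rw [Matrix.mulVec_mulVec, hhg, Matrix.one_mulVec]
  rw [← this] at hw
  have := sing_transform (h := g) hw
  rwa [transformPoly_inv_left hgh] at this

theorem cusp_of_transform {g h : Matrix (Fin 3) (Fin 3) K} (hgh : g * h = 1) (hhg : h * g = 1)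
    {A : MvPolynomial (Fin 3) K} {w : Fin 3 → K} (hw : IsCuspAt (transformPoly g A) w) :
    IsCuspAt A (g.mulVec w) := by
  have : h.mulVec (g.mulVec w) = w := by rw [Matrix.mulVec_mulVec, hhg, Matrix.one_mulVec]
  rw [← this] at hw
  have := cusp_transform hhg hgh hw
  rwa [transformPoly_inv_left hgh] at this

theorem sing_smul {c : K} {A : MvPolynomial (Fin 3) K} {w : Fin 3 → K} (hw : SingAt A w) :
    SingAt (c • A) w := by
  refine ⟨by rw [MvPolynomial.smul_eval, hw.1, mul_zero], fun i => ?_⟩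
  rw [Derivation.map_smul, MvPolynomial.smul_eval, hw.2, mul_zero]

theorem smul_one_inv {s : K} (hs : s ≠ 0) :
    (s • (1 : Matrix (Fin 3) (Fin 3) K)) * (s⁻¹ • 1) = 1 := by
  rw [Matrix.smul_mul, Matrix.mul_smul, smul_smul, mul_inv_cancel₀ hs]; simp

theorem smul_one_inv' {s : K} (hs : s ≠ 0) :
    (s⁻¹ • (1 : Matrix (Fin 3) (Fin 3) K)) * (s • 1) = 1 := by
  rw [Matrix.smul_mul, Matrix.mul_smul, smul_smul, inv_mul_cancel₀ hs]; simp

theorem sing_scale {A : MvPolynomial (Fin 3) K} {d : ℕ} (hA : A.IsHomogeneous d) {s : K} (hs : s ≠ 0)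
    {w : Fin 3 → K} (hw : SingAt A w) : SingAt A (s • w) := by
  have := sing_of_transform (g := s • 1) (h := s⁻¹ • 1) (A := A) (w := w) (smul_one_inv hs) (smul_one_inv' hs)
    (by rw [transformPoly_smul_one hA]; exact sing_smul hw)
  rwa [Matrix.smul_mulVec, Matrix.one_mulVec] at this

theorem cusp_scale {A : MvPolynomial (Fin 3) K} {d : ℕ} (hA : A.IsHomogeneous d) {s : K} (hs : s ≠ 0)
    {w : Fin 3 → K} (hw : IsCuspAt A w) : IsCuspAt A (s • w) := by
  have := cusp_of_transform (g := s • 1) (h := s⁻¹ • 1) (A := A) (w := w) (smul_one_inv hs) (smul_one_inv' hs)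
    (by rw [transformPoly_smul_one hA]; exact cusp_smul (pow_ne_zero _ hs) hw)
  rwa [Matrix.smul_mulVec, Matrix.one_mulVec] at this

theorem hesse_cyc [Infinite K] (l : K) : transformPoly cyc (hesse l) = hesse l := by
  conv_lhs => rw [← hesse_cyci l]
  exact transformPoly_inv_left (K := K) cyci_cyc _

theorem singAll_of_dualVan [Infinite K] (h2 : (2 : K) ≠ 0) (h3 : (3 : K) ≠ 0) {l : K} (hl : l ^ 3 + 27 ≠ 0)
    {A : MvPolynomial (Fin 3) K} {d : ℕ} (hA : A.IsHomogeneous d) (h : DualVan A (hesse l)) :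
    SingAll l A := by
  intro w hw
  refine infl_induction h3 hl (fun w => ∀ A : MvPolynomial (Fin 3) K, A.IsHomogeneous d → DualVan A (hesse l) →
    SingAt A w) ?_ ?_ ?_ ?_ w hw A hA h
  · intro s w hs ih A hA hd
    exact sing_scale hA hs (ih A hA hd)
  · intro w ih A hA hd
    refine sing_of_transform cyc_cyci cyci_cyc (ih _ (transformPoly_isHomogeneous _ hA) ?_)
    have := dualVan_transform (g := cyc) (h := cyci) cyc_cyci hd
    rwa [hesse_cyc, cyci_transpose] at this
  · intro e w he ih A hA hd
    refine sing_of_transform (dia_mul he) (dia_mul2 he) (ih _ (transformPoly_isHomogeneous _ hA) ?_)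
    have := dualVan_transform (g := dia (e ^ 2)) (h := dia e) (dia_mul2 he) hd
    rwa [hesse_dia l (by rw [← pow_mul, mul_comm, pow_mul, he, one_pow]), dia_transpose] at this
  · intro A hA hd
    exact sing_P0_of_dualVan h2 h3 hl hA hd

theorem low_degree_zero [IsAlgClosed K] (h2 : (2 : K) ≠ 0) (h3 : (3 : K) ≠ 0) {l : K} (hl : l ^ 3 + 27 ≠ 0)
    {A : MvPolynomial (Fin 3) K} {d : ℕ} (hA : A.IsHomogeneous d) (hd : d ≤ 5) (h : SingAll l A) : A = 0 := by
  have hx : ∀ i : Fin 3, (X i ^ (6 - d) * A : MvPolynomial (Fin 3) K).IsHomogeneous 6 := by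
    intro i
    have := ((isHomogeneous_X K i).pow (6 - d)).mul hA
    have e : 1 * (6 - d) + d = 6 := by omega
    rwa [e] at this
  have hs : ∀ i : Fin 3, SingAll l (X i ^ (6 - d) * A) := by
    intro i w hw
    refine ⟨by rw [map_mul, (h w hw).1, mul_zero], fun j => ?_⟩
    rw [Derivation.leibniz, smul_eq_mul, smul_eq_mul, map_add, map_mul, map_mul, (h w hw).1, (h w hw).2 j]
    ring
  choose α β hab using fun i => sext_span h2 h3 hl (hx i) (hs i)
  obtain ⟨s, hs0, hs1⟩ := Matrix.exists_mulVec_eq_zero_iff.2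
    (show (Matrix.of ![α, β, 0]).det = 0 by simp [Matrix.det_fin_three])
  have m0 := congrFun hs1 0
  have m1 := congrFun hs1 1
  simp [Matrix.mulVec, dotProduct, Fin.sum_univ_three] at m0 m1
  have hz : (∑ i, MvPolynomial.C (s i) * X i ^ (6 - d)) * A = 0 := by
    have : (∑ i, MvPolynomial.C (s i) * X i ^ (6 - d)) * A = ∑ i, MvPolynomial.C (s i) * (X i ^ (6 - d) * A) := by
      rw [Finset.sum_mul]; exact Finset.sum_congr rfl (fun _ _ => by ring)
    rw [this]
    simp only [hab, Fin.sum_univ_three, MvPolynomial.smul_eq_C_mul]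
    have m0' := congrArg (MvPolynomial.C (σ := Fin 3)) m0
    have m1' := congrArg (MvPolynomial.C (σ := Fin 3)) m1
    simp only [map_add, map_mul, map_zero] at m0' m1'
    linear_combination (Gd l) * m0' + Qd l ^ 2 * m1'
  rcases mul_eq_zero.1 hz with hz | hz
  · exfalso
    apply hs0
    ext i
    have := congrArg (MvPolynomial.eval (Pi.single i (1 : K))) hz
    have hn : 6 - d ≠ 0 := by omega
    simp only [map_sum, map_mul, map_pow, MvPolynomial.eval_C, MvPolynomial.eval_X, map_zero] at this
    rw [Finset.sum_eq_single i] at this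
    · simpa using this
    · intro b _ hb
      simp [Pi.single_apply, hb, hn]
    · simp
  · exact hz

theorem Gd_isHomogeneous (l : K) : (Gd l).IsHomogeneous 6 := by
  have hx : ∀ i : Fin 3, (X i : MvPolynomial (Fin 3) K).IsHomogeneous 1 := isHomogeneous_X K
  have hc : ∀ c : K, (MvPolynomial.C c : MvPolynomial (Fin 3) K).IsHomogeneous 0 := isHomogeneous_C _
  refine (((?_ : MvPolynomial.IsHomogeneous _ _).sub ?_).sub ?_).sub ?_
  · exact (hc _).mul (((hx 0).pow 6).add ((hx 1).pow 6) |>.add ((hx 2).pow 6))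
  · exact (hc _).mul ((((hx 0).pow 3).mul ((hx 1).pow 3)).add (((hx 1).pow 3).mul ((hx 2).pow 3)) |>.add
      (((hx 0).pow 3).mul ((hx 2).pow 3)))
  · exact (hc _).mul ((((hx 0).mul (hx 1)).mul (hx 2)).mul (((hx 0).pow 3).add ((hx 1).pow 3) |>.add ((hx 2).pow 3)))
  · exact (hc _).mul ((((hx 0).pow 2).mul ((hx 1).pow 2)).mul ((hx 2).pow 2))

theorem Gd_ne_zero (h3 : (3 : K) ≠ 0) (l : K) : Gd l ≠ 0 := by
  intro h
  have := congrArg (MvPolynomial.eval ![1, 0, 0]) h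
  rw [eval_Gd] at this
  simp at this
  have e : (27 : K) = 3 ^ 3 := by norm_num
  rw [e] at this
  exact pow_ne_zero 3 h3 this

theorem Gd_irreducible [IsAlgClosed K] (h2 : (2 : K) ≠ 0) (h3 : (3 : K) ≠ 0) {l : K} (hl : l ^ 3 + 27 ≠ 0) :
    Irreducible (Gd l) := by
  haveI : Infinite K := IsAlgClosed.instInfinite
  have hG := Gd_isHomogeneous l
  have hG0 := Gd_ne_zero h3 l
  refine ⟨fun hu => ?_, fun {a b} hab => ?_⟩
  · have h1 := hu.map (MvPolynomial.eval (0 : Fin 3 → K))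
    rw [eval_zero_of_isHomogeneous hG (by norm_num)] at h1
    exact not_isUnit_zero h1
  · rw [hab] at hG hG0
    obtain ⟨m, n, hm, hn, hmn⟩ := isHomogeneous_of_mul hG hG0
    have hp : Prime (hesse l) := (smooth_irreducible (by norm_num) (hesse_smooth h3 hl)).prime
    have hd := dualVan_Gd l
    rw [DualVan, hab, map_mul] at hd
    rcases hp.dvd_or_dvd hd with hd | hd
    · right
      have hs := singAll_of_dualVan h2 h3 hl hm hd
      have : n = 0 := by
        by_contra hn0
        exact left_ne_zero_of_mul hG0 (low_degree_zero h2 h3 hl hm (by omega) hs)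
      subst this
      exact isUnit_of_isHomogeneous_zero hn (right_ne_zero_of_mul hG0)
    · left
      have hs := singAll_of_dualVan h2 h3 hl hn hd
      have : m = 0 := by
        by_contra hn0
        exact right_ne_zero_of_mul hG0 (low_degree_zero h2 h3 hl hn (by omega) hs)
      subst this
      exact isUnit_of_isHomogeneous_zero hm (left_ne_zero_of_mul hG0)


/-! ### Cusps and uniqueness in characteristic different from two -/

theorem lineRestrict_derivative (A : MvPolynomial (Fin 3) K) (a b : Fin 3 → K) :
    Polynomial.derivative (lineRestrict A a b) = lineRestrict (dirD b A) a b := by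
  induction A using MvPolynomial.induction_on with
  | C c => simp [lineRestrict, dirD]
  | add p q hp hq =>
    simp only [lineRestrict, dirD, map_add, Fin.sum_univ_three, map_mul, mul_add] at *
    rw [hp, hq]; ring
  | mul_X p j hp =>
    have e : dirD b (p * X j) = dirD b p * X j + MvPolynomial.C (b j) * p := by
      simp only [dirD, Derivation.leibniz, pderiv_X, Fin.sum_univ_three, smul_eq_mul]
      fin_cases j <;> simp <;> ring
    rw [e]
    simp only [lineRestrict, map_add, map_mul, MvPolynomial.aeval_X, MvPolynomial.aeval_C, Polynomial.derivative_mul] at *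
    rw [hp]
    simp
    ring

theorem coeff_zero_lineRestrict (A : MvPolynomial (Fin 3) K) (a b : Fin 3 → K) :
    (lineRestrict A a b).coeff 0 = eval a A := by
  induction A using MvPolynomial.induction_on with
  | C c => simp [lineRestrict]
  | add p q hp hq => simp only [lineRestrict, map_add, Polynomial.coeff_add] at *; rw [hp, hq]
  | mul_X p j hp =>
    simp only [lineRestrict, map_mul, MvPolynomial.aeval_X, Polynomial.mul_coeff_zero, MvPolynomial.eval_X] at *
    rw [hp]; simp

theorem cubicForm_eq_coeff (A : MvPolynomial (Fin 3) K) (a b : Fin 3 → K) :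
    cubicForm A a b = 6 * (lineRestrict A a b).coeff 3 := by
  rw [cubicForm_eq_dirD, ← coeff_zero_lineRestrict _ a b, ← lineRestrict_derivative, ← lineRestrict_derivative,
    ← lineRestrict_derivative, Polynomial.coeff_derivative, Polynomial.coeff_derivative, Polynomial.coeff_derivative]
  push_cast
  ring

theorem pderiv_num (i : Fin 3) (n : ℕ) [n.AtLeastTwo] :
    pderiv i (no_index (OfNat.ofNat n : MvPolynomial (Fin 3) K)) = 0 := by
  rw [← map_ofNat (MvPolynomial.C : K →+* MvPolynomial (Fin 3) K)]; exact pderiv_C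

set_option maxHeartbeats 2000000 in
theorem hess_Gd (l : K) : hessMat (Gd l) (P0 l) = (54 * (l ^ 3 + 27) ^ 2) •
    Matrix.vecMulVec ![(0 : K), 1, -1] ![0, 1, -1] := by
  ext i j
  fin_cases i <;> fin_cases j <;>
  · simp [hessMat, Gd, P0, pderiv_X, Pi.single_apply, Derivation.leibniz, Derivation.leibniz_pow, Matrix.vecMulVec_apply, pderiv_num]
    try ring

theorem rank_one_of {κ : K} (hκ : κ ≠ 0) :
    (κ • Matrix.vecMulVec ![(0 : K), 1, -1] ![0, 1, -1]).rank = 1 := by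
  apply le_antisymm
  · rw [← Matrix.smul_vecMulVec]
    exact Matrix.rank_vecMulVec_le _ _
  · rw [Nat.one_le_iff_ne_zero]
    intro h
    rw [Matrix.rank, Submodule.finrank_eq_zero, LinearMap.range_eq_bot] at h
    have := congrFun (LinearMap.congr_fun h (Pi.single 1 1)) 1
    simp [Matrix.vecMulVec_apply, hκ] at this

theorem cusp_P0 [Infinite K] (h2 : (2 : K) ≠ 0) (h3 : (3 : K) ≠ 0) {l : K} (hl : l ^ 3 + 27 ≠ 0) :
    IsCuspAt (Gd l) (P0 l) := by
  have h6 : (6 : K) ≠ 0 := by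
    have e : (6 : K) = 2 * 3 := by norm_num
    rw [e]; exact mul_ne_zero h2 h3
  have h54 : (54 : K) ≠ 0 := by
    have e : (54 : K) = 2 * 3 ^ 3 := by norm_num
    rw [e]; exact mul_ne_zero h2 (pow_ne_zero _ h3)
  have hκ : 54 * (l ^ 3 + 27) ^ 2 ≠ 0 := mul_ne_zero h54 (pow_ne_zero _ hl)
  refine ⟨sing_P0_of_dualVan h2 h3 hl (Gd_isHomogeneous l) (dualVan_Gd l), ?_, ?_⟩
  · rw [hess_Gd]; exact rank_one_of hκ
  · intro v hv hli
    rw [hess_Gd] at hv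
    have e1 := congrFun hv 1
    simp [Matrix.mulVec, dotProduct, Fin.sum_univ_three, Matrix.vecMulVec_apply] at e1
    have e2 : v 2 = v 1 := by
      have : (54 * (l ^ 3 + 27) ^ 2) * (v 2 - v 1) = 0 := by linear_combination -e1
      exact sub_eq_zero.1 ((mul_eq_zero.1 this).resolve_left hκ)
    rw [cubicForm_eq_coeff]
    have e3 : lineRestrict (Gd l) (P0 l) v = Polynomial.X ^ 3 * (Polynomial.C ((3 * v 0 + l * v 1) ^ 3) *
        ((Polynomial.C (-l) + Polynomial.C (v 0) * Polynomial.X) ^ 3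
        - Polynomial.C l * (Polynomial.C (-l) + Polynomial.C (v 0) * Polynomial.X) ^ 2 * (3 + Polynomial.C (v 1) * Polynomial.X)
        - 4 * (3 + Polynomial.C (v 1) * Polynomial.X) ^ 3)) := by
      have hn : ∀ n : ℕ, [n.AtLeastTwo] → (Polynomial.C (OfNat.ofNat n : K)) = OfNat.ofNat n := fun n _ => rfl
      simp only [lineRestrict, Gd, P0, map_add, map_sub, map_mul, map_pow, MvPolynomial.aeval_X, MvPolynomial.aeval_C,
        Polynomial.algebraMap_eq, Matrix.cons_val, e2, hn, map_neg]
      ring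
    rw [e3, Polynomial.coeff_X_pow_mul']
    simp [Polynomial.coeff_zero_eq_eval_zero]
    refine ⟨h6, ?_, ?_⟩
    · intro h
      rw [LinearIndependent.pair_iff] at hli
      have := hli (v 1) (-3) (by
        ext j; fin_cases j <;> simp [P0, e2]
        · linear_combination -h
        · ring
        · ring)
      exact h3 (neg_eq_zero.1 this.2)
    · intro h
      have h4 : (-4 : K) ≠ 0 := by
        have e : (-4 : K) = -(2 * 2) := by norm_num
        rw [e]; exact neg_ne_zero.2 (mul_ne_zero h2 h2)
      apply mul_ne_zero h4 hl
      linear_combination h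

theorem Gd_cyc [Infinite K] (l : K) : transformPoly cyc (Gd l) = Gd l := by
  apply funext_poly; intro p
  rw [eval_transformPoly, cyc_mulVec, eval_Gd, eval_Gd]; simp only [Matrix.cons_val]; ring

theorem Gd_dia [Infinite K] (l : K) {e : K} (he : e ^ 3 = 1) :
    transformPoly (dia e) (Gd l) = Gd l := by
  apply funext_poly; intro p
  have h6 : e ^ 6 = 1 := by linear_combination (e ^ 3 + 1) * he
  rw [eval_transformPoly, dia_mulVec, eval_Gd, eval_Gd]; simp only [Matrix.cons_val, mul_pow]
  have a2 : (e ^ 2) ^ 6 = 1 := by rw [← pow_mul, mul_comm, pow_mul, h6]; ring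
  have a3 : (e ^ 2) ^ 3 = 1 := by rw [← pow_mul]; exact h6
  have a4 : e * e ^ 2 = 1 := by linear_combination he
  have a5 : e ^ 2 * (e ^ 2) ^ 2 = 1 := by linear_combination h6
  rw [he, h6, a2, a3]
  linear_combination (-18 * l ^ 2 * (p 0 * p 1 * p 2 * (p 0 ^ 3 + p 1 ^ 3 + p 2 ^ 3))) * a4
    - ((108 * l + l ^ 4) * (p 0 ^ 2 * p 1 ^ 2 * p 2 ^ 2)) * a5

theorem cusp_all [Infinite K] (h2 : (2 : K) ≠ 0) (h3 : (3 : K) ≠ 0) {l : K} (hl : l ^ 3 + 27 ≠ 0) :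
    ∀ w, IsInflLine (hesse l) w → IsCuspAt (Gd l) w := by
  refine infl_induction h3 hl _ ?_ ?_ ?_ (cusp_P0 h2 h3 hl)
  · intro s w hs h
    exact cusp_scale (Gd_isHomogeneous l) hs h
  · intro w h
    exact cusp_of_transform cyc_cyci cyci_cyc (by rwa [Gd_cyc])
  · intro e w he h
    exact cusp_of_transform (dia_mul he) (dia_mul2 he) (by rwa [Gd_dia l he])

theorem minor_of_rank_one {M : Matrix (Fin 3) (Fin 3) K} (h : M.rank = 1) :
    M 0 0 * M 1 1 - M 0 1 * M 1 0 = 0 := by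
  rw [Matrix.rank] at h
  obtain ⟨⟨v, hv⟩, hv0, hv1⟩ := finrank_eq_one_iff'.1 h
  obtain ⟨a, ha⟩ := hv1 ⟨_, LinearMap.mem_range_self M.mulVecLin (Pi.single 0 1)⟩
  obtain ⟨b, hb⟩ := hv1 ⟨_, LinearMap.mem_range_self M.mulVecLin (Pi.single 1 1)⟩
  have ha' := congrArg Subtype.val ha
  have hb' := congrArg Subtype.val hb
  have a0 := congrFun ha' 0
  have a1 := congrFun ha' 1
  have b0 := congrFun hb' 0
  have b1 := congrFun hb' 1
  simp at a0 a1 b0 b1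
  rw [← a0, ← a1, ← b0, ← b1]
  ring

theorem Qd_pderiv (l : K) (p : Fin 3 → K) : eval p (pderiv 0 (Qd l)) = 27 * l * p 0 ^ 2 + (54 - l ^ 3) * (p 1 * p 2) := by
  simp [Qd, pderiv_X, Pi.single_apply, Derivation.leibniz, Derivation.leibniz_pow]
  ring

theorem hess_sq (A : MvPolynomial (Fin 3) K) (p : Fin 3 → K) (h : eval p A = 0) (i j : Fin 3) :
    eval p (pderiv i (pderiv j (A ^ 2))) = 2 * eval p (pderiv i A) * eval p (pderiv j A) := by
  rw [pow_two]
  simp only [Derivation.leibniz, smul_eq_mul, map_add, map_mul, h]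
  ring

theorem Qd_P0 (l : K) : eval (P0 l) (Qd l) = 0 := by
  rw [eval_Qd]; simp [P0]; ring

theorem uniq_ne2 [IsAlgClosed K] (h2 : (2 : K) ≠ 0) (h3 : (3 : K) ≠ 0) {l : K} (hl : l ^ 3 + 27 ≠ 0)
    {A : MvPolynomial (Fin 3) K} (hA : A.IsHomogeneous 6)
    (h : ∀ w, IsInflLine (hesse l) w → IsCuspAt A w) (hi : Irreducible A) : ∃ c : K, A = c • Gd l := by
  obtain ⟨α, β, hab⟩ := sext_span h2 h3 hl hA (fun w hw => (h w hw).1)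
  have hm := minor_of_rank_one (h _ (infl_P0 h3 hl)).2.1
  have hH : ∀ i j, hessMat A (P0 l) i j = α * hessMat (Gd l) (P0 l) i j +
      β * (2 * eval (P0 l) (pderiv i (Qd l)) * eval (P0 l) (pderiv j (Qd l))) := by
    intro i j
    rw [← hess_sq _ _ (Qd_P0 l), hab]
    simp only [hessMat, Matrix.of_apply, map_add, Derivation.map_smul, MvPolynomial.smul_eval]
  have q0 : eval (P0 l) (pderiv 0 (Qd l)) = 18 * (l ^ 3 + 27) := by
    rw [Qd_pderiv]; simp [P0]; ring
  rw [hH, hH, hH, hH, hess_Gd, q0] at hm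
  simp [Matrix.vecMulVec_apply] at hm
  have key : (34992 * (l ^ 3 + 27) ^ 4) * (α * β) = 0 := by linear_combination hm
  have hn : (34992 : K) ≠ 0 := by
    have e : (34992 : K) = 2 ^ 4 * 3 ^ 7 := by norm_num
    rw [e]; exact mul_ne_zero (pow_ne_zero _ h2) (pow_ne_zero _ h3)
  rcases mul_eq_zero.1 ((mul_eq_zero.1 key).resolve_left (mul_ne_zero hn (pow_ne_zero _ hl))) with h0 | h0
  · exfalso
    have hQ : ¬ IsUnit (Qd l) := by
      intro hu
      have h1 := hu.map (MvPolynomial.eval (0 : Fin 3 → K))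
      rw [eval_Qd] at h1
      simp at h1
    have e : A = (MvPolynomial.C β * Qd l) * Qd l := by
      rw [hab, h0, MvPolynomial.smul_eq_C_mul, MvPolynomial.smul_eq_C_mul]; simp; ring
    rcases hi.isUnit_or_isUnit e with hu | hu
    · exact hQ (isUnit_of_mul_isUnit_right hu)
    · exact hQ hu
  · exact ⟨α, by rw [hab, h0, zero_smul, add_zero]⟩

theorem Qd_isHomogeneous (l : K) : (Qd l).IsHomogeneous 3 := by
  have hx : ∀ i : Fin 3, (X i : MvPolynomial (Fin 3) K).IsHomogeneous 1 := isHomogeneous_X K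
  have hc : ∀ c : K, (MvPolynomial.C c : MvPolynomial (Fin 3) K).IsHomogeneous 0 := isHomogeneous_C _
  exact ((hc _).mul (((hx 0).pow 3).add ((hx 1).pow 3) |>.add ((hx 2).pow 3))).add
    ((hc _).mul (((hx 0).mul (hx 1)).mul (hx 2)))

/-- forms of degree six vanishing on the dual curve -/
theorem dual_ne2 [IsAlgClosed K] (h2 : (2 : K) ≠ 0) (h3 : (3 : K) ≠ 0) {l : K} (hl : l ^ 3 + 27 ≠ 0)
    {A : MvPolynomial (Fin 3) K} (hA : A.IsHomogeneous 6) (h : DualVan A (hesse l)) : ∃ c : K, A = c • Gd l := by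
  haveI : Infinite K := IsAlgClosed.instInfinite
  obtain ⟨α, β, hab⟩ := sext_span h2 h3 hl hA (singAll_of_dualVan h2 h3 hl hA h)
  by_cases hb : β = 0
  · exact ⟨α, by rw [hab, hb, zero_smul, add_zero]⟩
  exfalso
  have hp : Prime (hesse l) := (smooth_irreducible (by norm_num) (hesse_smooth h3 hl)).prime
  have h1 : hesse l ∣ MvPolynomial.C β * MvPolynomial.aeval (ggrad (hesse l)) (Qd l) ^ 2 := by
    have := dvd_sub h ((dualVan_Gd l).mul_left (MvPolynomial.C α))
    convert this using 1
    rw [hab, map_add, map_smul, map_smul, map_pow, MvPolynomial.smul_eq_C_mul, MvPolynomial.smul_eq_C_mul]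
    ring
  have h4 : DualVan (Qd l) (hesse l) := by
    rw [((isUnit_iff_ne_zero.2 hb).map MvPolynomial.C).dvd_mul_left] at h1
    exact hp.dvd_of_dvd_pow h1
  have := low_degree_zero h2 h3 hl (Qd_isHomogeneous l) (by norm_num)
    (singAll_of_dualVan h2 h3 hl (Qd_isHomogeneous l) h4)
  have h5 := Qd_pderiv l (P0 l)
  rw [this] at h5
  simp [P0] at h5
  have hn : (18 : K) ≠ 0 := by
    have e : (18 : K) = 2 * 3 ^ 2 := by norm_num
    rw [e]; exact mul_ne_zero h2 (pow_ne_zero _ h3)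
  exact mul_ne_zero hn hl (by linear_combination -h5)


/-! ### Characteristic two -/

theorem eval_smul_hom {d : ℕ} {A : MvPolynomial (Fin 3) K} (hA : A.IsHomogeneous d) (t : K) (v : Fin 3 → K) :
    eval (t • v) A = t ^ d * eval v A := by
  have h := congrArg (MvPolynomial.eval v) (transformPoly_smul_one hA t)
  rw [eval_transformPoly, MvPolynomial.smul_eval] at h
  rw [← h]
  congr 2
  rw [Matrix.smul_mulVec, Matrix.one_mulVec]

/-- a form with relation to the flex polynomial vanishes at inflection lines -/
theorem infl_vanish {c : ℕ → ℕ → K} (hF : IsSmoothCurve (cub c) 3) {A : MvPolynomial (Fin 3) K} {d : ℕ}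
    (hA : A.IsHomogeneous d) {P R : MvPolynomial (Fin 3) K}
    (h : MvPolynomial.aeval (ggrad (cub c)) A = cub c * P + flexc c * R)
    {w : Fin 3 → K} (hw : IsInflLine (cub c) w) : eval w A = 0 := by
  obtain ⟨a, ha, t, ht, rfl⟩ := flex_of_infl hF hw
  rw [eval_smul_hom hA, ← eval_aeval_ggrad, h, map_add, map_mul, map_mul, eval_flexc, flexe_of_isFlex hF ha, ha.2.1]
  ring

theorem infl_vanish_dual {F : MvPolynomial (Fin 3) K} (hF : IsSmoothCurve F 3) {A : MvPolynomial (Fin 3) K} {d : ℕ}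
    (hA : A.IsHomogeneous d) (h : DualVan A F) {w : Fin 3 → K} (hw : IsInflLine F w) : eval w A = 0 := by
  obtain ⟨c, rfl⟩ := exists_cub hF.1
  obtain ⟨P, hP⟩ := h
  exact infl_vanish hF hA (P := P) (R := 0) (by rw [hP]; ring) hw

def xyz : MvPolynomial (Fin 3) K := X 0 * X 1 * X 2

theorem eval_xyz (p : Fin 3 → K) : eval p xyz = p 0 * p 1 * p 2 := by simp [xyz]

theorem span_cubics [IsAlgClosed K] (h3 : (3 : K) ≠ 0) {l : K} (hl : l ^ 3 + 27 ≠ 0) {A : MvPolynomial (Fin 3) K}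
    (hA : A.IsHomogeneous 3) (h : ∀ w, IsInflLine (hesse l) w → eval w A = 0) :
    ∃ α β : K, A = α • hesse 0 + β • xyz ∧ (54 - l ^ 3) * α = 9 * l * β := by
  haveI : Infinite K := IsAlgClosed.instInfinite
  obtain ⟨c, rfl⟩ := exists_cub hA
  obtain ⟨⟨z1, z2, z3, z4, z5, z6⟩, e1, e2, e3⟩ := cubics_thru h3 hl h
  refine ⟨c 3 0, c 1 1, ?_, e3⟩
  apply funext_poly; intro p
  rw [eval_cub, z1, z2, z3, z4, z5, z6, e1, e2, map_add, MvPolynomial.smul_eval, MvPolynomial.smul_eval, eval_hesse, eval_xyz]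
  ring

theorem hesse_eq_span [Infinite K] (m : K) : hesse m = hesse 0 + m • xyz := by
  apply funext_poly; intro p
  rw [map_add, MvPolynomial.smul_eval, eval_hesse, eval_hesse, eval_xyz]; ring

theorem aeval_hesse0_two [Infinite K] (h2 : (2 : K) = 0) :
    MvPolynomial.aeval (ggrad (hesse (0 : K))) (hesse (0 : K)) = hesse (0 : K) * hesse 0 := by
  apply funext_poly; intro p
  obtain ⟨p0, p1, p2⟩ := eval_pderiv_hesse 0 p
  rw [eval_aeval_ggrad, eval_hesse, map_mul, eval_hesse]
  simp only [gradVec, p0, p1, p2]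
  linear_combination (13 * (p 0 ^ 3 + p 1 ^ 3 + p 2 ^ 3) ^ 2 - 27 * (p 0 ^ 3 * p 1 ^ 3 + p 0 ^ 3 * p 2 ^ 3 + p 1 ^ 3 * p 2 ^ 3)) * h2

theorem aeval_xyz [Infinite K] :
    MvPolynomial.aeval (ggrad (hesse (0 : K))) (xyz : MvPolynomial (Fin 3) K) = (27 : K) • (xyz * xyz) := by
  apply funext_poly; intro p
  obtain ⟨p0, p1, p2⟩ := eval_pderiv_hesse 0 p
  rw [eval_aeval_ggrad, eval_xyz, MvPolynomial.smul_eval, map_mul, eval_xyz]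
  simp only [gradVec, p0, p1, p2]
  ring

theorem dualVan_two [Infinite K] (h2 : (2 : K) = 0) (l : K) : DualVan (hesse (l ^ 2)) (hesse l) := by
  refine ⟨hesse (l ^ 4), ?_⟩
  apply funext_poly; intro p
  obtain ⟨p0, p1, p2⟩ := eval_pderiv_hesse l p
  rw [eval_aeval_ggrad, eval_hesse, map_mul, eval_hesse, eval_hesse]
  simp only [gradVec, p0, p1, p2]
  linear_combination (13 * (p 0 ^ 3 + p 1 ^ 3 + p 2 ^ 3) ^ 2 +
    (5 * l ^ 3 - 27) * (p 0 ^ 3 * p 1 ^ 3 + p 0 ^ 3 * p 2 ^ 3 + p 1 ^ 3 * p 2 ^ 3)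
    + (13 * l + l ^ 4) * (p 0 * p 1 * p 2) * (p 0 ^ 3 + p 1 ^ 3 + p 2 ^ 3) + 27 * l ^ 2 * (p 0 * p 1 * p 2) ^ 2) * h2

theorem hl_two (h2 : (2 : K) = 0) {l : K} (hl : l ^ 3 + 27 ≠ 0) : (l ^ 2) ^ 3 + 27 ≠ 0 := by
  have : (l ^ 2) ^ 3 + 27 = (l ^ 3 + 27) ^ 2 := by linear_combination (- 27 * l ^ 3 - 351) * h2
  rw [this]; exact pow_ne_zero _ hl

theorem hl_zero (h3 : (3 : K) ≠ 0) : (0 : K) ^ 3 + 27 ≠ 0 := by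
  have e : (0 : K) ^ 3 + 27 = 3 ^ 3 := by norm_num
  rw [e]; exact pow_ne_zero _ h3

theorem span_two [IsAlgClosed K] (h2 : (2 : K) = 0) (h3 : (3 : K) ≠ 0) {l : K} (hl : l ^ 3 + 27 ≠ 0) (h0 : l ≠ 0)
    {A : MvPolynomial (Fin 3) K}
    (hA : A.IsHomogeneous 3) (h : ∀ w, IsInflLine (hesse l) w → eval w A = 0) : ∃ c : K, A = c • hesse (l ^ 2) := by
  haveI : Infinite K := IsAlgClosed.instInfinite
  obtain ⟨α, β, h1, hab⟩ := span_cubics h3 hl hA h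
  refine ⟨α, ?_⟩
  have : β = l ^ 2 * α := by
    apply mul_left_cancel₀ h0
    linear_combination (-1 : K) * hab + (27 * α + (-4 * l) * β - l ^ 3 * α + l * β - l * β) * h2
  rw [h1, hesse_eq_span (l ^ 2), smul_add, smul_smul, this, mul_comm]

theorem span_two_zero [IsAlgClosed K] (h3 : (3 : K) ≠ 0)
    {A : MvPolynomial (Fin 3) K}
    (hA : A.IsHomogeneous 3) (h : ∀ w, IsInflLine (hesse 0) w → eval w A = 0) :
    ∃ α β : K, A = α • hesse 0 + β • xyz := by
  obtain ⟨α, β, h1, hab⟩ := span_cubics h3 (hl_zero h3) hA h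
  exact ⟨α, β, h1⟩

theorem hesse_not_dvd_xyz [IsAlgClosed K] (h3 : (3 : K) ≠ 0) : ¬ hesse (0 : K) ∣ xyz * xyz := by
  rintro ⟨R, hR⟩
  obtain ⟨s, hs⟩ := exists_cbrt (-2 : K)
  by_cases h2 : (2 : K) = 0
  · obtain ⟨w, hw⟩ := exists_omega (K := K)
    obtain ⟨t, ht⟩ := exists_cbrt w
    obtain ⟨r, hr⟩ := exists_cbrt (-1 - w)
    have := congrArg (MvPolynomial.eval ![1, t, r]) hR
    rw [map_mul, map_mul, eval_xyz, eval_hesse] at this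
    simp only [Matrix.cons_val] at this
    have e : (1 : K) ^ 3 + t ^ 3 + r ^ 3 + 0 * 1 * t * r = 0 := by rw [ht, hr]; ring
    rw [e, zero_mul] at this
    have hw0 : w ≠ 0 := by rintro rfl; simp at hw
    have hw1 : -1 - w ≠ 0 := by
      intro h; apply hw0; apply pow_eq_zero_iff (n := 2) (by norm_num) |>.1; linear_combination hw + h
    have ht0 : t ≠ 0 := by rintro rfl; apply hw0; rw [← ht]; ring
    have hr0 : r ≠ 0 := by rintro rfl; apply hw1; rw [← hr]; ring
    simp [ht0, hr0] at this
  · have := congrArg (MvPolynomial.eval ![1, 1, s]) hR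
    rw [map_mul, map_mul, eval_xyz, eval_hesse] at this
    simp only [Matrix.cons_val] at this
    have e : (1 : K) ^ 3 + 1 ^ 3 + s ^ 3 + 0 * 1 * 1 * s = 0 := by rw [hs]; ring
    rw [e, zero_mul] at this
    have hs0 : s ≠ 0 := by rintro rfl; apply h2; linear_combination hs
    simp [hs0] at this

theorem dual_two [IsAlgClosed K] (h2 : (2 : K) = 0) (h3 : (3 : K) ≠ 0) {l : K} (hl : l ^ 3 + 27 ≠ 0)
    {A : MvPolynomial (Fin 3) K} (hA : A.IsHomogeneous 3) (h : DualVan A (hesse l)) : ∃ c : K, A = c • hesse (l ^ 2) := by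
  haveI : Infinite K := IsAlgClosed.instInfinite
  have hv : ∀ w, IsInflLine (hesse l) w → eval w A = 0 := fun w hw => infl_vanish_dual (hesse_smooth h3 hl) hA h hw
  by_cases h0 : l = 0
  · subst h0
    obtain ⟨α, β, rfl⟩ := span_two_zero h3 hA hv
    refine ⟨α, ?_⟩
    by_cases hb : β = 0
    · rw [hb, zero_smul, add_zero]; norm_num
    exfalso
    apply hesse_not_dvd_xyz h3 (K := K)
    rw [DualVan, map_add, map_smul, map_smul, aeval_hesse0_two h2, aeval_xyz, smul_smul, ← smul_mul_assoc,
      mul_comm] at h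
    have h' := (Dvd.dvd.mul_right (dvd_refl (hesse (0 : K))) (α • hesse 0))
    have h'' := (dvd_add_right h').1 h
    have hn : β * 27 ≠ 0 := by
      have e : (27 : K) = 3 ^ 3 := by norm_num
      rw [e]; exact mul_ne_zero hb (pow_ne_zero _ h3)
    have := Dvd.dvd.mul_left h'' (MvPolynomial.C (β * 27)⁻¹)
    rw [← MvPolynomial.smul_eq_C_mul, smul_smul, inv_mul_cancel₀ hn, one_smul] at this
    exact this
  · exact span_two h2 h3 hl h0 hA hv

/-! Vanishing of the j-invariant -/

theorem hess_wpoly (h2 : (2 : K) = 0) (W : WeierstrassCurve K) (h1 : W.a₁ = 0) (p : Fin 3 → K) :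
    hessMat (wpoly W) p = 0 := by
  ext i j
  have h6 : (6 : K) = 0 := by linear_combination 3 * h2
  fin_cases i <;> fin_cases j <;>
  · simp [hessMat, wpoly, pderiv_X, Pi.single_apply, Derivation.leibniz, Derivation.leibniz_pow, pderiv_num, h1, h2]
    try linear_combination (exp := 1) (0 : K) * h2

theorem hess_of_hasJZero (h2 : (2 : k) = 0) {P : MvPolynomial (Fin 3) k} (h : HasJZero P)
    (p : Fin 3 → AlgebraicClosure k) : hessMat (bar P) p = 0 := by
  have h2' : (2 : AlgebraicClosure k) = 0 := by
    have := congrArg (algebraMap k (AlgebraicClosure k)) h2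
    rwa [map_ofNat, map_zero] at this
  obtain ⟨W, hW, g, c, hj, e⟩ := h
  have hc4 : W.c₄ = 0 := by
    rw [WeierstrassCurve.j] at hj
    have := (mul_eq_zero.1 hj).resolve_left (Units.ne_zero _)
    exact pow_eq_zero_iff (n := 3) (by norm_num) |>.1 this
  have ha1 : W.a₁ = 0 := by
    rw [WeierstrassCurve.c₄, WeierstrassCurve.b₂] at hc4
    apply pow_eq_zero_iff (n := 4) (by norm_num) |>.1
    linear_combination hc4 - (8 * W.a₂ ^ 2 + 4 * W.a₁ ^ 2 * W.a₂ - 12 * W.b₄) * h2'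
  have hg : (g : Matrix (Fin 3) (Fin 3) (AlgebraicClosure k)) * (g⁻¹ : GL (Fin 3) (AlgebraicClosure k)) = 1 := by
    rw [← Units.val_mul]; simp
  have hg' : ((g⁻¹ : GL (Fin 3) (AlgebraicClosure k)) : Matrix (Fin 3) (Fin 3) (AlgebraicClosure k)) * g = 1 := by
    rw [← Units.val_mul]; simp
  rw [← transformPoly_inv_left hg (bar P), e, hessMat_transformPoly, hessMat_smul, hess_wpoly h2' W ha1]
  simp


theorem wei_hesse [IsAlgClosed K] (h3 : (3 : K) ≠ 0) : Equivv (wei 0 0 1 0 0) (hesse (0 : K)) := by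
  haveI : Infinite K := IsAlgClosed.instInfinite
  obtain ⟨w, hw⟩ := exists_omega (K := K)
  have hw3 : w ^ 3 = 1 := by linear_combination (w - 1) * hw
  apply equivv_of_eval (g := Matrix.of ![![-1, 0, 0], ![0, -1, -1], ![0, -w, -w ^ 2]])
  · rw [det_mat]
    intro h
    have h1 : w ^ 2 = w := by linear_combination -h
    have h4 : w = 1 := by
      have h0 : w ≠ 0 := by rintro rfl; simp at hw
      apply mul_left_cancel₀ h0; linear_combination h1
    apply h3; rw [h4] at hw; linear_combination hw
  · intro p
    rw [mulVec_mat, eval_wei, eval_hesse]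
    simp only [Matrix.cons_val]
    linear_combination (-(p 1 ^ 2 * p 2 + p 1 * p 2 ^ 2 + p 1 ^ 3 + p 2 ^ 3)) * hw + p 2 ^ 3 * hw3
      - (p 1 * p 2 ^ 2 + p 1 ^ 2 * p 2) * hw - (p 1 * p 2 ^ 2 * (2 + w) + 2 * p 1 ^ 2 * p 2 + p 2 ^ 3 * (1 + w)) * hw3

theorem hasJZero_of (h3 : (3 : k) ≠ 0) {P : MvPolynomial (Fin 3) k} {g h : Matrix (Fin 3) (Fin 3) (AlgebraicClosure k)}
    (hgh : g * h = 1) (hhg : h * g = 1) {c : AlgebraicClosure k} (hc : c ≠ 0)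
    (e : transformPoly g (bar P) = c • hesse 0) : HasJZero P := by
  have h3' : (3 : AlgebraicClosure k) ≠ 0 := by
    have := (map_ne_zero (algebraMap k (AlgebraicClosure k))).2 h3
    rwa [map_ofNat] at this
  obtain ⟨u, v, huv, hvu, e2⟩ := (wei_hesse (K := AlgebraicClosure k) h3').symm
  have hΔ : (⟨0, 0, 1, 0, 0⟩ : WeierstrassCurve (AlgebraicClosure k)).Δ ≠ 0 := by
    have : (⟨0, 0, 1, 0, 0⟩ : WeierstrassCurve (AlgebraicClosure k)).Δ = - 3 ^ 3 := by
      simp only [WeierstrassCurve.Δ, WeierstrassCurve.b₂, WeierstrassCurve.b₄, WeierstrassCurve.b₆, WeierstrassCurve.b₈]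
      norm_num
    rw [this]; exact neg_ne_zero.2 (pow_ne_zero _ h3')
  refine ⟨⟨0, 0, 1, 0, 0⟩, ⟨isUnit_iff_ne_zero.2 hΔ⟩, ⟨g * u, v * h, ?_, ?_⟩, Units.mk0 c hc, ?_, ?_⟩
  · rw [mul_assoc, ← mul_assoc u, huv, one_mul, hgh]
  · rw [mul_assoc, ← mul_assoc h, hhg, one_mul, hvu]
  · rw [WeierstrassCurve.j]
    simp [WeierstrassCurve.c₄, WeierstrassCurve.b₂, WeierstrassCurve.b₄]
  · show transformPoly (g * u) (bar P) = c • wei 0 0 1 0 0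
    rw [← transformPoly_comp, e, transformPoly_smul, e2]

theorem hess_hesse_span [Infinite K] (h2 : (2 : K) = 0) (α β : K)
    (h : ∀ p : Fin 3 → K, hessMat (α • hesse (0 : K) + β • (xyz : MvPolynomial (Fin 3) K)) p = 0) : β = 0 := by
  have := congrFun (congrFun (h ![0, 0, 1]) 0) 1
  simp [hessMat, hesse, xyz, pderiv_X, Pi.single_apply, Derivation.leibniz, Derivation.leibniz_pow, pderiv_num] at this
  exact this


/-! ### Descent -/

theorem ggrad_bar (F : MvPolynomial (Fin 3) k) :
    ggrad (bar F) = fun i => MvPolynomial.map (algebraMap k (AlgebraicClosure k)) (ggrad F i) := by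
  ext1 i
  simp only [ggrad, bar]
  exact MvPolynomial.pderiv_map

theorem bar_aeval (v : Fin 3 → MvPolynomial (Fin 3) k) (A : MvPolynomial (Fin 3) k) :
    bar (MvPolynomial.aeval v A) =
      MvPolynomial.aeval (fun i => MvPolynomial.map (algebraMap k (AlgebraicClosure k)) (v i)) (bar A) := by
  induction A using MvPolynomial.induction_on with
  | C c => simp [bar]
  | add p q hp hq => simp only [bar, map_add] at *; rw [hp, hq]
  | mul_X p j hp => simp only [bar, map_mul, MvPolynomial.aeval_X, MvPolynomial.map_X] at *; rw [hp]

theorem bar_mul (A B : MvPolynomial (Fin 3) k) : bar (A * B) = bar A * bar B := map_mul _ _ _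
theorem bar_add (A B : MvPolynomial (Fin 3) k) : bar (A + B) = bar A + bar B := map_add _ _ _
theorem bar_smul (c : k) (A : MvPolynomial (Fin 3) k) : bar (c • A) = algebraMap k (AlgebraicClosure k) c • bar A := by
  simp only [bar, MvPolynomial.smul_eq_C_mul, map_mul, MvPolynomial.map_C]

theorem bar_isHomogeneous {A : MvPolynomial (Fin 3) k} {d : ℕ} (h : A.IsHomogeneous d) : (bar A).IsHomogeneous d :=
  h.map _

theorem bar_ne_zero {A : MvPolynomial (Fin 3) k} (h : A ≠ 0) : bar A ≠ 0 := by
  intro h0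
  apply h; apply bar_injective; rw [h0]; simp [bar]

theorem descend_dual {F : MvPolynomial (Fin 3) k} {B : MvPolynomial (Fin 3) (AlgebraicClosure k)} {d : ℕ}
    (hB : B.IsHomogeneous d) (h0 : B ≠ 0) (h : DualVan B (bar F)) :
    ∃ G : MvPolynomial (Fin 3) k, G ≠ 0 ∧ G.IsHomogeneous d ∧ DualVan (bar G) (bar F) := by
  obtain ⟨φ, hφ⟩ := exists_mapc_ne_zero (k := k) h0
  refine ⟨mapc φ B, hφ, mapc_isHomogeneous φ hB, ?_⟩
  obtain ⟨R, hR⟩ := h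
  have h1 := congrArg (mapc φ) hR
  rw [ggrad_bar, mapc_aeval] at h1
  have h2 : mapc φ (bar F * R) = F * mapc φ R := mapc_map_mul φ F R
  rw [h2] at h1
  have h3 := congrArg bar h1
  rw [bar_aeval, bar_mul, ← ggrad_bar] at h3
  exact ⟨_, h3⟩

theorem main_exists {F : MvPolynomial (Fin 3) k} {l : AlgebraicClosure k}
    {g h : Matrix (Fin 3) (Fin 3) (AlgebraicClosure k)} (hgh : g * h = 1) (hhg : h * g = 1)
    (e : transformPoly g (bar F) = hesse l) {S : MvPolynomial (Fin 3) (AlgebraicClosure k)} {d : ℕ}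
    (hS : S.IsHomogeneous d) (hS0 : S ≠ 0) (hd : DualVan S (hesse l))
    (hu : ∀ A : MvPolynomial (Fin 3) (AlgebraicClosure k), A.IsHomogeneous d → DualVan A (hesse l) → ∃ c : AlgebraicClosure k, A = c • S) :
    ∃ G : MvPolynomial (Fin 3) k, G.IsHomogeneous d ∧ DualVan (bar G) (bar F) ∧
      ∃ c : AlgebraicClosure k, c ≠ 0 ∧ transformPoly h.transpose (bar G) = c • S := by
  have e' : transformPoly h (hesse l) = bar F := by rw [← e]; exact transformPoly_inv_left hgh _
  have h1 := dualVan_transform hhg hd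
  rw [e'] at h1
  have hne : transformPoly g.transpose S ≠ 0 := by
    intro h0
    apply hS0
    have := transformPoly_inv_left (tr_inv hhg) S
    rw [h0] at this
    rw [← this]; simp [transformPoly]
  obtain ⟨G, hG0, hG, hGd⟩ := descend_dual (transformPoly_isHomogeneous _ hS) hne h1
  refine ⟨G, hG, hGd, ?_⟩
  have h2 := dualVan_transform hgh hGd
  rw [e] at h2
  obtain ⟨c, hc⟩ := hu _ (transformPoly_isHomogeneous _ (bar_isHomogeneous hG)) h2
  refine ⟨c, ?_, hc⟩
  rintro rfl
  apply bar_ne_zero hG0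
  rw [zero_smul] at hc
  rw [← transformPoly_inv_left (tr_inv hgh) (bar G), hc]; simp [transformPoly]

theorem main_unique {G G' : MvPolynomial (Fin 3) k}
    {g h : Matrix (Fin 3) (Fin 3) (AlgebraicClosure k)} (hgh : g * h = 1)
    {S : MvPolynomial (Fin 3) (AlgebraicClosure k)} {c c' : AlgebraicClosure k} (hc : c ≠ 0)
    (h1 : transformPoly h.transpose (bar G) = c • S) (h2 : transformPoly h.transpose (bar G') = c' • S)
    (h0 : G' ≠ 0) : ∃ d : k, d ≠ 0 ∧ G' = d • G := by
  apply descend_smul h0 (c := c' * c⁻¹)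
  rw [← transformPoly_inv_left (tr_inv hgh) (bar G), ← transformPoly_inv_left (tr_inv hgh) (bar G'), h1, h2,
    ← transformPoly_smul, smul_smul, mul_assoc, inv_mul_cancel₀ hc, mul_one]

theorem main_irr {G : MvPolynomial (Fin 3) k}
    {g h : Matrix (Fin 3) (Fin 3) (AlgebraicClosure k)} (hgh : g * h = 1) (hhg : h * g = 1)
    {S : MvPolynomial (Fin 3) (AlgebraicClosure k)} {c : AlgebraicClosure k} (hc : c ≠ 0)
    (h1 : transformPoly h.transpose (bar G) = c • S) (hi : Irreducible S) : Irreducible (bar G) := by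
  rw [← transformPoly_inv_left (tr_inv hgh) (bar G), h1]
  apply transformPoly_irreducible (tr_inv hhg) (tr_inv hgh)
  rw [MvPolynomial.smul_eq_C_mul]
  exact (irreducible_isUnit_mul ((isUnit_iff_ne_zero.2 hc).map MvPolynomial.C)).2 hi

theorem infl_to {F : MvPolynomial (Fin 3) K} {l : K}
    {g h : Matrix (Fin 3) (Fin 3) K} (hgh : g * h = 1) (hhg : h * g = 1)
    (e : transformPoly g F = hesse l) {w : Fin 3 → K} (hw : IsInflLine F w) :
    IsInflLine (hesse l) (g.transpose.mulVec w) := by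
  rw [← e]; exact infl_transform hgh hhg hw

theorem infl_from {F : MvPolynomial (Fin 3) K} {l : K}
    {g h : Matrix (Fin 3) (Fin 3) K} (hgh : g * h = 1) (hhg : h * g = 1)
    (e : transformPoly g F = hesse l) {w : Fin 3 → K} (hw : IsInflLine (hesse l) w) :
    IsInflLine F (h.transpose.mulVec w) := by
  have e' : transformPoly h (hesse l) = F := by rw [← e]; exact transformPoly_inv_left hgh _
  rw [← e']; exact infl_transform hhg hgh hw

theorem exists_ne2 (h2 : (2 : k) ≠ 0) (h3 : (3 : k) ≠ 0) {F : MvPolynomial (Fin 3) k} {l : AlgebraicClosure k}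
    (hl : l ^ 3 + 27 ≠ 0)
    {g h : Matrix (Fin 3) (Fin 3) (AlgebraicClosure k)} (hgh : g * h = 1) (hhg : h * g = 1)
    (e : transformPoly g (bar F) = hesse l) :
    ∃ G : MvPolynomial (Fin 3) k,
      Irreducible (bar G) ∧ ReconstructionCond F G ∧
      (∀ G' : MvPolynomial (Fin 3) k, Irreducible (bar G') → ReconstructionCond F G' →
        ∃ c : k, c ≠ 0 ∧ G' = c • G) ∧
      ContainsGaussImage (bar G) (bar F) := by
  haveI : Infinite (AlgebraicClosure k) := IsAlgClosed.instInfinite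
  have h3' : (3 : AlgebraicClosure k) ≠ 0 := by
    have := (map_ne_zero (algebraMap k (AlgebraicClosure k))).2 h3
    rwa [map_ofNat] at this
  have h2' : (2 : AlgebraicClosure k) ≠ 0 := by
    have := (map_ne_zero (algebraMap k (AlgebraicClosure k))).2 h2
    rwa [map_ofNat] at this
  obtain ⟨G, hG, hGd, c, hc, hcG⟩ := main_exists hgh hhg e (Gd_isHomogeneous l) (Gd_ne_zero h3' l) (dualVan_Gd l)
    (fun A hA hd => dual_ne2 h2' h3' hl hA hd)
  refine ⟨G, main_irr hgh hhg hc hcG (Gd_irreducible h2' h3' hl), ⟨fun _ => ⟨hG, ?_⟩, fun h => absurd h h2⟩, ?_,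
    containsGauss_of_dualVan hGd⟩
  · intro w hw
    have h1 := cusp_all h2' h3' hl _ (infl_to hgh hhg e hw)
    have h4 := cusp_transform (tr_inv hhg) (tr_inv hgh) (cusp_smul hc h1)
    rw [← hcG, transformPoly_inv_left (tr_inv hgh)] at h4
    exact h4
  · intro G' hi hG'
    obtain ⟨hh, hcu⟩ := hG'.1 h2
    obtain ⟨c', hc'⟩ := uniq_ne2 h2' h3' hl (transformPoly_isHomogeneous h.transpose (bar_isHomogeneous hh))
      (fun w hw => cusp_transform (tr_inv hgh) (tr_inv hhg) (hcu _ (infl_from hgh hhg e hw)))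
      (transformPoly_irreducible (tr_inv hgh) (tr_inv hhg) hi)
    refine main_unique hgh hc hcG hc' ?_
    rintro rfl
    apply hi.ne_zero; simp [bar]

theorem hasJ_iff (h2 : (2 : k) = 0) (h3 : (3 : k) ≠ 0) {F : MvPolynomial (Fin 3) k} {l : AlgebraicClosure k}
    {g h : Matrix (Fin 3) (Fin 3) (AlgebraicClosure k)} (hgh : g * h = 1) (hhg : h * g = 1)
    (e : transformPoly g (bar F) = hesse l) : HasJZero F ↔ l = 0 := by
  haveI : Infinite (AlgebraicClosure k) := IsAlgClosed.instInfinite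
  have h2' : (2 : AlgebraicClosure k) = 0 := by
    have := congrArg (algebraMap k (AlgebraicClosure k)) h2
    rwa [map_ofNat, map_zero] at this
  constructor
  · intro hj
    apply hess_hesse_span h2' 1 l
    intro p
    rw [one_smul, ← hesse_eq_span, ← e, hessMat_transformPoly, hess_of_hasJZero h2 hj]
    simp
  · rintro rfl
    exact hasJZero_of h3 hgh hhg one_ne_zero (by rw [e, one_smul])

theorem exists_two (h2 : (2 : k) = 0) (h3 : (3 : k) ≠ 0) {F : MvPolynomial (Fin 3) k} (hF : IsSmoothCurve (bar F) 3)
    {l : AlgebraicClosure k}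
    (hl : l ^ 3 + 27 ≠ 0)
    {g h : Matrix (Fin 3) (Fin 3) (AlgebraicClosure k)} (hgh : g * h = 1) (hhg : h * g = 1)
    (e : transformPoly g (bar F) = hesse l) :
    ∃ G : MvPolynomial (Fin 3) k,
      Irreducible (bar G) ∧ ReconstructionCond F G ∧
      (∀ G' : MvPolynomial (Fin 3) k, Irreducible (bar G') → ReconstructionCond F G' →
        ∃ c : k, c ≠ 0 ∧ G' = c • G) ∧
      ContainsGaussImage (bar G) (bar F) := by
  haveI : Infinite (AlgebraicClosure k) := IsAlgClosed.instInfinite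
  have h3' : (3 : AlgebraicClosure k) ≠ 0 := by
    have := (map_ne_zero (algebraMap k (AlgebraicClosure k))).2 h3
    rwa [map_ofNat] at this
  have h2' : (2 : AlgebraicClosure k) = 0 := by
    have := congrArg (algebraMap k (AlgebraicClosure k)) h2
    rwa [map_ofNat, map_zero] at this
  have hsm := hesse_smooth h3' (hl_two h2' hl)
  obtain ⟨G, hG, hGd, c, hc, hcG⟩ := main_exists hgh hhg e hsm.1 hsm.2.1 (dualVan_two h2' l)
    (fun A hA hd => dual_two h2' h3' hl hA hd)
  refine ⟨G, main_irr hgh hhg hc hcG (smooth_irreducible (by norm_num) hsm),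
    ⟨fun h => absurd h2 h, fun _ => ⟨hG, ?_, ?_⟩⟩, ?_,
    containsGauss_of_dualVan hGd⟩
  · intro w hw
    exact infl_vanish_dual hF (bar_isHomogeneous hG) hGd hw
  · intro hj
    have h0 := (hasJ_iff h2 h3 hgh hhg e).1 hj
    subst h0
    refine hasJZero_of h3 (tr_inv hgh) (tr_inv hhg) hc ?_
    rw [hcG]; norm_num
  · intro G' hi hG'
    obtain ⟨hh, hcu, hj⟩ := hG'.2 h2
    have hv : ∀ w, IsInflLine (hesse l) w → eval w (transformPoly h.transpose (bar G')) = 0 := by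
      intro w hw
      rw [eval_transformPoly]
      exact hcu _ (infl_from hgh hhg e hw)
    have hhom := transformPoly_isHomogeneous h.transpose (bar_isHomogeneous hh)
    have hne : G' ≠ 0 := by
      rintro rfl
      apply hi.ne_zero; simp [bar]
    by_cases h0 : l = 0
    · have hj' := hj ((hasJ_iff h2 h3 hgh hhg e).2 h0)
      subst h0
      obtain ⟨α, β, hab⟩ := span_two_zero h3' hhom hv
      have hb : β = 0 := by
        apply hess_hesse_span h2' α β
        intro p
        rw [← hab, hessMat_transformPoly, hess_of_hasJZero h2 hj']
        simp
      refine main_unique hgh hc hcG (c' := α) ?_ hne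
      rw [hab, hb, zero_smul, add_zero]; norm_num
    · obtain ⟨c', hc'⟩ := span_two h2' h3' hl h0 hhom hv
      exact main_unique hgh hc hcG hc' hne


/-! ### The linear system of cubics through the inflection lines -/

theorem mem_TC {F P : MvPolynomial (Fin 3) k} : P ∈ cubicsThroughTC F ↔
    P.IsHomogeneous 3 ∧ ∀ w, IsInflLine (bar F) w → eval w (bar P) = 0 := by
  have e : ∀ w : Fin 3 → AlgebraicClosure k, MvPolynomial.aeval w P = eval w (bar P) := by
    intro w
    rw [bar, MvPolynomial.eval_map, MvPolynomial.aeval_def]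
  simp only [cubicsThroughTC, Submodule.mem_inf, mem_homogeneousSubmodule, Submodule.mem_iInf, Set.mem_setOf_eq,
    LinearMap.mem_ker, AlgHom.toLinearMap_apply, e]

theorem transform_injective {g h : Matrix (Fin 3) (Fin 3) K} (hgh : g * h = 1) {A B : MvPolynomial (Fin 3) K}
    (e : transformPoly g A = transformPoly g B) : A = B := by
  rw [← transformPoly_inv_left hgh A, e, transformPoly_inv_left hgh]

theorem finrank_ne_two {F : MvPolynomial (Fin 3) k} {g h : Matrix (Fin 3) (Fin 3) (AlgebraicClosure k)}
    (hgh : g * h = 1) {S : MvPolynomial (Fin 3) (AlgebraicClosure k)}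
    (hS : ∀ P ∈ cubicsThroughTC F, ∃ c : AlgebraicClosure k, transformPoly g (bar P) = c • S) :
    Module.finrank k (cubicsThroughTC F) ≠ 2 := by
  intro h2
  haveI : Module.Finite k (cubicsThroughTC F) := Module.finite_of_finrank_pos (by omega)
  let b := Module.finBasisOfFinrankEq k (cubicsThroughTC F) h2
  have hli : LinearIndependent k (fun i => ((b i : cubicsThroughTC F) : MvPolynomial (Fin 3) k)) :=
    b.linearIndependent.map' (Submodule.subtype _) (Submodule.ker_subtype _)
  have hli2 := bar_linearIndependent hli
  obtain ⟨c0, hc0⟩ := hS _ (b 0).2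
  obtain ⟨c1, hc1⟩ := hS _ (b 1).2
  have hne : bar ((b 0 : cubicsThroughTC F) : MvPolynomial (Fin 3) k) ≠ 0 := hli2.ne_zero 0
  rw [Fintype.linearIndependent_iff] at hli2
  have := hli2 ![c1, -c0] (by
    rw [Fin.sum_univ_two]
    apply transform_injective hgh
    rw [transformPoly_add, transformPoly_smul, transformPoly_smul, hc0, hc1, smul_smul, smul_smul, ← add_smul]
    simp only [Matrix.cons_val_zero, Matrix.cons_val_one]
    have e : c1 * c0 + -c0 * c1 = 0 := by ring
    rw [e, zero_smul]; simp [transformPoly])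
  have h0 := this 1
  simp at h0
  rw [h0, zero_smul] at hc0
  apply hne
  apply transform_injective hgh
  rw [hc0]; simp [transformPoly]

theorem span_not_two [IsAlgClosed K] (h3 : (3 : K) ≠ 0) {l : K} (hl : l ^ 3 + 27 ≠ 0) (hn : ¬ ((2 : K) = 0 ∧ l = 0)) :
    ∃ S : MvPolynomial (Fin 3) K, ∀ A : MvPolynomial (Fin 3) K, A.IsHomogeneous 3 →
      (∀ w, IsInflLine (hesse l) w → eval w A = 0) → ∃ c : K, A = c • S := by
  by_cases h0 : l = 0
  · have h2 : (2 : K) ≠ 0 := fun h => hn ⟨h, h0⟩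
    refine ⟨xyz, fun A hA h => ?_⟩
    obtain ⟨α, β, h1, hab⟩ := span_cubics h3 hl hA h
    have ha : α = 0 := by
      have : (2 * 3 ^ 3) * α = 0 := by rw [h0] at hab; linear_combination hab
      exact (mul_eq_zero.1 this).resolve_left (mul_ne_zero h2 (pow_ne_zero _ h3))
    exact ⟨β, by rw [h1, ha, zero_smul, zero_add]⟩
  · have h9 : 9 * l ≠ 0 := by
      have e : (9 : K) = 3 ^ 2 := by norm_num
      rw [e]; exact mul_ne_zero (pow_ne_zero _ h3) h0
    refine ⟨hesse 0 + ((9 * l)⁻¹ * (54 - l ^ 3)) • xyz, fun A hA h => ?_⟩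
    obtain ⟨α, β, h1, hab⟩ := span_cubics h3 hl hA h
    refine ⟨α, ?_⟩
    have hb : β = α * ((9 * l)⁻¹ * (54 - l ^ 3)) := by
      apply mul_left_cancel₀ h9
      rw [← hab]
      linear_combination (-(54 - l ^ 3) * α) * (mul_inv_cancel₀ h9)
    rw [h1, smul_add, smul_smul, ← hb]

theorem multiple_of_mapc {A : MvPolynomial (Fin 3) (AlgebraicClosure k)} {e1 : MvPolynomial (Fin 3) k} (h1 : e1 ≠ 0)
    (h : ∀ φ : AlgebraicClosure k →ₗ[k] k, ∃ c : k, mapc φ A = c • e1) :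
    ∃ a : AlgebraicClosure k, A = a • bar e1 := by
  obtain ⟨m0, hm0⟩ := MvPolynomial.ne_zero_iff.1 h1
  set r := MvPolynomial.coeff m0 e1 with hr
  refine ⟨(algebraMap k (AlgebraicClosure k) r)⁻¹ * MvPolynomial.coeff m0 A, ?_⟩
  have hr' : algebraMap k (AlgebraicClosure k) r ≠ 0 := (_root_.map_ne_zero (algebraMap k (AlgebraicClosure k))).2 hm0
  ext m
  rw [MvPolynomial.coeff_smul, bar, MvPolynomial.coeff_map, smul_eq_mul]
  by_contra hne
  have hne' : r • MvPolynomial.coeff m A - (MvPolynomial.coeff m e1) • MvPolynomial.coeff m0 A ≠ 0 := by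
    intro h0
    apply hne
    rw [Algebra.smul_def, Algebra.smul_def] at h0
    apply mul_left_cancel₀ hr'
    linear_combination h0 - (MvPolynomial.coeff m0 A * algebraMap k (AlgebraicClosure k) (MvPolynomial.coeff m e1)) * (mul_inv_cancel₀ hr')
  obtain ⟨φ, hφ⟩ := exists_functional (k := k) hne'
  apply hφ
  obtain ⟨c, hc⟩ := h φ
  rw [map_sub, map_smul, map_smul, ← coeff_mapc, ← coeff_mapc, hc, MvPolynomial.coeff_smul, MvPolynomial.coeff_smul,
    smul_eq_mul, smul_eq_mul, smul_eq_mul, smul_eq_mul, ← hr]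
  ring

theorem finrank_two_of {F : MvPolynomial (Fin 3) k} {B1 B2 : MvPolynomial (Fin 3) (AlgebraicClosure k)}
    (hli : LinearIndependent (AlgebraicClosure k) ![B1, B2])
    (hup : ∀ P ∈ cubicsThroughTC F, ∃ α β : AlgebraicClosure k, bar P = α • B1 + β • B2)
    (h1 : ∀ φ : AlgebraicClosure k →ₗ[k] k, mapc φ B1 ∈ cubicsThroughTC F)
    (h2 : ∀ φ : AlgebraicClosure k →ₗ[k] k, mapc φ B2 ∈ cubicsThroughTC F) :
    Module.finrank k (cubicsThroughTC F) = 2 := by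
  have hB1 : B1 ≠ 0 := hli.ne_zero 0
  have hB2 : B2 ≠ 0 := hli.ne_zero 1
  obtain ⟨φ, hφ⟩ := exists_mapc_ne_zero (k := k) hB1
  set e1 := mapc φ B1
  have : ∃ e2 ∈ cubicsThroughTC F, ∀ a : k, a • e1 ≠ e2 := by
    by_contra! hcon
    obtain ⟨a, ha⟩ := multiple_of_mapc hφ (A := B1) (fun ψ => by
      obtain ⟨c, hc⟩ := hcon _ (h1 ψ); exact ⟨c, hc.symm⟩)
    obtain ⟨b, hb⟩ := multiple_of_mapc hφ (A := B2) (fun ψ => by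
      obtain ⟨c, hc⟩ := hcon _ (h2 ψ); exact ⟨c, hc.symm⟩)
    rw [LinearIndependent.pair_iff] at hli
    have h0 := hli b (-a) (by
      rw [ha, hb, smul_smul, smul_smul, ← add_smul]
      have e : b * a + -a * b = 0 := by ring
      rw [e, zero_smul])
    apply hB2; rw [hb, h0.1, zero_smul]
  obtain ⟨e2, he2, hne⟩ := this
  have hl2 : LinearIndependent k ![e1, e2] := (LinearIndependent.pair_iff' hφ).2 hne
  have hV : cubicsThroughTC F = Submodule.span k (Set.range ![e1, e2]) := by
    apply le_antisymm
    · intro x hx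
      by_contra hxs
      have hl3 : LinearIndependent k (Fin.cons x ![e1, e2] : Fin 3 → MvPolynomial (Fin 3) k) :=
        linearIndependent_finCons.2 ⟨hl2, hxs⟩
      have hl3' := bar_linearIndependent hl3
      classical
      have := linearIndependent_le_span' _ hl3' (({B1, B2} : Finset (MvPolynomial (Fin 3) (AlgebraicClosure k))) : Set _) (by
        rintro _ ⟨i, rfl⟩
        have hm : ∀ P ∈ cubicsThroughTC F, bar P ∈ Submodule.span (AlgebraicClosure k)
            ((({B1, B2} : Finset (MvPolynomial (Fin 3) (AlgebraicClosure k))) : Set (MvPolynomial (Fin 3) (AlgebraicClosure k)))) := by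
          intro P hP
          obtain ⟨α, β, hab⟩ := hup P hP
          rw [hab]
          exact Submodule.add_mem _ (Submodule.smul_mem _ _ (Submodule.subset_span (by simp)))
            (Submodule.smul_mem _ _ (Submodule.subset_span (by simp)))
        fin_cases i
        · exact hm _ hx
        · exact hm _ (h1 φ)
        · exact hm _ he2)
      rw [Cardinal.mk_fin] at this
      have hcc : Fintype.card (({B1, B2} : Finset (MvPolynomial (Fin 3) (AlgebraicClosure k))) : Set (MvPolynomial (Fin 3) (AlgebraicClosure k))) =
          ({B1, B2} : Finset (MvPolynomial (Fin 3) (AlgebraicClosure k))).card := by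
        rw [← Nat.card_eq_fintype_card]; simp only [Finset.coe_sort_coe, Nat.card_eq_fintype_card, Fintype.card_coe]
      rw [hcc] at this
      have h4 : ({B1, B2} : Finset (MvPolynomial (Fin 3) (AlgebraicClosure k))).card ≤ 2 := Finset.card_le_two
      have h5 : 3 ≤ ({B1, B2} : Finset (MvPolynomial (Fin 3) (AlgebraicClosure k))).card := by exact_mod_cast this
      omega
    · rw [Submodule.span_le]
      rintro _ ⟨i, rfl⟩
      fin_cases i
      · exact h1 φ
      · exact he2
  rw [hV, finrank_span_eq_card hl2, Fintype.card_fin]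

theorem bar_cub (c : ℕ → ℕ → k) : bar (cub c) = cub (fun i j => algebraMap k (AlgebraicClosure k) (c i j)) := by
  simp [bar, cub]

theorem bar_flexc (c : ℕ → ℕ → k) : bar (flexc c) = flexc (fun i j => algebraMap k (AlgebraicClosure k) (c i j)) := by
  have h3 : algebraMap k (AlgebraicClosure k) 3 = 3 := map_ofNat _ 3
  have h2 : algebraMap k (AlgebraicClosure k) 2 = 2 := map_ofNat _ 2
  simp [bar, flexc, h3, h2]

theorem flexc_isHomogeneous (c : ℕ → ℕ → K) : (flexc c).IsHomogeneous 3 := by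
  have hx : ∀ i : Fin 3, (X i : MvPolynomial (Fin 3) K).IsHomogeneous 1 := isHomogeneous_X K
  have hc : ∀ c : K, (MvPolynomial.C c : MvPolynomial (Fin 3) K).IsHomogeneous 0 := isHomogeneous_C _
  have hcx : ∀ (c : K) (i : Fin 3), (MvPolynomial.C c * X i : MvPolynomial (Fin 3) K).IsHomogeneous 1 := fun c i =>
    isHomogeneous_C_mul_X c i
  have h2 : (2 : MvPolynomial (Fin 3) K).IsHomogeneous 0 := by
    rw [← map_ofNat (MvPolynomial.C : K →+* MvPolynomial (Fin 3) K)]; exact hc _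
  have D0 := ((hcx (3 * c 3 0) 0).add (hcx (c 2 1) 1)).add (hcx (c 2 0) 2)
  have D1 := ((hcx (c 1 2) 0).add (hcx (3 * c 0 3) 1)).add (hcx (c 0 2) 2)
  have D2 := ((hcx (c 1 0) 0).add (hcx (c 0 1) 1)).add (hcx (3 * c 0 0) 2)
  have O0 := (hcx (c 0 2) 1).add (hcx (c 0 1) 2)
  have O1 := (hcx (c 2 0) 0).add (hcx (c 1 0) 2)
  have O2 := (hcx (c 2 1) 0).add (hcx (c 1 2) 1)
  have m := hc (c 1 1)
  have x := hx 0
  have y := hx 1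
  have z := hx 2
  exact ((((((D0.mul D1).mul D2).add (((h2.mul O0).mul O1).mul O2)).add
    (m.mul ((((O0.mul O1).mul z).add ((O1.mul O2).mul x)).add ((O0.mul O2).mul y)))).sub
    (((D0.mul (O0.pow 2)).add (D1.mul (O1.pow 2))).add (D2.mul (O2.pow 2)))).sub
    (m.mul ((((D0.mul O0).mul x).add ((D1.mul O1).mul y)).add ((D2.mul O2).mul z)))).sub
    ((m.pow 2).mul ((((hc _).mul (x.pow 3)).add ((hc _).mul (y.pow 3))).add ((hc _).mul (z.pow 3))))

theorem flex_hesse0 (h3 : (3 : K) ≠ 0) {a : Fin 3 → K} (h0 : a ≠ 0) (ha : a 0 * a 1 * a 2 = 0)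
    (he : eval a (hesse 0) = 0) : IsFlex (hesse 0) a := by
  have hs := hesse_smooth h3 (hl_zero h3)
  rw [hesse_eq_cub] at hs he ⊢
  refine isFlex_of_flexe hs h0 he ?_
  rw [flexe_hesse, ha]; ring

theorem vanish_flex_span [IsAlgClosed K] (h3 : (3 : K) ≠ 0) {T : MvPolynomial (Fin 3) K} (hT : T.IsHomogeneous 3)
    (h : ∀ a, IsFlex (hesse 0) a → eval a T = 0) : ∃ α β : K, T = α • hesse 0 + β • xyz := by
  haveI : Infinite K := IsAlgClosed.instInfinite
  obtain ⟨t, rfl⟩ := exists_cub hT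
  have s0 : t 0 3 - t 0 0 = 0 ∧ - t 0 2 = 0 ∧ t 0 1 = 0 := by
    apply sep h3
    intro e he
    have := h ![0, 1, -e] (flex_hesse0 h3 (by intro h; simpa using congrFun h 1) (by simp) (by
      rw [eval_hesse]; simp only [Matrix.cons_val]; linear_combination -he))
    rw [eval_cub] at this
    simp only [Matrix.cons_val] at this
    linear_combination this + t 0 0 * he
  have s1 : t 3 0 - t 0 0 = 0 ∧ - t 2 0 = 0 ∧ t 1 0 = 0 := by
    apply sep h3
    intro e he
    have := h ![1, 0, -e] (flex_hesse0 h3 (by intro h; simpa using congrFun h 0) (by simp) (by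
      rw [eval_hesse]; simp only [Matrix.cons_val]; linear_combination -he))
    rw [eval_cub] at this
    simp only [Matrix.cons_val] at this
    linear_combination this + t 0 0 * he
  have s2 : t 3 0 - t 0 3 = 0 ∧ - t 2 1 = 0 ∧ t 1 2 = 0 := by
    apply sep h3
    intro e he
    have := h ![1, -e, 0] (flex_hesse0 h3 (by intro h; simpa using congrFun h 0) (by simp) (by
      rw [eval_hesse]; simp only [Matrix.cons_val]; linear_combination -he))
    rw [eval_cub] at this
    simp only [Matrix.cons_val] at this
    linear_combination this + t 0 3 * he
  refine ⟨t 3 0, t 1 1, ?_⟩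
  apply funext_poly; intro p
  rw [eval_cub, map_add, MvPolynomial.smul_eval, MvPolynomial.smul_eval, eval_hesse, eval_xyz, s0.2.2, s1.2.2, s2.2.2]
  linear_combination (-p 1 ^ 3) * s2.1 - p 2 ^ 3 * s1.1 - p 0 ^ 2 * p 1 * s2.2.1 - p 0 ^ 2 * p 2 * s1.2.1 - p 1 ^ 2 * p 2 * s0.2.1

theorem nonflex_point [IsAlgClosed K] (h2 : (2 : K) = 0) : ∃ t r : K, t ≠ 0 ∧ r ≠ 0 ∧ 1 + t ^ 3 + r ^ 3 = 0 := by
  obtain ⟨w, hw⟩ := exists_omega (K := K)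
  obtain ⟨t, ht⟩ := exists_cbrt w
  obtain ⟨r, hr⟩ := exists_cbrt (-1 - w)
  have hw0 : w ≠ 0 := by rintro rfl; simp at hw
  have hw1 : -1 - w ≠ 0 := by
    intro h; apply hw0; apply pow_eq_zero_iff (n := 2) (by norm_num) |>.1; linear_combination hw + h
  refine ⟨t, r, ?_, ?_, ?_⟩
  · rintro rfl; apply hw0; rw [← ht]; ring
  · rintro rfl; apply hw1; rw [← hr]; ring
  · rw [ht, hr]; ring

theorem flexc_span [IsAlgClosed K] (h2 : (2 : K) = 0) (h3 : (3 : K) ≠ 0) {c : ℕ → ℕ → K} (hF : IsSmoothCurve (cub c) 3)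
    {g h : Matrix (Fin 3) (Fin 3) K} (hgh : g * h = 1) (hhg : h * g = 1)
    (e : transformPoly g (cub c) = hesse 0) :
    ∃ α β : K, β ≠ 0 ∧ transformPoly g (flexc c) = α • hesse 0 + β • xyz := by
  haveI : Infinite K := IsAlgClosed.instInfinite
  have e' : transformPoly h (hesse 0) = cub c := by rw [← e]; exact transformPoly_inv_left hgh _
  obtain ⟨α, β, hab⟩ := vanish_flex_span h3 (transformPoly_isHomogeneous g (flexc_isHomogeneous c)) (by
    intro a ha
    rw [← e] at ha
    rw [eval_transformPoly, eval_flexc, flexe_of_isFlex hF (flex_transform hgh hhg ha)])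
  refine ⟨α, β, ?_, hab⟩
  rintro rfl
  obtain ⟨t, r, ht, hr, htr⟩ := nonflex_point h2
  have hz : eval ![1, t, r] (hesse 0) = 0 := by
    rw [eval_hesse]; simp only [Matrix.cons_val]; linear_combination htr
  have hz1 := congrArg (MvPolynomial.eval ![1, t, r]) hab
  rw [eval_transformPoly, eval_flexc, map_add, MvPolynomial.smul_eval, MvPolynomial.smul_eval, hz] at hz1
  have hn : ![1, t, r] ≠ 0 := by intro h; simpa using congrFun h 0
  have hz2 := hz
  rw [← e, eval_transformPoly] at hz2
  have hf := isFlex_of_flexe hF (mulVec_ne_zero hhg hn) hz2 (by rw [hz1]; ring)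
  rw [← e'] at hf
  have hf2 := flex_transform hhg hgh hf
  rw [mulVec_inv hhg] at hf2
  have hs := hesse_smooth h3 (hl_zero h3)
  rw [hesse_eq_cub] at hs hf2
  have hf3 := flexe_of_isFlex hs hf2
  rw [flexe_hesse] at hf3
  simp only [Matrix.cons_val] at hf3
  have : (0 ^ 3 + 27) * (t * r) = 0 := by linear_combination hf3
  exact mul_ne_zero (hl_zero h3) (mul_ne_zero ht hr) this

theorem mapc_mem {c : ℕ → ℕ → k} (hF : IsSmoothCurve (bar (cub c)) 3) {B P R : MvPolynomial (Fin 3) (AlgebraicClosure k)}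
    (hB : B.IsHomogeneous 3) (h : MvPolynomial.aeval (ggrad (bar (cub c))) B = bar (cub c) * P + bar (flexc c) * R)
    (φ : AlgebraicClosure k →ₗ[k] k) : mapc φ B ∈ cubicsThroughTC (cub c) := by
  rw [mem_TC]
  refine ⟨mapc_isHomogeneous φ hB, fun w hw => ?_⟩
  have h1 := congrArg (mapc φ) h
  have e1 : mapc φ (bar (cub c) * P) = cub c * mapc φ P := mapc_map_mul φ _ _
  have e2 : mapc φ (bar (flexc c) * R) = flexc c * mapc φ R := mapc_map_mul φ _ _
  rw [ggrad_bar, mapc_aeval, mapc_add, e1, e2] at h1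
  have h3 := congrArg bar h1
  rw [bar_aeval, bar_add, bar_mul, bar_mul, ← ggrad_bar, bar_flexc, bar_cub] at h3
  rw [bar_cub] at hF hw
  exact infl_vanish hF (bar_isHomogeneous (mapc_isHomogeneous φ hB)) h3 hw

theorem xyz_isHomogeneous : (xyz : MvPolynomial (Fin 3) K).IsHomogeneous 3 :=
  ((isHomogeneous_X K 0).mul (isHomogeneous_X K 1)).mul (isHomogeneous_X K 2)

theorem finrank_two (h2 : (2 : k) = 0) (h3 : (3 : k) ≠ 0) {F : MvPolynomial (Fin 3) k} (hF : IsSmoothCurve (bar F) 3)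
    (hFh : F.IsHomogeneous 3)
    {g h : Matrix (Fin 3) (Fin 3) (AlgebraicClosure k)} (hgh : g * h = 1) (hhg : h * g = 1)
    (e : transformPoly g (bar F) = hesse 0) : Module.finrank k (cubicsThroughTC F) = 2 := by
  haveI : Infinite (AlgebraicClosure k) := IsAlgClosed.instInfinite
  have h3' : (3 : AlgebraicClosure k) ≠ 0 := by
    have := (_root_.map_ne_zero (algebraMap k (AlgebraicClosure k))).2 h3
    rwa [map_ofNat] at this
  have h2' : (2 : AlgebraicClosure k) = 0 := by
    have := congrArg (algebraMap k (AlgebraicClosure k)) h2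
    rwa [map_ofNat, map_zero] at this
  obtain ⟨c, rfl⟩ := exists_cub hFh
  have e' : transformPoly h (hesse 0) = bar (cub c) := by rw [← e]; exact transformPoly_inv_left hgh _
  have hF' := hF
  have e2 := e
  rw [bar_cub] at hF' e2
  obtain ⟨α, β, hb, hab⟩ := flexc_span h2' h3' hF' hgh hhg e2
  rw [← bar_flexc] at hab
  have hx : transformPoly h (xyz : MvPolynomial (Fin 3) (AlgebraicClosure k)) =
      β⁻¹ • bar (flexc c) - (β⁻¹ * α) • bar (cub c) := by
    have h1 := congrArg (transformPoly h) hab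
    rw [transformPoly_inv_left hgh, transformPoly_add, transformPoly_smul, transformPoly_smul, e'] at h1
    rw [h1, smul_add, smul_smul, smul_smul, inv_mul_cancel₀ hb, one_smul]; abel
  refine finrank_two_of (B1 := transformPoly g.transpose (hesse 0)) (B2 := transformPoly g.transpose xyz) ?_ ?_ ?_ ?_
  · rw [LinearIndependent.pair_iff]
    intro s t hst
    rw [← transformPoly_smul, ← transformPoly_smul, ← transformPoly_add] at hst
    have h1 : s • hesse 0 + t • xyz = (0 : MvPolynomial (Fin 3) (AlgebraicClosure k)) := by
      apply transform_injective (tr_inv hhg); rw [hst]; simp [transformPoly]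
    have hs := congrArg (MvPolynomial.eval ![1, 0, 0]) h1
    rw [map_add, MvPolynomial.smul_eval, MvPolynomial.smul_eval, eval_hesse, eval_xyz] at hs
    simp at hs
    have ht := congrArg (MvPolynomial.eval ![1, 1, 1]) h1
    rw [map_add, MvPolynomial.smul_eval, MvPolynomial.smul_eval, eval_hesse, eval_xyz, hs] at ht
    simp at ht
    exact ⟨hs, ht⟩
  · intro P hP
    obtain ⟨hh, hv⟩ := mem_TC.1 hP
    obtain ⟨a, b, hP2⟩ := span_two_zero h3' (transformPoly_isHomogeneous h.transpose (bar_isHomogeneous hh)) (by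
      intro w hw
      rw [eval_transformPoly]
      exact hv _ (infl_from hgh hhg e hw))
    refine ⟨a, b, ?_⟩
    rw [← transformPoly_inv_left (tr_inv hgh) (bar P), hP2, transformPoly_add, transformPoly_smul, transformPoly_smul]
  · refine mapc_mem hF (transformPoly_isHomogeneous _ (hesse_smooth h3' (hl_zero h3')).1) (P := bar (cub c)) (R := 0) ?_
    have := aeval_ggrad_transform hhg (hesse 0) (hesse 0)
    rw [e', aeval_hesse0_two h2', transformPoly_mul, e'] at this
    rw [this, mul_zero, add_zero]
  · refine mapc_mem hF (transformPoly_isHomogeneous _ xyz_isHomogeneous)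
      (P := - (27 * β⁻¹ * α) • transformPoly h xyz) (R := (27 * β⁻¹) • transformPoly h xyz) ?_
    have := aeval_ggrad_transform hhg xyz (hesse 0)
    rw [e', aeval_xyz, transformPoly_smul, transformPoly_mul] at this
    rw [this]
    nth_rewrite 1 [hx]
    simp only [MvPolynomial.smul_eq_C_mul, map_neg, map_mul]
    ring

theorem isHomogeneous_of_bar {F : MvPolynomial (Fin 3) k} {d : ℕ} (h : (bar F).IsHomogeneous d) : F.IsHomogeneous d := by
  intro m hm
  apply h
  rw [bar, MvPolynomial.coeff_map]
  exact (_root_.map_ne_zero (algebraMap k (AlgebraicClosure k))).2 hm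

theorem main_finrank (h3 : (3 : k) ≠ 0) {F : MvPolynomial (Fin 3) k} (hF : IsSmoothCurve (bar F) 3)
    {l : AlgebraicClosure k} (hl : l ^ 3 + 27 ≠ 0)
    {g h : Matrix (Fin 3) (Fin 3) (AlgebraicClosure k)} (hgh : g * h = 1) (hhg : h * g = 1)
    (e : transformPoly g (bar F) = hesse l) :
    Module.finrank k (cubicsThroughTC F) = 2 ↔ ((2 : k) = 0 ∧ HasJZero F) := by
  have h3' : (3 : AlgebraicClosure k) ≠ 0 := by
    have := (_root_.map_ne_zero (algebraMap k (AlgebraicClosure k))).2 h3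
    rwa [map_ofNat] at this
  constructor
  · intro hf
    by_contra hcon
    have hn : ¬ ((2 : AlgebraicClosure k) = 0 ∧ l = 0) := by
      rintro ⟨h2', h0⟩
      have h2 : (2 : k) = 0 := by
        apply (algebraMap k (AlgebraicClosure k)).injective
        rw [map_ofNat, map_zero]; exact h2'
      exact hcon ⟨h2, (hasJ_iff h2 h3 hgh hhg e).2 h0⟩
    obtain ⟨S, hS⟩ := span_not_two h3' hl hn
    refine finrank_ne_two (tr_inv hgh) (S := S) (fun P hP => ?_) hf
    obtain ⟨hh, hv⟩ := mem_TC.1 hP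
    refine hS _ (transformPoly_isHomogeneous h.transpose (bar_isHomogeneous hh)) ?_
    intro w hw
    rw [eval_transformPoly]
    exact hv _ (infl_from hgh hhg e hw)
  · rintro ⟨h2, hj⟩
    have h0 := (hasJ_iff h2 h3 hgh hhg e).1 hj
    subst h0
    exact finrank_two h2 h3 hF (isHomogeneous_of_bar hF.1) hgh hhg e

theorem reconstruction_of_plane_cubics
    (k : Type*) [Field k] (h3 : (3 : k) ≠ 0)
    (F : MvPolynomial (Fin 3) k) (hF : IsSmoothCurve (bar F) 3) :
    -- there is a geometrically integral curve `C′` satisfying the case conditions,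
    (∃ G : MvPolynomial (Fin 3) k,
      Irreducible (bar G) ∧ ReconstructionCond F G ∧
      -- it is unique (as a curve, i.e. up to a nonzero scalar),
      (∀ G' : MvPolynomial (Fin 3) k, Irreducible (bar G') → ReconstructionCond F G' →
        ∃ c : k, c ≠ 0 ∧ G' = c • G) ∧
      -- and it is the dual curve of `C`:
      ContainsGaussImage (bar G) (bar F)) ∧
    -- the space of cubics through `T_C` has dimension one iff `char k = 2`, `j(C) = 0`:
    (Module.finrank k (cubicsThroughTC F) = 2 ↔ ((2 : k) = 0 ∧ HasJZero F)) := by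
  have h3' : (3 : AlgebraicClosure k) ≠ 0 := by
    have := (_root_.map_ne_zero (algebraMap k (AlgebraicClosure k))).2 h3
    rwa [map_ofNat] at this
  obtain ⟨l, ⟨g, h, hgh, hhg, e⟩, hl⟩ := hesse_normal_form h3' hF
  refine ⟨?_, main_finrank h3 hF hl hgh hhg e⟩
  by_cases h2 : (2 : k) = 0
  · exact exists_two h2 h3 hF hl hgh hhg e
  · exact exists_ne2 h2 h3 hl hgh hhg e

end Infl
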